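/- (Herman–Yoccoz theorem.) Let B : ℝ → ℝ be a C^∞ function with B(x+1) = B(x) + 1 and B'(x) > 0 for all x ∈ ℝ (a lift of a smooth orientation-preserving circle diffeomorphism), and suppose its rotation number ρ = lim_{n→∞} Bⁿ(0)/n is Diophantine. Then there exists a C^∞ function Ψ : ℝ → ℝ with Ψ(x+1) = Ψ(x) + 1 and Ψ'(x) > 0 for all x, such that Ψ(B(x)) = Ψ(x) + ρ for all x ∈ ℝ; i.e. the diffeomorphism is smoothly conjugate to the rotation by ρ. -/

import Mathlib

open Filter

/-- A real number `r` is Diophantine with constants `c, β > 0` if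
`|r − p/q| ≥ c/q^(2+β)` for all `p ∈ ℤ` and all integers `q ≥ 1`. -/
def DiophantineWith (c β r : ℝ) : Prop :=
  ∀ (p : ℤ) (q : ℕ), 1 ≤ q → c / (q : ℝ) ^ (2 + β) ≤ |r - (p : ℝ) / (q : ℝ)|

/-- `r` is Diophantine if it is Diophantine with some constants `c, β > 0`. -/
def Diophantine (r : ℝ) : Prop :=
  ∃ c > (0 : ℝ), ∃ β > (0 : ℝ), DiophantineWith c β r

open scoped ContDiff

/-! ### Uniform bounds on iterated derivatives -/

/-- Uniform bounds, up to a multiplicative constant, on the derivatives of order at most `N` of a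
family of functions, at a family of points. -/
def DerivBound {ι : Type*} (N : ℕ) (φ : ι → ℝ → ℝ) (x : ι → ℝ) (W : ι → ℕ → ℝ) : Prop :=
  ∃ C : ℝ, 0 ≤ C ∧ ∀ i, ∀ j ≤ N, |iteratedDeriv j (φ i) (x i)| ≤ C * W i j

lemma smooth_deriv {f : ℝ → ℝ} (hf : ContDiff ℝ ∞ f) : ContDiff ℝ ∞ (deriv f) :=
  (contDiff_infty_iff_deriv.1 hf).2

lemma smooth_iteratedDeriv {f : ℝ → ℝ} (hf : ContDiff ℝ ∞ f) (j : ℕ) :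
    ContDiff ℝ ∞ (iteratedDeriv j f) := by
  induction j with
  | zero => simpa using hf
  | succ j ih => rw [iteratedDeriv_succ]; exact smooth_deriv ih

lemma ContDiff.diff_infty {f : ℝ → ℝ} (hf : ContDiff ℝ ∞ f) : Differentiable ℝ f :=
  hf.differentiable (by simp)

lemma ContDiff.at_nat {f : ℝ → ℝ} (hf : ContDiff ℝ ∞ f) (n : ℕ) (x : ℝ) :
    ContDiffAt ℝ n f x :=
  (hf.of_le (by exact_mod_cast le_top)).contDiffAt

namespace DerivBound

variable {ι κ : Type*} {N M : ℕ} {φ ψ : ι → ℝ → ℝ} {x : ι → ℝ} {W V U : ι → ℕ → ℝ}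

lemma mono (h : DerivBound N φ x W) (hM : M ≤ N) : DerivBound M φ x W := by
  obtain ⟨C, hC, h⟩ := h
  exact ⟨C, hC, fun i j hj => h i j (hj.trans hM)⟩

lemma weaken (h : DerivBound N φ x W) (K : ℝ) (hK : 0 ≤ K)
    (hW : ∀ i, ∀ j ≤ N, W i j ≤ K * V i j) : DerivBound N φ x V := by
  obtain ⟨C, hC, h⟩ := h
  refine ⟨C * K, by positivity, fun i j hj => (h i j hj).trans ?_⟩
  rw [mul_assoc]
  exact mul_le_mul_of_nonneg_left (hW i j hj) hC

lemma reindex (h : DerivBound N φ x W) (f : κ → ι) :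
    DerivBound N (fun k => φ (f k)) (fun k => x (f k)) (fun k => W (f k)) := by
  obtain ⟨C, hC, h⟩ := h
  exact ⟨C, hC, fun i j hj => h (f i) j hj⟩

lemma of_zero (C : ℝ) (hC : 0 ≤ C) (h : ∀ i, |φ i (x i)| ≤ C * W i 0) : DerivBound 0 φ x W := by
  refine ⟨C, hC, fun i j hj => ?_⟩
  obtain rfl : j = 0 := by omega
  simpa using h i

lemma deriv (h : DerivBound (N + 1) φ x W) :
    DerivBound N (fun i => deriv (φ i)) x (fun i j => W i (j + 1)) := by
  obtain ⟨C, hC, h⟩ := h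
  refine ⟨C, hC, fun i j hj => ?_⟩
  simpa [iteratedDeriv_succ'] using h i (j + 1) (by omega)

lemma of_deriv (h0 : DerivBound 0 φ x W)
    (h : DerivBound N (fun i => _root_.deriv (φ i)) x (fun i j => W i (j + 1)))
    (hW : ∀ i j, 0 ≤ W i j) : DerivBound (N + 1) φ x W := by
  obtain ⟨C, hC, h⟩ := h
  obtain ⟨C', hC', h'⟩ := h0
  refine ⟨C + C', by positivity, fun i j hj => ?_⟩
  rw [add_mul]
  rcases j with _ | j
  · have := h' i 0 le_rfl
    have := mul_nonneg hC (hW i 0)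
    linarith
  · have h1 := h i j (by omega)
    rw [iteratedDeriv_succ']
    have := mul_nonneg hC' (hW i (j + 1))
    linarith

lemma mul (hφ : ∀ i, ContDiff ℝ ∞ (φ i)) (hψ : ∀ i, ContDiff ℝ ∞ (ψ i))
    (h1 : DerivBound N φ x W) (h2 : DerivBound N ψ x V)
    (hW : ∀ i j, 0 ≤ W i j)
    (hWVU : ∀ i a b, a + b ≤ N → W i a * V i b ≤ U i (a + b)) :
    DerivBound N (fun i y => φ i y * ψ i y) x U := by
  obtain ⟨C, hC, h1⟩ := h1
  obtain ⟨D, hD, h2⟩ := h2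
  refine ⟨2 ^ N * (C * D), by positivity, fun i j hj => ?_⟩
  rw [iteratedDeriv_fun_mul ((hφ i).at_nat j _) ((hψ i).at_nat j _)]
  have hU : ∀ k ∈ Finset.range (j + 1),
      |(j.choose k : ℝ) * iteratedDeriv k (φ i) (x i) * iteratedDeriv (j - k) (ψ i) (x i)| ≤
        (j.choose k : ℝ) * (C * D * U i j) := by
    intro k hk
    have hk' : k ≤ j := by simpa [Nat.lt_succ_iff] using hk
    rw [abs_mul, abs_mul, Nat.abs_cast, mul_assoc]
    refine mul_le_mul_of_nonneg_left ?_ (by positivity)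
    have e1 := h1 i k (by omega)
    have e2 := h2 i (j - k) (by omega)
    have e3 := hWVU i k (j - k) (by omega)
    rw [Nat.add_sub_cancel' hk'] at e3
    calc _ ≤ (C * W i k) * (D * V i (j - k)) :=
          mul_le_mul e1 e2 (abs_nonneg _) (mul_nonneg hC (hW i k))
      _ = C * D * (W i k * V i (j - k)) := by ring
      _ ≤ _ := mul_le_mul_of_nonneg_left e3 (by positivity)
  refine (Finset.abs_sum_le_sum_abs _ _).trans ((Finset.sum_le_sum hU).trans ?_)
  rw [← Finset.sum_mul, ← Nat.cast_sum, Nat.sum_range_choose]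
  have hU0 : 0 ≤ C * D * U i j := by
    have := hU 0 (by simp)
    simp at this
    exact (by positivity : (0:ℝ) ≤ _).trans this
  have : ((2 ^ j : ℕ) : ℝ) ≤ 2 ^ N := by
    push_cast
    exact pow_le_pow_right₀ (by norm_num) hj
  calc _ ≤ 2 ^ N * (C * D * U i j) := mul_le_mul_of_nonneg_right this hU0
    _ = _ := by ring

lemma add (hφ : ∀ i, ContDiff ℝ ∞ (φ i)) (hψ : ∀ i, ContDiff ℝ ∞ (ψ i))
    (h1 : DerivBound N φ x W) (h2 : DerivBound N ψ x W) :
    DerivBound N (fun i y => φ i y + ψ i y) x W := by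
  obtain ⟨C, hC, h1⟩ := h1
  obtain ⟨D, hD, h2⟩ := h2
  refine ⟨C + D, by positivity, fun i j hj => ?_⟩
  have : iteratedDeriv j (fun y => φ i y + ψ i y) (x i) = _ :=
    iteratedDeriv_add ((hφ i).at_nat j _) ((hψ i).at_nat j _)
  rw [this, add_mul]
  exact (abs_add_le _ _).trans (add_le_add (h1 i j hj) (h2 i j hj))

lemma const_mul (c : ι → ℝ) (h1 : DerivBound N φ x W) (K : ℝ) (hK : 0 ≤ K)
    (hc : ∀ i, ∀ j ≤ N, |c i| * W i j ≤ K * V i j) :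
    DerivBound N (fun i y => c i * φ i y) x V := by
  obtain ⟨C, hC, h1⟩ := h1
  refine ⟨C * K, by positivity, fun i j hj => ?_⟩
  rw [iteratedDeriv_const_mul_field, abs_mul]
  calc _ ≤ |c i| * (C * W i j) := mul_le_mul_of_nonneg_left (h1 i j hj) (abs_nonneg _)
    _ = C * (|c i| * W i j) := by ring
    _ ≤ C * (K * V i j) := mul_le_mul_of_nonneg_left (hc i j hj) hC
    _ = _ := by ring

/-- Composition: `X i s a` bounds the `a`-th derivative of `(φ i)^{(s)} ∘ u i`. -/
lemma comp {u : ι → ℝ → ℝ} {X : ι → ℕ → ℕ → ℝ} {Z : ι → ℕ → ℝ}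
    (hφ : ∀ i, ContDiff ℝ ∞ (φ i)) (hu : ∀ i, ContDiff ℝ ∞ (u i))
    (h1 : DerivBound N φ (fun i => u i (x i)) (fun i s => X i s 0))
    (h2 : DerivBound N (fun i => _root_.deriv (u i)) x Z)
    (hX : ∀ i s a, 0 ≤ X i s a)
    (hXZ : ∀ i s a b, X i (s + 1) a * Z i b ≤ X i s (a + b + 1)) :
    DerivBound N (fun i y => φ i (u i y)) x (fun i => X i 0) := by
  have key : ∀ a s : ℕ, s + a ≤ N →
      DerivBound a (fun i y => iteratedDeriv s (φ i) (u i y)) x (fun i => X i s) := by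
    intro a
    induction a with
    | zero =>
      intro s hs
      obtain ⟨C, hC, h1⟩ := h1
      exact of_zero C hC fun i => by simpa using h1 i s (by omega)
    | succ a ih =>
      intro s hs
      refine of_deriv ((ih s (by omega)).mono (Nat.zero_le _)) ?_ (fun i j => hX i s j)
      have hd : ∀ i, _root_.deriv (fun y => iteratedDeriv s (φ i) (u i y)) =
          fun y => iteratedDeriv (s + 1) (φ i) (u i y) * _root_.deriv (u i) y := by
        intro i
        funext y
        have e1 := ((smooth_iteratedDeriv (hφ i) s).diff_infty (u i y)).hasDerivAt
        have e2 := ((hu i).diff_infty y).hasDerivAt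
        rw [iteratedDeriv_succ]
        exact (e1.comp y e2).deriv
      simp only [hd]
      exact mul (fun i => (smooth_iteratedDeriv (hφ i) _).comp (hu i)) (fun i => smooth_deriv (hu i))
        (ih (s + 1) (by omega)) (h2.mono (by omega)) (fun i j => hX i (s + 1) j)
        (fun i p q _ => hXZ i s p q)
  simpa using key N 0 (by omega)

lemma inv (hφ : ∀ i, ContDiff ℝ ∞ (φ i)) (h : DerivBound N φ x W)
    (c : ℝ) (hc : 0 < c) (hcφ : ∀ i y, c ≤ φ i y)
    (hW0 : ∀ i, W i 0 = 1) (hW : ∀ i j, 0 ≤ W i j)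
    (hWW : ∀ i a b, W i a * W i b ≤ W i (a + b)) :
    DerivBound N (fun i y => (φ i y)⁻¹) x W := by
  have hpos : ∀ i y, 0 < φ i y := fun i y => hc.trans_le (hcφ i y)
  have hs : ∀ i, ContDiff ℝ ∞ (fun y => (φ i y)⁻¹) := fun i =>
    (hφ i).inv fun y => (hpos i y).ne'
  induction N with
  | zero =>
    refine of_zero c⁻¹ (by positivity) fun i => ?_
    rw [hW0, mul_one, abs_of_pos (inv_pos.2 (hpos i _))]
    exact inv_anti₀ hc (hcφ i _)
  | succ N ih =>
    have ih := ih (h.mono (by omega))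
    refine of_deriv (ih.mono (Nat.zero_le _)) ?_ hW
    have hd : ∀ i, _root_.deriv (fun y => (φ i y)⁻¹) =
        fun y => -1 * (_root_.deriv (φ i) y * ((φ i y)⁻¹ * (φ i y)⁻¹)) := by
      intro i
      funext y
      rw [(((hφ i).diff_infty y).hasDerivAt.fun_inv (hpos i y).ne').deriv]
      field_simp
    simp only [hd]
    refine const_mul (W := fun i j => W i (j + 1)) (fun _ => -1) ?_ 1 zero_le_one (by simp)
    refine mul (V := W) (fun i => smooth_deriv (hφ i)) (fun i => (hs i).mul (hs i)) h.deriv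
      (mul hs hs ih ih hW fun i a b _ => hWW i a b) (fun i j => hW i _) fun i a b _ => ?_
    have := hWW i (a + 1) b
    rwa [show a + 1 + b = a + b + 1 by ring] at this

end DerivBound

/-! ### Interpolation -/

lemma exists_deriv_eq_slope_bound {f : ℝ → ℝ} (hf : ContDiff ℝ ∞ f) {a b m η : ℝ} (hm : 0 < m)
    (hab : a + m ≤ b) (ha : |f a| ≤ η) (hb : |f b| ≤ η) :
    ∃ c ∈ Set.Icc a b, |deriv f c| ≤ 2 * η / m := by
  obtain ⟨c, hc, h⟩ := exists_deriv_eq_slope f (by linarith : a < b)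
    hf.continuous.continuousOn hf.diff_infty.differentiableOn
  refine ⟨c, Set.Ioo_subset_Icc_self hc, ?_⟩
  rw [h, abs_div, abs_of_pos (by linarith : 0 < b - a)]
  have : |f b - f a| ≤ 2 * η := by
    have := abs_sub (f b) (f a)
    linarith
  have h0 : 0 ≤ η := (abs_nonneg _).trans ha
  exact div_le_div₀ (by linarith) this hm (by linarith)

lemma abs_sub_le_of_abs_deriv_le {f : ℝ → ℝ} (hf : Differentiable ℝ f) {a b Q : ℝ}
    (h : ∀ x ∈ Set.Icc a b, |deriv f x| ≤ Q) {x y : ℝ} (hx : x ∈ Set.Icc a b)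
    (hy : y ∈ Set.Icc a b) : |f x - f y| ≤ Q * |x - y| := by
  simpa [Real.norm_eq_abs] using (convex_Icc a b).norm_image_sub_le_of_norm_deriv_le
    (fun z _ => hf z) (fun z hz => by simpa using h z hz) hy hx

/-- A function with a bounded derivative of order `k` that is small at `2 ^ k` separated nodes is
small together with its derivatives of order less than `k`. -/
lemma exists_interpolation_bound (k : ℕ) (D : ℝ) (hD : 0 ≤ D) :
    ∃ C : ℝ, 0 ≤ C ∧ ∀ (f : ℝ → ℝ) (z : ℕ → ℝ) (a b m η Q : ℝ), ContDiff ℝ ∞ f → 0 < m →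
      b - a ≤ D * m → (∀ i < 2 ^ k, z i ∈ Set.Icc a b) →
      (∀ i, i + 1 < 2 ^ k → z i + m ≤ z (i + 1)) → (∀ i < 2 ^ k, |f (z i)| ≤ η) →
      (∀ x ∈ Set.Icc a b, |iteratedDeriv k f x| ≤ Q) →
      ∀ j < k, ∀ x ∈ Set.Icc a b, |iteratedDeriv j f x| * m ^ j ≤ C * (η + Q * m ^ k) := by
  induction k with
  | zero => exact ⟨0, le_rfl, fun _ _ _ _ _ _ _ _ _ _ _ _ _ _ j hj => by omega⟩
  | succ k ih =>
    obtain ⟨C, hC, ih⟩ := ih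
    refine ⟨2 * C + 1 + D * (2 * C + 1), by positivity, ?_⟩
    intro f z a b m η Q hf hm hab hz hgap hη hQ j hj x hx
    have hη0 : 0 ≤ η := (abs_nonneg _).trans (hη 0 (by positivity))
    have hQ0 : 0 ≤ Q := (abs_nonneg _).trans (hQ x hx)
    have hpow : (2:ℕ) ^ (k + 1) = 2 * 2 ^ k := by ring
    have hnode : ∀ i, ∃ c, i < 2 ^ k → (c ∈ Set.Icc (z (2 * i)) (z (2 * i + 1)) ∧
        |deriv f c| ≤ 2 * η / m) := by
      intro i
      by_cases hi : i < 2 ^ k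
      · obtain ⟨c, hc, h⟩ := exists_deriv_eq_slope_bound hf hm (hgap (2 * i) (by omega))
          (hη _ (by omega)) (hη _ (by omega))
        exact ⟨c, fun _ => ⟨hc, h⟩⟩
      · exact ⟨0, fun h => absurd h hi⟩
    choose c hc using hnode
    have hd : ∀ j < k + 1, ∀ x ∈ Set.Icc a b,
        |iteratedDeriv j (deriv f) x| * m ^ (j + 1) ≤ (2 * C + 1) * (η + Q * m ^ (k + 1)) := by
      intro j hj x hx
      have hpos : 0 ≤ Q * m ^ (k + 1) := by positivity
      rcases Nat.lt_succ_iff_lt_or_eq.1 hj with hj | rfl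
      · have := ih (deriv f) c a b m (2 * η / m) Q (smooth_deriv hf) hm hab
          (fun i hi => ⟨(hz (2 * i) (by omega)).1.trans (hc i hi).1.1,
            (hc i hi).1.2.trans (hz (2 * i + 1) (by omega)).2⟩)
          (fun i hi => by
            have h1 := (hc i (by omega)).1.2
            have h2 := (hc (i + 1) hi).1.1
            have h3 := hgap (2 * i + 1) (by omega)
            rw [show 2 * (i + 1) = 2 * i + 1 + 1 by ring] at h2
            linarith)
          (fun i hi => (hc i hi).2)
          (fun x hx => by simpa [iteratedDeriv_succ'] using hQ x hx) j hj x hx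
        calc _ = (|iteratedDeriv j (deriv f) x| * m ^ j) * m := by ring
          _ ≤ (C * (2 * η / m + Q * m ^ k)) * m := mul_le_mul_of_nonneg_right this hm.le
          _ = C * (2 * η + Q * m ^ (k + 1)) := by field_simp; ring
          _ ≤ _ := by nlinarith [mul_nonneg hC hpos, mul_nonneg hC hη0]
      · have h1 := hQ x hx
        rw [iteratedDeriv_succ'] at h1
        have h2 := mul_le_mul_of_nonneg_right h1 (by positivity : 0 ≤ m ^ (j + 1))
        nlinarith [mul_nonneg hC hpos, mul_nonneg hC hη0]
    have hS : 0 ≤ η + Q * m ^ (k + 1) := by positivity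
    rcases j with _ | j
    · have h1 : ∀ x ∈ Set.Icc a b, |deriv f x| ≤ (2 * C + 1) * (η + Q * m ^ (k + 1)) / m := by
        intro x hx
        rw [le_div_iff₀ hm]
        simpa using hd 0 (by omega) x hx
      have h0 := hz 0 (by positivity)
      have h2 := abs_sub_le_of_abs_deriv_le hf.diff_infty h1 hx h0
      have h3 : |x - z 0| ≤ D * m := by
        rw [abs_le]
        constructor <;> linarith [hx.1, hx.2, h0.1, h0.2]
      have h4 := hη 0 (by positivity)
      have h5 : (2 * C + 1) * (η + Q * m ^ (k + 1)) / m * |x - z 0| ≤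
          D * (2 * C + 1) * (η + Q * m ^ (k + 1)) := by
        calc _ ≤ (2 * C + 1) * (η + Q * m ^ (k + 1)) / m * (D * m) :=
              mul_le_mul_of_nonneg_left h3 (by positivity)
          _ = _ := by field_simp
      have h6 : |f x| ≤ |f x - f (z 0)| + |f (z 0)| := by
        simpa using abs_add_le (f x - f (z 0)) (f (z 0))
      have h7 : 0 ≤ Q * m ^ (k + 1) := by positivity
      simp only [iteratedDeriv_zero, pow_zero, mul_one]
      nlinarith [mul_nonneg hC hη0, mul_nonneg hC h7]
    · have := hd j (by omega) x hx
      rw [iteratedDeriv_succ']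
      nlinarith [mul_nonneg hD (mul_nonneg (by positivity : 0 ≤ 2 * C + 1) hS)]

/-- The Landau–Kolmogorov inequality, with a free scale `m`. -/
lemma exists_landau_bound (k : ℕ) :
    ∃ C : ℝ, 0 ≤ C ∧ ∀ (f : ℝ → ℝ) (m η Q : ℝ), ContDiff ℝ ∞ f → 0 < m →
      (∀ x, |f x| ≤ η) → (∀ x, |iteratedDeriv k f x| ≤ Q) →
      ∀ j < k, ∀ x, |iteratedDeriv j f x| * m ^ j ≤ C * (η + Q * m ^ k) := by
  obtain ⟨C, hC, h⟩ := exists_interpolation_bound k (2 ^ k) (by positivity)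
  refine ⟨C, hC, fun f m η Q hf hm hη hQ j hj x => ?_⟩
  refine h f (fun i => x + i * m) x (x + 2 ^ k * m) m η Q hf hm (by linarith) ?_ ?_
    (fun _ _ => hη _) (fun _ _ => hQ _) j hj x ⟨le_rfl, by simp; positivity⟩
  · intro i hi
    have : (i : ℝ) ≤ 2 ^ k := by exact_mod_cast hi.le
    exact ⟨by simp; positivity, by simpa using mul_le_mul_of_nonneg_right this hm.le⟩
  · intro i _
    push_cast
    linarith

/-! ### Integrals depending on a parameter -/

lemma contDiff_partial_deriv {k : ℝ → ℝ → ℝ} (hk : ContDiff ℝ ∞ (fun p : ℝ × ℝ => k p.1 p.2)) :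
    ContDiff ℝ ∞ (fun p : ℝ × ℝ => deriv (k p.1) p.2) := by
  have h : (fun p : ℝ × ℝ => deriv (k p.1) p.2) =
      fun p => fderiv ℝ (fun p : ℝ × ℝ => k p.1 p.2) p (0, 1) := by
    funext p
    have h1 : HasDerivAt (fun y : ℝ => (p.1, y)) ((0, 1) : ℝ × ℝ) p.2 :=
      (hasDerivAt_const p.2 p.1).prodMk (hasDerivAt_id p.2)
    have h2 := ((hk.differentiable (by simp)) (p.1, p.2)).hasFDerivAt
    exact (h2.comp_hasDerivAt p.2 h1).deriv
  rw [h]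
  exact (hk.fderiv_right (m := ∞) (by simp)).clm_apply contDiff_const

lemma hasDerivAt_param_integral {k : ℝ → ℝ → ℝ}
    (hk : ContDiff ℝ ∞ (fun p : ℝ × ℝ => k p.1 p.2)) (x : ℝ) :
    HasDerivAt (fun y => ∫ t in (0:ℝ)..1, k t y) (∫ t in (0:ℝ)..1, deriv (k t) x) x := by
  have hk' := contDiff_partial_deriv hk
  obtain ⟨C, hC⟩ := (isCompact_Icc.prod isCompact_Icc : IsCompact
    (Set.Icc (0:ℝ) 1 ×ˢ Set.Icc (x - 1) (x + 1))).exists_bound_of_continuousOn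
      hk'.continuous.continuousOn
  have c1 : ∀ y, Continuous (fun t => k t y) := fun y =>
    hk.continuous.comp (continuous_id.prodMk continuous_const)
  have c2 : Continuous (fun t => deriv (k t) x) :=
    hk'.continuous.comp (continuous_id.prodMk continuous_const)
  refine (intervalIntegral.hasDerivAt_integral_of_dominated_loc_of_deriv_le
    (F := fun y t => k t y) (F' := fun y t => deriv (k t) y) (bound := fun _ => C)
    (Icc_mem_nhds (by linarith : x - 1 < x) (by linarith : x < x + 1))
    (Eventually.of_forall fun y => (c1 y).aestronglyMeasurable)
    ((c1 x).intervalIntegrable _ _) c2.aestronglyMeasurable ?_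
    (by simp) ?_).2
  · refine Eventually.of_forall fun t ht y hy => hC (t, y) ⟨?_, hy⟩
    rw [Set.uIoc_of_le zero_le_one] at ht
    exact Set.Ioc_subset_Icc_self ht
  · refine Eventually.of_forall fun t _ y _ => ?_
    have : ContDiff ℝ ∞ (k t) := hk.comp (contDiff_const.prodMk contDiff_id)
    exact (this.diff_infty y).hasDerivAt

lemma iteratedDeriv_param_integral {k : ℝ → ℝ → ℝ}
    (hk : ContDiff ℝ ∞ (fun p : ℝ × ℝ => k p.1 p.2)) (j : ℕ) :
    iteratedDeriv j (fun y => ∫ t in (0:ℝ)..1, k t y) =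
      fun y => ∫ t in (0:ℝ)..1, iteratedDeriv j (k t) y := by
  induction j generalizing k with
  | zero => simp
  | succ j ih =>
    rw [iteratedDeriv_succ']
    have : deriv (fun y => ∫ t in (0:ℝ)..1, k t y) = fun y => ∫ t in (0:ℝ)..1, deriv (k t) y :=
      funext fun y => (hasDerivAt_param_integral hk y).deriv
    rw [this, ih (k := fun t => deriv (k t)) (contDiff_partial_deriv hk)]
    simp [iteratedDeriv_succ']

lemma contDiff_param_integral {k : ℝ → ℝ → ℝ}
    (hk : ContDiff ℝ ∞ (fun p : ℝ × ℝ => k p.1 p.2)) :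
    ContDiff ℝ ∞ (fun y => ∫ t in (0:ℝ)..1, k t y) := by
  refine contDiff_of_differentiable_iteratedDeriv fun j _ => ?_
  rw [iteratedDeriv_param_integral hk]
  have hj : ∀ j : ℕ, ContDiff ℝ ∞ (fun p : ℝ × ℝ => iteratedDeriv j (k p.1) p.2) := by
    intro j
    induction j with
    | zero => simpa using hk
    | succ j ih => simpa only [iteratedDeriv_succ] using
        contDiff_partial_deriv (k := fun t => iteratedDeriv j (k t)) ih
  exact fun y => (hasDerivAt_param_integral (hj j) y).differentiableAt

/-- Bounds on a parametric family of functions carry over to its average. -/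
lemma DerivBound.param_integral {ι : Type*} {N : ℕ} {k : ι → ℝ → ℝ → ℝ} {x : ι → ℝ}
    {W : ι → ℕ → ℝ} (hk : ∀ i, ContDiff ℝ ∞ (fun p : ℝ × ℝ => k i p.1 p.2))
    (h : DerivBound N (fun i : ι × Set.Icc (0:ℝ) 1 => k i.1 i.2) (fun i => x i.1)
      (fun i => W i.1)) :
    DerivBound N (fun i y => ∫ t in (0:ℝ)..1, k i t y) x W := by
  obtain ⟨C, hC, h⟩ := h
  refine ⟨C, hC, fun i j hj => ?_⟩
  rw [iteratedDeriv_param_integral (hk i)]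
  have := intervalIntegral.norm_integral_le_of_norm_le_const (a := 0) (b := 1)
    (f := fun t => iteratedDeriv j (k i t) (x i)) (C := C * W i j) (fun t ht => by
      rw [Set.uIoc_of_le zero_le_one] at ht
      exact h (i, ⟨t, Set.Ioc_subset_Icc_self ht⟩) j hj)
  simpa using this

/-! ### Disjoint intervals -/

open MeasureTheory in
lemma sum_length_le_of_disjoint {ι : Type*} (s : Finset ι) (a b : ι → ℝ) (A A' : ℝ)
    (hA : A ≤ A') (hab : ∀ i ∈ s, a i ≤ b i) (h1 : ∀ i ∈ s, A ≤ a i) (h2 : ∀ i ∈ s, b i ≤ A')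
    (hd : ∀ i ∈ s, ∀ j ∈ s, i ≠ j → b i ≤ a j ∨ b j ≤ a i) :
    ∑ i ∈ s, (b i - a i) ≤ A' - A := by
  have hdisj : Set.PairwiseDisjoint (s : Set ι) (fun i => Set.Ioo (a i) (b i)) := by
    intro i hi j hj hij
    rw [Function.onFun, Set.disjoint_left]
    intro y hy hy'
    rcases hd i hi j hj hij with h | h
    · linarith [hy.2, hy'.1]
    · linarith [hy.1, hy'.2]
  have h := measure_biUnion_finset (μ := volume) hdisj (fun i _ => measurableSet_Ioo)
  have hle : volume (⋃ i ∈ s, Set.Ioo (a i) (b i)) ≤ volume (Set.Icc A A') := by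
    refine measure_mono (Set.iUnion₂_subset fun i hi y hy => ?_)
    exact ⟨(h1 i hi).trans hy.1.le, hy.2.le.trans (h2 i hi)⟩
  rw [h] at hle
  simp only [Real.volume_Ioo, Real.volume_Icc] at hle
  rw [← ENNReal.ofReal_sum_of_nonneg (fun i hi => by linarith [hab i hi])] at hle
  exact (ENNReal.ofReal_le_ofReal_iff (by linarith)).1 hle

/-! ### Continued fractions -/

/-- Two consecutive terms of the sequence of distances to the rotation orbit. -/
noncomputable def cfPair (ρ : ℝ) : ℕ → ℝ × ℝ
  | 0 => (1, Int.fract ρ)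
  | n + 1 => ((cfPair ρ n).2,
      (cfPair ρ n).1 - ⌊(cfPair ρ n).1 / (cfPair ρ n).2⌋₊ * (cfPair ρ n).2)

/-- The distance `|q_n ρ - p_n|`. -/
noncomputable def cfDist (ρ : ℝ) (n : ℕ) : ℝ := (cfPair ρ n).1

/-- The partial quotients. -/
noncomputable def cfCoeff (ρ : ℝ) (n : ℕ) : ℕ := ⌊cfDist ρ n / cfDist ρ (n + 1)⌋₊

/-- The denominators of the convergents. -/
noncomputable def cfDen (ρ : ℝ) : ℕ → ℕ
  | 0 => 0
  | 1 => 1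
  | n + 2 => cfCoeff ρ n * cfDen ρ (n + 1) + cfDen ρ n

/-- The numerators of the convergents. -/
noncomputable def cfNum (ρ : ℝ) : ℕ → ℤ
  | 0 => 1
  | 1 => ⌊ρ⌋
  | n + 2 => cfCoeff ρ n * cfNum ρ (n + 1) + cfNum ρ n

/-- The sign of `q_n ρ - p_n`. -/
noncomputable def cfSign (n : ℕ) : ℝ := (-1) ^ (n + 1)

lemma cfSign_succ (n : ℕ) : cfSign (n + 1) = -cfSign n := by
  simp [cfSign, pow_succ]

lemma cfSign_mul_self (n : ℕ) : cfSign n * cfSign n = 1 := by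
  simp [cfSign, ← mul_pow]

lemma cfSign_eq (n : ℕ) : cfSign n = 1 ∨ cfSign n = -1 := neg_one_pow_eq_or ℝ _

lemma abs_cfSign (n : ℕ) : |cfSign n| = 1 := by simp [cfSign]

lemma cfDist_zero (ρ : ℝ) : cfDist ρ 0 = 1 := rfl

lemma cfDist_one (ρ : ℝ) : cfDist ρ 1 = Int.fract ρ := rfl

lemma cfPair_snd (ρ : ℝ) (n : ℕ) : (cfPair ρ n).2 = cfDist ρ (n + 1) := by
  cases n <;> rfl

lemma cfDist_add_two (ρ : ℝ) (n : ℕ) :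
    cfDist ρ (n + 2) = cfDist ρ n - cfCoeff ρ n * cfDist ρ (n + 1) := by
  rw [cfCoeff, ← cfPair_snd ρ n, ← cfPair_snd ρ (n + 1)]
  rfl

lemma cfDist_eq (ρ : ℝ) (n : ℕ) :
    cfDist ρ n = cfSign n * (cfDen ρ n * ρ - cfNum ρ n) := by
  induction n using Nat.twoStepInduction with
  | zero => simp [cfDist_zero, cfSign, cfDen, cfNum]
  | one => simp [cfDist_one, cfSign, cfDen, cfNum, Int.self_sub_floor]
  | more n h1 h2 =>
    rw [cfDist_add_two, h1, h2, cfSign_succ (n + 1), cfSign_succ n]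
    simp only [cfDen, cfNum]
    push_cast
    ring

section Irrational

variable {ρ : ℝ} (hρ : Irrational ρ)
include hρ

lemma int_mul_add_ne_zero (i k : ℤ) (h : i ≠ 0 ∨ k ≠ 0) : (i : ℝ) * ρ + k ≠ 0 := by
  intro h0
  by_cases hi : i = 0
  · subst hi
    simp at h0
    omega
  · exact ((hρ.intCast_mul hi).add_intCast k).ne_zero h0

lemma cfDist_pos_aux (n : ℕ) :
    0 < cfDist ρ (n + 1) ∧ cfDist ρ (n + 1) < cfDist ρ n ∧ 1 ≤ cfDen ρ (n + 1) := by
  induction n with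
  | zero =>
    refine ⟨?_, ?_, by simp [cfDen]⟩
    · rw [cfDist_one]
      refine lt_of_le_of_ne (Int.fract_nonneg ρ) fun h => ?_
      exact int_mul_add_ne_zero hρ 1 (-⌊ρ⌋) (Or.inl one_ne_zero)
        (by rw [Int.fract] at h; push_cast; linarith)
    · simpa [cfDist_one, cfDist_zero] using Int.fract_lt_one ρ
  | succ n ih =>
    obtain ⟨h0, h1, h2⟩ := ih
    have hden : 1 ≤ cfDen ρ (n + 2) := by
      have hc : 1 ≤ cfCoeff ρ n := by
        refine Nat.le_floor ?_
        rw [Nat.cast_one, one_le_div h0]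
        exact h1.le
      simp only [cfDen]
      nlinarith
    refine ⟨?_, ?_, hden⟩
    · have hle : 0 ≤ cfDist ρ (n + 2) := by
        rw [cfDist_add_two]
        have := Nat.floor_le (div_nonneg (h0.trans h1).le h0.le)
        rw [le_div_iff₀ h0] at this
        simpa [cfCoeff] using this
      refine lt_of_le_of_ne hle fun h => ?_
      rw [cfDist_eq] at h
      refine int_mul_add_ne_zero hρ (cfDen ρ (n + 2)) (-cfNum ρ (n + 2)) (Or.inl ?_) ?_
      · exact_mod_cast (by omega : cfDen ρ (n + 2) ≠ 0)
      · rcases cfSign_eq (n + 2) with h' | h' <;> rw [h'] at h <;> push_cast <;> linarith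
    · rw [cfDist_add_two]
      have := Nat.lt_floor_add_one (cfDist ρ n / cfDist ρ (n + 1))
      rw [div_lt_iff₀ h0] at this
      simp only [cfCoeff]
      linarith

lemma cfDist_pos (n : ℕ) : 0 < cfDist ρ n := by
  rcases n with _ | n
  · simp [cfDist_zero]
  · exact (cfDist_pos_aux hρ n).1

lemma cfDist_succ_lt (n : ℕ) : cfDist ρ (n + 1) < cfDist ρ n := (cfDist_pos_aux hρ n).2.1

lemma one_le_cfDen_succ (n : ℕ) : 1 ≤ cfDen ρ (n + 1) := (cfDist_pos_aux hρ n).2.2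

lemma cfDist_antitone : Antitone (cfDist ρ) :=
  antitone_nat_of_succ_le fun n => (cfDist_succ_lt hρ n).le

lemma cfDist_le_one (n : ℕ) : cfDist ρ n ≤ 1 := cfDist_antitone hρ (Nat.zero_le n)

lemma one_le_cfCoeff (n : ℕ) : 1 ≤ cfCoeff ρ n := by
  refine Nat.le_floor ?_
  rw [Nat.cast_one, one_le_div (cfDist_pos hρ _)]
  exact (cfDist_succ_lt hρ n).le

lemma cfDist_le_coeff (n : ℕ) : cfDist ρ n ≤ 2 * cfCoeff ρ n * cfDist ρ (n + 1) := by
  have h := cfDist_add_two ρ n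
  have h1 := cfDist_succ_lt hρ (n + 1)
  have h2 : (1 : ℝ) ≤ cfCoeff ρ n := by exact_mod_cast one_le_cfCoeff hρ n
  nlinarith [cfDist_pos hρ (n + 1)]

lemma cfDist_add_two_le_half (n : ℕ) : cfDist ρ (n + 2) ≤ cfDist ρ n / 2 := by
  have h := cfDist_add_two ρ n
  have h1 := cfDist_succ_lt hρ (n + 1)
  have h2 : (1 : ℝ) ≤ cfCoeff ρ n := by exact_mod_cast one_le_cfCoeff hρ n
  nlinarith [cfDist_pos hρ (n + 1)]

lemma cfDen_le_succ (n : ℕ) : cfDen ρ n ≤ cfDen ρ (n + 1) := by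
  rcases n with _ | n
  · simp [cfDen]
  · have := one_le_cfCoeff hρ n
    simp only [cfDen]
    nlinarith

omit hρ in
lemma cfDen_mul_cfDist (ρ : ℝ) (n : ℕ) :
    cfDen ρ (n + 1) * cfDist ρ n + cfDen ρ n * cfDist ρ (n + 1) = 1 := by
  induction n with
  | zero => simp [cfDen, cfDist_zero]
  | succ n ih =>
    rw [cfDist_add_two]
    simp only [cfDen]
    push_cast
    linarith

lemma cfDen_mul_cfDist_le (n : ℕ) : cfDen ρ (n + 1) * cfDist ρ n ≤ 1 := by
  have := cfDen_mul_cfDist ρ n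
  have := mul_nonneg (Nat.cast_nonneg (α := ℝ) (cfDen ρ n)) (cfDist_pos hρ (n + 1)).le
  linarith

omit hρ in
lemma cf_det (n : ℕ) : (cfDen ρ (n + 1) * cfNum ρ n - cfDen ρ n * cfNum ρ (n + 1) : ℤ) =
    (-1) ^ n := by
  induction n with
  | zero => simp [cfDen, cfNum]
  | succ n ih =>
    rw [pow_succ, ← ih]
    simp only [cfDen, cfNum]
    push_cast
    ring

/-- Best approximation property. -/
lemma cfDist_le_abs (n : ℕ) (i k : ℤ) (hi : |i| < cfDen ρ (n + 1)) (hik : i ≠ 0 ∨ k ≠ 0) :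
    cfDist ρ n ≤ |(i : ℝ) * ρ + k| := by
  have hdet := cf_det (ρ := ρ) n
  obtain ⟨u, v, hu, hv⟩ : ∃ u v : ℤ, i = u * cfDen ρ n + v * cfDen ρ (n + 1) ∧
      -k = u * cfNum ρ n + v * cfNum ρ (n + 1) := by
    have hs : ((-1 : ℤ) ^ n) * (-1) ^ n = 1 := by rw [← mul_pow]; simp
    refine ⟨(-1) ^ n * (-k * cfDen ρ (n + 1) - i * cfNum ρ (n + 1)),
      (-1) ^ n * (i * cfNum ρ n + k * cfDen ρ n), ?_, ?_⟩
    · linear_combination (-(-1) ^ n * i) * hdet - i * hs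
    · linear_combination ((-1) ^ n * k) * hdet + k * hs
  have hval : (i : ℝ) * ρ + k = cfSign n * (u * cfDist ρ n - v * cfDist ρ (n + 1)) := by
    have hk : (k : ℝ) = -(u * cfNum ρ n + v * cfNum ρ (n + 1)) := by
      exact_mod_cast (by linarith : k = -(u * cfNum ρ n + v * cfNum ρ (n + 1)))
    rw [hk, hu, cfDist_eq ρ n, cfDist_eq ρ (n + 1), cfSign_succ]
    push_cast
    linear_combination (-(u * (cfDen ρ n * ρ - cfNum ρ n)) -
      v * (cfDen ρ (n + 1) * ρ - cfNum ρ (n + 1))) * cfSign_mul_self n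
  rw [hval, abs_mul, abs_cfSign, one_mul]
  have hα := cfDist_pos hρ n
  have hα' := cfDist_pos hρ (n + 1)
  have hq : (1 : ℤ) ≤ cfDen ρ (n + 1) := by exact_mod_cast one_le_cfDen_succ hρ n
  have hq0 : (0 : ℤ) ≤ cfDen ρ n := by positivity
  rw [abs_lt] at hi
  rcases lt_trichotomy v 0 with hv0 | hv0 | hv0
  · have : 0 < u := by
      by_contra hu0
      push Not at hu0
      have : i ≤ -cfDen ρ (n + 1) := by rw [hu]; nlinarith
      omega
    have h1 : (1 : ℝ) ≤ u := by exact_mod_cast this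
    have h2 : (v : ℝ) ≤ 0 := by exact_mod_cast hv0.le
    exact le_trans (by nlinarith) (le_abs_self _)
  · subst hv0
    have hu0 : u ≠ 0 := by
      rintro rfl
      simp at hu hv
      omega
    have : (1 : ℝ) ≤ |(u : ℝ)| := by exact_mod_cast Int.one_le_abs hu0
    rw [Int.cast_zero, zero_mul, sub_zero, abs_mul, abs_of_pos hα]
    nlinarith
  · have : u < 0 := by
      by_contra hu0
      push Not at hu0
      have : (cfDen ρ (n + 1) : ℤ) ≤ i := by rw [hu]; nlinarith
      omega
    have h1 : (u : ℝ) ≤ -1 := by exact_mod_cast (by omega : u ≤ -1)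
    have h2 : (0 : ℝ) ≤ v := by exact_mod_cast hv0.le
    exact le_trans (by nlinarith) (neg_le_abs _)

lemma le_cfDist_succ {c β : ℝ} (hc : 0 < c) (hβ : 0 < β) (h : DiophantineWith c β ρ) (n : ℕ) :
    c * cfDist ρ n ^ (1 + β) ≤ cfDist ρ (n + 1) := by
  have hq : (1 : ℝ) ≤ cfDen ρ (n + 1) := by exact_mod_cast one_le_cfDen_succ hρ n
  have hq0 : (0 : ℝ) < cfDen ρ (n + 1) := by linarith
  have hα := cfDist_pos hρ n
  have h1 := h (cfNum ρ (n + 1)) (cfDen ρ (n + 1)) (one_le_cfDen_succ hρ n)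
  have h2 : cfDist ρ (n + 1) = cfDen ρ (n + 1) * |ρ - cfNum ρ (n + 1) / cfDen ρ (n + 1)| := by
    rw [← abs_of_pos (cfDist_pos hρ (n + 1)), cfDist_eq, abs_mul, abs_cfSign, one_mul,
      ← abs_of_pos hq0, ← abs_mul, abs_of_pos hq0]
    congr 1
    field_simp
  rw [h2]
  have h3 : cfDist ρ n ^ (1 + β) ≤ ((cfDen ρ (n + 1) : ℝ) ^ (1 + β))⁻¹ := by
    rw [← Real.inv_rpow hq0.le]
    refine Real.rpow_le_rpow hα.le ?_ (by linarith)
    rw [le_inv_comm₀ hα hq0, ← one_div, le_div_iff₀ hα]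
    exact cfDen_mul_cfDist_le hρ n
  calc c * cfDist ρ n ^ (1 + β) ≤ c * ((cfDen ρ (n + 1) : ℝ) ^ (1 + β))⁻¹ :=
        mul_le_mul_of_nonneg_left h3 hc.le
    _ = cfDen ρ (n + 1) * (c / (cfDen ρ (n + 1) : ℝ) ^ (2 + β)) := by
        have e : (cfDen ρ (n + 1) : ℝ) ^ (2 + β) =
            cfDen ρ (n + 1) * (cfDen ρ (n + 1) : ℝ) ^ (1 + β) := by
          rw [show (2 + β) = 1 + (1 + β) by ring, Real.rpow_add hq0 1, Real.rpow_one]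
        have e' : (0 : ℝ) < (cfDen ρ (n + 1) : ℝ) ^ (1 + β) := by positivity
        rw [e]
        generalize (cfDen ρ (n + 1) : ℝ) ^ (1 + β) = P at e' ⊢
        field_simp
    _ ≤ _ := mul_le_mul_of_nonneg_left h1 hq0.le

end Irrational

lemma Diophantine.irrational {ρ : ℝ} (h : Diophantine ρ) : Irrational ρ := by
  obtain ⟨c, hc, β, hβ, h⟩ := h
  rintro ⟨r, rfl⟩
  have := h r.num r.den r.pos
  have hr : (r : ℝ) = (r.num : ℝ) / (r.den : ℝ) := by exact_mod_cast (Rat.num_div_den r).symm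
  rw [← hr, sub_self, abs_zero] at this
  have hd : (0 : ℝ) < r.den := by exact_mod_cast r.pos
  have : 0 < c / (r.den : ℝ) ^ (2 + β) := by positivity
  linarith

lemma exists_sub_eq_deriv_mul {f : ℝ → ℝ} (hf : Differentiable ℝ f) (x y : ℝ) :
    ∃ ξ ∈ Set.uIcc x y, f y - f x = deriv f ξ * (y - x) := by
  rcases lt_trichotomy x y with h | rfl | h
  · obtain ⟨c, hc, e⟩ := exists_deriv_eq_slope f h hf.continuous.continuousOn hf.differentiableOn
    refine ⟨c, ?_, ?_⟩
    · rw [Set.uIcc_of_le h.le]; exact Set.Ioo_subset_Icc_self hc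
    · rw [e]; field_simp [(sub_pos.2 h).ne']
  · exact ⟨x, by simp, by simp⟩
  · obtain ⟨c, hc, e⟩ := exists_deriv_eq_slope f h hf.continuous.continuousOn hf.differentiableOn
    refine ⟨c, ?_, ?_⟩
    · rw [Set.uIcc_of_ge h.le]; exact Set.Ioo_subset_Icc_self hc
    · rw [e]
      have := (sub_pos.2 h).ne'
      field_simp
      ring

lemma exists_isMax_of_periodic {f : ℝ → ℝ} (hf : Continuous f) (hp : ∀ x, f (x + 1) = f x) :
    ∃ x, ∀ y, f y ≤ f x := by
  obtain ⟨x, -, hx⟩ := isCompact_Icc.exists_isMaxOn (s := Set.Icc (0:ℝ) 1) ⟨0, by simp⟩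
    hf.continuousOn
  refine ⟨x, fun y => ?_⟩
  have hp' : Function.Periodic f 1 := hp
  obtain ⟨z, hz, e⟩ := hp'.exists_mem_Ico₀ one_pos y
  rw [e]
  exact hx (Set.Ico_subset_Icc_self hz)

lemma exists_abs_le_of_periodic {f : ℝ → ℝ} (hf : Continuous f) (hp : ∀ x, f (x + 1) = f x) :
    ∃ C, 0 ≤ C ∧ ∀ x, |f x| ≤ C := by
  obtain ⟨x, hx⟩ := exists_isMax_of_periodic hf.abs (fun x => by rw [hp])
  exact ⟨|f x|, abs_nonneg _, hx⟩

lemma deriv_periodic {f : ℝ → ℝ} (hp : ∀ x, f (x + 1) = f x) (x : ℝ) :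
    deriv f (x + 1) = deriv f x := by
  have : (fun x => f (x + 1)) = f := funext hp
  rw [← deriv_comp_add_const, this]

lemma iteratedDeriv_periodic {f : ℝ → ℝ} (hp : ∀ x, f (x + 1) = f x) (j : ℕ) (x : ℝ) :
    iteratedDeriv j f (x + 1) = iteratedDeriv j f x := by
  induction j generalizing x with
  | zero => simpa using hp x
  | succ j ih => rw [iteratedDeriv_succ]; exact deriv_periodic ih x

/-- A lift of a smooth circle diffeomorphism whose orbits are ordered as those of the rotation by
the Diophantine number `ρ`. -/
structure DioLift (B : ℝ → ℝ) (ρ : ℝ) : Prop where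
  smooth : ContDiff ℝ ∞ B
  add_one : ∀ x, B (x + 1) = B x + 1
  deriv_pos : ∀ x, 0 < deriv B x
  dio : Diophantine ρ
  order : ∀ (i j : ℕ) (k l : ℤ) (x : ℝ), (i : ℝ) * ρ + k < j * ρ + l → B^[i] x + k < B^[j] x + l

/-- The lift `x ↦ Bⁱ(x) + k` of an iterate. -/
def tr (B : ℝ → ℝ) (i : ℕ) (k : ℤ) (x : ℝ) : ℝ := B^[i] x + k

/-- The return map `x ↦ B^{q_n}(x) - p_n`. -/
noncomputable def ret (B : ℝ → ℝ) (ρ : ℝ) (n : ℕ) : ℝ → ℝ := tr B (cfDen ρ n) (-cfNum ρ n)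

/-- The displacement of the return map. -/
noncomputable def gap (B : ℝ → ℝ) (ρ : ℝ) (n : ℕ) (x : ℝ) : ℝ := cfSign n * (ret B ρ n x - x)

/-- Logarithm of the derivative of an iterate. -/
noncomputable def logD (B : ℝ → ℝ) (l : ℕ) (x : ℝ) : ℝ := Real.log (deriv B^[l] x)

lemma cfDen_mul_sub_eq (ρ : ℝ) (n : ℕ) :
    cfDen ρ n * ρ - cfNum ρ n = cfSign n * cfDist ρ n := by
  rw [cfDist_eq, ← mul_assoc, cfSign_mul_self, one_mul]

lemma mem_uIcc_sign {n : ℕ} {x y z : ℝ} (h : cfSign n * x ≤ cfSign n * y)  :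
    z ∈ Set.uIcc x y ↔ cfSign n * x ≤ cfSign n * z ∧ cfSign n * z ≤ cfSign n * y := by
  rcases cfSign_eq n with e | e <;> rw [e] at h ⊢
  · rw [Set.uIcc_of_le (by linarith)]; simp
  · rw [Set.uIcc_of_ge (by linarith)]; simp [and_comm]

namespace DioLift

variable {B : ℝ → ℝ} {ρ : ℝ} (h : DioLift B ρ)
include h

lemma irr : Irrational ρ := h.dio.irrational

lemma smooth_iter (i : ℕ) : ContDiff ℝ ∞ B^[i] := by
  induction i with
  | zero => exact contDiff_id
  | succ i ih => rw [Function.iterate_succ]; exact ih.comp h.smooth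

lemma add_int (k : ℤ) (x : ℝ) : B (x + k) = B x + k := by
  induction k using Int.induction_on generalizing x with
  | zero => simp
  | succ i ih => push_cast at ih ⊢; rw [← add_assoc, h.add_one, ih]; ring
  | pred i ih =>
    have := h.add_one (x + ((-(i : ℤ) - 1 : ℤ) : ℝ))
    have h2 := ih x
    push_cast at this h2 ⊢
    rw [show x + (-(i : ℝ) - 1) + 1 = x + -i by ring, h2] at this
    linarith

lemma iter_add_int (i : ℕ) (k : ℤ) (x : ℝ) : B^[i] (x + k) = B^[i] x + k := by
  induction i with
  | zero => simp
  | succ i ih => rw [Function.iterate_succ_apply', ih, h.add_int, Function.iterate_succ_apply']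

lemma tr_tr (i j : ℕ) (k l : ℤ) (x : ℝ) : tr B i k (tr B j l x) = tr B (i + j) (k + l) x := by
  simp only [tr]
  rw [h.iter_add_int, Function.iterate_add_apply]
  push_cast
  ring

lemma tr_comm (i j : ℕ) (k l : ℤ) (x : ℝ) :
    tr B i k (tr B j l x) = tr B j l (tr B i k x) := by
  rw [h.tr_tr, h.tr_tr, add_comm, add_comm k]

omit h in
lemma deriv_tr (i : ℕ) (k : ℤ) (x : ℝ) : deriv (tr B i k) x = deriv B^[i] x := by
  unfold tr
  simp

lemma smooth_tr (i : ℕ) (k : ℤ) : ContDiff ℝ ∞ (tr B i k) :=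
  (h.smooth_iter i).add contDiff_const

lemma deriv_iter_add (l i : ℕ) (x : ℝ) :
    deriv B^[l + i] x = deriv B^[l] (B^[i] x) * deriv B^[i] x := by
  rw [Function.iterate_add]
  exact deriv_comp x ((h.smooth_iter l).diff_infty _) ((h.smooth_iter i).diff_infty _)

lemma deriv_iter_pos (i : ℕ) (x : ℝ) : 0 < deriv B^[i] x := by
  induction i with
  | zero => simp
  | succ i ih =>
    rw [add_comm, h.deriv_iter_add]
    exact mul_pos (by simpa using h.deriv_pos _) ih

lemma deriv_iter_add_int (i : ℕ) (k : ℤ) (x : ℝ) : deriv B^[i] (x + k) = deriv B^[i] x := by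
  rw [← deriv_comp_add_const, funext (h.iter_add_int i k)]
  simp

lemma strictMono_tr (i : ℕ) (k : ℤ) : StrictMono (tr B i k) :=
  strictMono_of_deriv_pos fun x => by rw [deriv_tr]; exact h.deriv_iter_pos i x

lemma logD_add (l i : ℕ) (x : ℝ) : logD B (l + i) x = logD B l (B^[i] x) + logD B i x := by
  rw [logD, h.deriv_iter_add, Real.log_mul (h.deriv_iter_pos _ _).ne' (h.deriv_iter_pos _ _).ne']
  rfl

lemma logD_add_int (i : ℕ) (k : ℤ) (x : ℝ) : logD B i (x + k) = logD B i x := by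
  rw [logD, h.deriv_iter_add_int]; rfl

lemma logD_tr (l i : ℕ) (k : ℤ) (x : ℝ) : logD B l (tr B i k x) = logD B l (B^[i] x) :=
  h.logD_add_int _ _ _

omit h in
lemma logD_zero (x : ℝ) : logD B 0 x = 0 := by simp [logD]

lemma exp_logD (l : ℕ) (x : ℝ) : Real.exp (logD B l x) = deriv B^[l] x :=
  Real.exp_log (h.deriv_iter_pos l x)

lemma smooth_logD (l : ℕ) : ContDiff ℝ ∞ (logD B l) :=
  (smooth_deriv (h.smooth_iter l)).log fun x => (h.deriv_iter_pos l x).ne'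

lemma logD_eq_sum (l : ℕ) (x : ℝ) : logD B l x = ∑ i ∈ Finset.range l, logD B 1 (B^[i] x) := by
  induction l with
  | zero => simp [logD_zero]
  | succ l ih => rw [Finset.sum_range_succ, ← ih, add_comm l, h.logD_add, add_comm]

/-! #### Order of the orbits -/

lemma sign_lt (n i j : ℕ) (k l : ℤ) (x : ℝ)
    (hlt : cfSign n * (i * ρ + k) < cfSign n * (j * ρ + l)) :
    cfSign n * tr B i k x < cfSign n * tr B j l x := by
  rcases cfSign_eq n with e | e <;> rw [e] at hlt ⊢
  · have := h.order i j k l x (by linarith)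
    simp only [tr]; linarith
  · have := h.order j i l k x (by linarith)
    simp only [tr]; linarith

lemma sign_le (n i j : ℕ) (k l : ℤ) (x : ℝ)
    (hle : cfSign n * (i * ρ + k) ≤ cfSign n * (j * ρ + l)) :
    cfSign n * tr B i k x ≤ cfSign n * tr B j l x := by
  rcases hle.lt_or_eq with hlt | heq
  · exact (h.sign_lt n i j k l x hlt).le
  · have heq' : (i : ℝ) * ρ + k = j * ρ + l := by
      rcases cfSign_eq n with e | e <;> rw [e] at heq <;> linarith
    by_cases hij : (i : ℤ) - j = 0 ∧ k - l = 0
    · have e1 : i = j := by omega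
      have e2 : k = l := by omega
      rw [e1, e2]
    · exfalso
      refine int_mul_add_ne_zero h.irr ((i : ℤ) - j) (k - l) (by tauto) ?_
      push_cast
      linarith

omit h in
lemma cfSign_mul_add (n i : ℕ) (k : ℤ) :
    cfSign n * (((i + cfDen ρ n : ℕ) : ℝ) * ρ + ((k + -cfNum ρ n : ℤ) : ℝ)) =
      cfSign n * (i * ρ + k) + cfDist ρ n := by
  have := cfDen_mul_sub_eq ρ n
  have h2 := cfSign_mul_self n
  push_cast
  linear_combination cfSign n * this + cfDist ρ n * h2

omit h in
lemma ret_eq (n : ℕ) (x : ℝ) : ret B ρ n x = x + cfSign n * gap B ρ n x := by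
  rw [gap, ← mul_assoc, cfSign_mul_self]; ring

lemma smooth_ret (n : ℕ) : ContDiff ℝ ∞ (ret B ρ n) := h.smooth_tr _ _

lemma smooth_gap (n : ℕ) : ContDiff ℝ ∞ (gap B ρ n) :=
  contDiff_const.mul ((h.smooth_ret n).sub contDiff_id)

omit h in
lemma deriv_ret (n : ℕ) (x : ℝ) : deriv (ret B ρ n) x = deriv B^[cfDen ρ n] x := deriv_tr _ _ _

lemma ret_add_int (n : ℕ) (k : ℤ) (x : ℝ) : ret B ρ n (x + k) = ret B ρ n x + k := by
  simp only [ret, tr]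
  rw [h.iter_add_int]
  ring

lemma gap_add_int (n : ℕ) (k : ℤ) (x : ℝ) : gap B ρ n (x + k) = gap B ρ n x := by
  rw [gap, h.ret_add_int, gap]
  ring

lemma gap_add_one (n : ℕ) (x : ℝ) : gap B ρ n (x + 1) = gap B ρ n x := by
  simpa using h.gap_add_int n 1 x

lemma ret_tr (n i : ℕ) (k : ℤ) (x : ℝ) :
    ret B ρ n (tr B i k x) = tr B i k (ret B ρ n x) := h.tr_comm _ _ _ _ _

lemma ret_comm (n m : ℕ) (x : ℝ) :
    ret B ρ n (ret B ρ m x) = ret B ρ m (ret B ρ n x) := h.tr_comm _ _ _ _ _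

omit h in
lemma tr_zero (x : ℝ) : tr B 0 0 x = x := by simp [tr]

lemma gap_pos (n : ℕ) (x : ℝ) : 0 < gap B ρ n x := by
  have h1 := cfSign_mul_add (ρ := ρ) n 0 0
  simp only [zero_add, Nat.cast_zero, zero_mul, Int.cast_zero, mul_zero] at h1
  have h2 := h.sign_lt n 0 (cfDen ρ n) 0 (-cfNum ρ n) x
    (by rw [h1]; simpa using cfDist_pos h.irr n)
  rw [tr_zero] at h2
  rw [gap, ret]
  linarith

lemma gap_eq_abs (n : ℕ) (x : ℝ) : gap B ρ n x = |ret B ρ n x - x| := by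
  rw [← abs_of_pos (h.gap_pos n x), gap, abs_mul, abs_cfSign, one_mul]

lemma gap_tr_eq_abs (n i : ℕ) (k : ℤ) (x : ℝ) :
    gap B ρ n (tr B i k x) = |B^[i] (ret B ρ n x) - B^[i] x| := by
  rw [h.gap_eq_abs, h.ret_tr]
  congr 1
  simp only [tr]
  ring

lemma mem_seg {n : ℕ} {x z : ℝ} : z ∈ Set.uIcc x (ret B ρ n x) ↔
    cfSign n * x ≤ cfSign n * z ∧ cfSign n * z ≤ cfSign n * ret B ρ n x :=
  mem_uIcc_sign (by have := h.gap_pos n x; rw [gap] at this; linarith)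

lemma gap_tr_eq_deriv (n i : ℕ) (k : ℤ) (x : ℝ) : ∃ ξ ∈ Set.uIcc x (ret B ρ n x),
    gap B ρ n (tr B i k x) = deriv B^[i] ξ * gap B ρ n x := by
  obtain ⟨ξ, hξ, e⟩ := exists_sub_eq_deriv_mul (h.smooth_iter i).diff_infty x (ret B ρ n x)
  refine ⟨ξ, hξ, ?_⟩
  rw [h.gap_tr_eq_abs n i k, e, abs_mul, abs_of_pos (h.deriv_iter_pos i ξ), ← h.gap_eq_abs]

lemma sum_abs_sub_le (n : ℕ) (x : ℝ) :
    ∑ i ∈ Finset.range (cfDen ρ (n + 1)), |B^[i] (ret B ρ n x) - B^[i] x| ≤ 1 := by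
  have hk : ∀ i : ℕ, ∃ k : ℤ, cfSign n * x ≤ cfSign n * tr B i k x ∧
      cfSign n * tr B i k x < cfSign n * x + 1 := by
    intro i
    rcases cfSign_eq n with e | e <;> rw [e]
    · refine ⟨-⌊B^[i] x - x⌋, ?_⟩
      have h1 := Int.floor_le (B^[i] x - x)
      have h2 := Int.lt_floor_add_one (B^[i] x - x)
      simp only [tr]
      push_cast
      constructor <;> linarith
    · refine ⟨⌊x - B^[i] x⌋, ?_⟩
      have h1 := Int.floor_le (x - B^[i] x)
      have h2 := Int.lt_floor_add_one (x - B^[i] x)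
      simp only [tr]
      constructor <;> linarith
  choose k hk1 hk2 using hk
  have hα := cfDist_pos h.irr n
  have key : ∀ (i j : ℕ) (k l : ℤ), i < cfDen ρ (n + 1) → j < cfDen ρ (n + 1) →
      (i ≠ j ∨ k ≠ l) → cfSign n * (i * ρ + k) + cfDist ρ n ≤ cfSign n * (j * ρ + l) ∨
        cfSign n * (j * ρ + l) + cfDist ρ n ≤ cfSign n * (i * ρ + k) := by
    intro i j k l hi hj hne
    have h1 := cfDist_le_abs h.irr n ((i : ℤ) - j) (k - l) (by rw [abs_lt]; omega) (by omega)
    have h2 : |cfSign n * (i * ρ + k) - cfSign n * (j * ρ + l)| =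
        |(((i : ℤ) - j : ℤ) : ℝ) * ρ + ((k - l : ℤ) : ℝ)| := by
      rw [← mul_sub, abs_mul, abs_cfSign, one_mul]
      congr 1
      push_cast
      ring
    rw [← h2] at h1
    rcases le_abs.1 h1 with h3 | h3
    · right; linarith
    · left; linarith
  have hb : ∀ (i j : ℕ) (k l : ℤ),
      cfSign n * (i * ρ + k) + cfDist ρ n ≤ cfSign n * (j * ρ + l) →
      cfSign n * tr B i k (ret B ρ n x) ≤ cfSign n * tr B j l x := by
    intro i j k l hij
    rw [ret, h.tr_tr]
    exact h.sign_le n _ _ _ _ _ (by rw [cfSign_mul_add]; exact hij)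
  have hab : ∀ i, |B^[i] (ret B ρ n x) - B^[i] x| =
      cfSign n * tr B i (k i) (ret B ρ n x) - cfSign n * tr B i (k i) x := by
    intro i
    rw [← h.gap_tr_eq_abs n i (k i), gap, h.ret_tr]
    ring
  have hσ : ∃ e : ℤ, cfSign n = e ∧ cfSign n * tr B 0 e x = cfSign n * x + 1 := by
    rcases cfSign_eq n with e | e
    · exact ⟨1, by simp [e], by simp [e, tr]⟩
    · exact ⟨-1, by simp [e], by simp [e, tr]; ring⟩
  obtain ⟨e, he, he'⟩ := hσ
  have h0 : 0 < cfDen ρ (n + 1) := one_le_cfDen_succ h.irr n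
  have := sum_length_le_of_disjoint (Finset.range (cfDen ρ (n + 1)))
    (fun i => cfSign n * tr B i (k i) x) (fun i => cfSign n * tr B i (k i) (ret B ρ n x))
    (cfSign n * x) (cfSign n * x + 1) (by linarith)
    (fun i _ => by have := hab i; have := abs_nonneg (B^[i] (ret B ρ n x) - B^[i] x); linarith)
    (fun i _ => hk1 i)
    (fun i hi => by
      rw [← he']
      have hi' : i < cfDen ρ (n + 1) := by simpa using hi
      have hne : i ≠ 0 ∨ k i ≠ e := by
        by_contra hcon
        push Not at hcon
        have := hk2 i
        rw [hcon.2, hcon.1, he'] at this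
        exact lt_irrefl _ this
      rcases key i 0 (k i) e hi' h0 hne with h1 | h1
      · exact hb _ _ _ _ h1
      · exfalso
        have h2 := h.sign_lt n 0 i e (k i) x (by linarith)
        have := hk2 i
        linarith)
    (fun i hi j hj hij => by
      simp only [Finset.mem_range] at hi hj
      rcases key i j (k i) (k j) hi hj (Or.inl hij) with h1 | h1
      · exact Or.inl (hb _ _ _ _ h1)
      · exact Or.inr (hb _ _ _ _ h1))
  simp only [hab]
  linarith

lemma sum_abs_sub_le_mul (n K l : ℕ) (hl : l ≤ K * cfDen ρ (n + 1)) (x : ℝ) :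
    ∑ i ∈ Finset.range l, |B^[i] (ret B ρ n x) - B^[i] x| ≤ K := by
  induction K generalizing l x with
  | zero => obtain rfl : l = 0 := by omega
            simp
  | succ K ih =>
    have h1 := h.sum_abs_sub_le n x
    rcases le_total l (cfDen ρ (n + 1)) with hl' | hl'
    · have : ∑ i ∈ Finset.range l, |B^[i] (ret B ρ n x) - B^[i] x| ≤
          ∑ i ∈ Finset.range (cfDen ρ (n + 1)), |B^[i] (ret B ρ n x) - B^[i] x| :=
        Finset.sum_le_sum_of_subset_of_nonneg (Finset.range_mono hl') fun _ _ _ => abs_nonneg _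
      push_cast
      linarith [Nat.cast_nonneg (α := ℝ) K]
    · obtain ⟨l', rfl⟩ := Nat.exists_eq_add_of_le hl'
      rw [Finset.sum_range_add]
      have h2 := ih l' (by rw [add_mul, one_mul] at hl; omega) (tr B (cfDen ρ (n + 1)) 0 x)
      have h3 : ∀ i, |B^[cfDen ρ (n + 1) + i] (ret B ρ n x) - B^[cfDen ρ (n + 1) + i] x| =
          |B^[i] (ret B ρ n (tr B (cfDen ρ (n + 1)) 0 x)) - B^[i] (tr B (cfDen ρ (n + 1)) 0 x)| := by
        intro i
        rw [h.ret_tr]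
        simp [tr, add_comm (cfDen ρ (n + 1)) i, Function.iterate_add_apply]
      simp only [h3]
      push_cast
      linarith

lemma exists_cover (n : ℕ) (x z : ℝ) : ∃ i < 2 * cfDen ρ (n + 1), ∃ (k : ℤ),
    ∃ y ∈ Set.uIcc x (ret B ρ n x), z = tr B i k y := by
  set Q := cfDen ρ (n + 1) + cfDen ρ n with hQ
  have hQ2 : Q ≤ 2 * cfDen ρ (n + 1) := by have := cfDen_le_succ h.irr n; omega
  have hq1 := one_le_cfDen_succ h.irr n
  have hk : ∀ i : ℕ, ∃ k : ℤ, cfSign n * tr B i k x ≤ cfSign n * z ∧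
      ∀ l : ℤ, cfSign n * tr B i l x ≤ cfSign n * z → cfSign n * tr B i l x ≤
        cfSign n * tr B i k x := by
    intro i
    rcases cfSign_eq n with e | e <;> rw [e]
    · refine ⟨⌊z - B^[i] x⌋, ?_, fun l hl => ?_⟩
      · have h1 := Int.floor_le (z - B^[i] x)
        simp only [tr]; linarith
      · simp only [tr] at hl ⊢
        have : l ≤ ⌊z - B^[i] x⌋ := Int.le_floor.2 (by linarith)
        have : (l : ℝ) ≤ (⌊z - B^[i] x⌋ : ℝ) := by exact_mod_cast this
        linarith
    · refine ⟨⌈z - B^[i] x⌉, ?_, fun l hl => ?_⟩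
      · have h1 := Int.le_ceil (z - B^[i] x)
        simp only [tr]; linarith
      · simp only [tr] at hl ⊢
        have : ⌈z - B^[i] x⌉ ≤ l := Int.ceil_le.2 (by linarith)
        have : (⌈z - B^[i] x⌉ : ℝ) ≤ (l : ℝ) := by exact_mod_cast this
        linarith
  choose k hk1 hk2 using hk
  obtain ⟨i, hi, hmax⟩ := Finset.exists_max_image (Finset.range Q)
    (fun i => cfSign n * tr B i (k i) x) ⟨0, by simp; omega⟩
  have hi' : i < Q := by simpa using hi
  have hnext : ∀ (j : ℕ) (l : ℤ), j < Q →
      cfSign n * (i * ρ + k i) < cfSign n * (j * ρ + l) →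
      cfSign n * z < cfSign n * tr B j l x := by
    intro j l hj hlt
    by_contra hcon
    push Not at hcon
    have h1 := hk2 j l hcon
    have h2 := hmax j (by simpa using hj)
    have h3 := h.sign_lt n i j (k i) l x hlt
    linarith
  have hz : cfSign n * z ≤ cfSign n * tr B i (k i) (ret B ρ n x) := by
    rw [ret, h.tr_tr]
    by_cases hiq : i < cfDen ρ (n + 1)
    · refine (hnext _ _ (by omega) ?_).le
      rw [cfSign_mul_add]
      linarith [cfDist_pos h.irr n]
    · have e := cfSign_mul_add (ρ := ρ) (n + 1) (i - cfDen ρ (n + 1)) (k i + cfNum ρ (n + 1))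
      rw [Nat.sub_add_cancel (by omega), cfSign_succ] at e
      simp only [add_neg_cancel_right] at e
      have h1 := hnext (i - cfDen ρ (n + 1)) (k i + cfNum ρ (n + 1)) (by omega)
        (by linarith [cfDist_pos h.irr (n + 1)])
      refine h1.le.trans (h.sign_le n _ _ _ _ x ?_)
      rw [cfSign_mul_add]
      linarith [cfDist_succ_lt h.irr n]
  have hc := (h.smooth_tr i (k i)).continuous
  have hmem : z ∈ Set.uIcc (tr B i (k i) x) (tr B i (k i) (ret B ρ n x)) :=
    (mem_uIcc_sign (n := n) ((hk1 i).trans hz)).2 ⟨hk1 i, hz⟩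
  obtain ⟨y, hy, e⟩ := intermediate_value_uIcc (hc.continuousOn) hmem
  exact ⟨i, by omega, k i, y, hy, e.symm⟩

end DioLift

/-- Distortion bound by `δ` over segments of level `n`, for `K q_{n+1}` iterates. -/
def HasDist (B : ℝ → ℝ) (ρ : ℝ) (K n : ℕ) (δ : ℝ) : Prop :=
  ∀ l ≤ K * cfDen ρ (n + 1), ∀ x, ∀ z ∈ Set.uIcc x (ret B ρ n x), |logD B l z - logD B l x| ≤ δ

/-- The maximal displacement of the return map. -/
noncomputable def maxGap (B : ℝ → ℝ) (ρ : ℝ) (n : ℕ) : ℝ := ⨆ x, gap B ρ n x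

namespace DioLift

variable {B : ℝ → ℝ} {ρ : ℝ} (h : DioLift B ρ)
include h

lemma abs_iter_sub_le (i : ℕ) {x y z : ℝ} (hz : z ∈ Set.uIcc x y) :
    |B^[i] z - B^[i] x| ≤ |B^[i] y - B^[i] x| := by
  have hm : Monotone B^[i] := by
    have := (h.strictMono_tr i 0).monotone
    rwa [show tr B i 0 = B^[i] from funext fun x => by simp [tr]] at this
  exact Set.abs_sub_left_of_mem_uIcc (hm.image_uIcc_subset ⟨z, hz, rfl⟩)

lemma logD_periodic (l : ℕ) (x : ℝ) : logD B l (x + 1) = logD B l x := by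
  simpa using h.logD_add_int l 1 x

lemma exists_hasDist (K : ℕ) : ∃ δ, 0 ≤ δ ∧ ∀ n, HasDist B ρ K n δ := by
  obtain ⟨V, hV, hVb⟩ := exists_abs_le_of_periodic (smooth_deriv (h.smooth_logD 1)).continuous
    (deriv_periodic (h.logD_periodic 1))
  refine ⟨V * K, by positivity, fun n l hl x z hz => ?_⟩
  rw [h.logD_eq_sum, h.logD_eq_sum, ← Finset.sum_sub_distrib]
  refine (Finset.abs_sum_le_sum_abs _ _).trans ?_
  refine le_trans (Finset.sum_le_sum (g := fun i => V * |B^[i] (ret B ρ n x) - B^[i] x|) ?_) ?_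
  · intro i _
    obtain ⟨ξ, -, e⟩ := exists_sub_eq_deriv_mul (h.smooth_logD 1).diff_infty (B^[i] x) (B^[i] z)
    rw [e, abs_mul]
    exact mul_le_mul (hVb ξ) (h.abs_iter_sub_le i hz) (abs_nonneg _) hV
  · rw [← Finset.mul_sum]
    exact mul_le_mul_of_nonneg_left (h.sum_abs_sub_le_mul n K l hl x) hV

lemma ret_succ_mem (n : ℕ) (x : ℝ) :
    x ∈ Set.uIcc (ret B ρ (n + 1) x) (ret B ρ n (ret B ρ (n + 1) x)) := by
  rw [h.mem_seg]
  constructor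
  · have := h.gap_pos (n + 1) x
    rw [gap, cfSign_succ] at this
    linarith
  · rw [ret, ret, h.tr_tr, add_comm, add_comm (-cfNum ρ n)]
    have e := cfSign_mul_add (ρ := ρ) (n + 1) 0 0
    simp only [zero_add, Nat.cast_zero, zero_mul, Int.cast_zero, mul_zero, cfSign_succ] at e
    have := h.sign_le n 0 (cfDen ρ (n + 1) + cfDen ρ n) 0 (-cfNum ρ (n + 1) + -cfNum ρ n) x (by
      rw [cfSign_mul_add]
      simp only [Nat.cast_zero, zero_mul, Int.cast_zero, add_zero, mul_zero]
      linarith [cfDist_succ_lt h.irr n])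
    rwa [tr_zero] at this

lemma gap_succ_le (n : ℕ) (x : ℝ) : gap B ρ (n + 1) x ≤ gap B ρ n (ret B ρ (n + 1) x) := by
  have := (h.mem_seg.1 (h.ret_succ_mem n x)).2
  rw [gap, gap, cfSign_succ]
  linarith

lemma abs_logD_succ_le {n : ℕ} {δ : ℝ} (hδ : HasDist B ρ 2 n δ) (x : ℝ) :
    |logD B (cfDen ρ (n + 1)) x| ≤ 2 * δ := by
  set q := cfDen ρ (n + 1)
  obtain ⟨z, hz⟩ : ∃ z, logD B q z = 0 := by
    obtain ⟨z, -, e⟩ := exists_sub_eq_deriv_mul (h.smooth_iter q).diff_infty 0 1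
    have := h.iter_add_int q 1 0
    simp only [zero_add, Int.cast_one] at this
    rw [this] at e
    refine ⟨z, ?_⟩
    rw [logD, show deriv B^[q] z = 1 by linarith, Real.log_one]
  obtain ⟨i, hi, k, y, hy, rfl⟩ := h.exists_cover n z x
  have e1 : logD B q (tr B i k y) = logD B i (ret B ρ (n + 1) y) - logD B i y + logD B q y := by
    have e2 := h.logD_add q i y
    have e3 := h.logD_add i q y
    rw [h.logD_tr, ret, h.logD_tr]
    rw [add_comm q i] at e2
    linarith
  have h1 := hδ q (by omega) z y hy
  have h2 := hδ i hi.le (ret B ρ (n + 1) y) y (h.ret_succ_mem n y)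
  rw [e1]
  rw [hz, sub_zero] at h1
  rw [abs_sub_comm] at h2
  refine (abs_add_le _ _).trans ?_
  linarith

lemma exists_abs_logD_le : ∃ E, 0 ≤ E ∧ ∀ n x, |logD B (cfDen ρ n) x| ≤ E := by
  obtain ⟨δ, hδ, hD⟩ := h.exists_hasDist 2
  refine ⟨2 * δ, by positivity, fun n x => ?_⟩
  rcases n with _ | n
  · simp [cfDen, logD_zero, hδ]
  · exact h.abs_logD_succ_le (hD n) x

lemma gap_compare {n : ℕ} {e : ℝ} (he : ∀ x, |logD B (cfDen ρ n) x| ≤ e) {x z : ℝ}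
    (hz : z ∈ Set.uIcc x (ret B ρ n x)) :
    gap B ρ n z ≤ Real.exp e * gap B ρ n x ∧ gap B ρ n x ≤ Real.exp e * gap B ρ n z := by
  obtain ⟨ξ, -, hξ⟩ := exists_sub_eq_deriv_mul (h.smooth_ret n).diff_infty x z
  obtain ⟨h1, h2⟩ := h.mem_seg.1 hz
  rw [deriv_ret, ← h.exp_logD] at hξ
  obtain ⟨h3, h4⟩ := abs_le.1 (he ξ)
  have h5 := Real.exp_le_exp.2 h4
  have h6 := Real.exp_le_exp.2 h3
  have he0 : 0 ≤ e := (abs_nonneg _).trans (he ξ)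
  have h7 := Real.one_le_exp he0
  have h8 : Real.exp (-e) * Real.exp e = 1 := by rw [← Real.exp_add]; simp
  set d := Real.exp (logD B (cfDen ρ n) ξ)
  set s := cfSign n * z - cfSign n * x with hs
  have hs0 : 0 ≤ s := by linarith
  have hgz : gap B ρ n z = d * s + (gap B ρ n x - s) := by
    simp only [gap, hs]
    linear_combination cfSign n * hξ
  have hs1 : s ≤ gap B ρ n x := by simp only [gap, hs]; linarith
  have h9 : Real.exp (-e) ≤ 1 := by rw [Real.exp_le_one_iff]; linarith
  have hlow : Real.exp (-e) * gap B ρ n x ≤ gap B ρ n z := by rw [hgz]; nlinarith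
  refine ⟨by rw [hgz]; nlinarith, ?_⟩
  calc gap B ρ n x = Real.exp e * (Real.exp (-e) * gap B ρ n x) := by
        rw [← mul_assoc, mul_comm (Real.exp e), h8, one_mul]
    _ ≤ _ := mul_le_mul_of_nonneg_left hlow (Real.exp_pos _).le

/-! #### Extremal displacements -/

lemma exists_gap_max (n : ℕ) : ∃ x, ∀ y, gap B ρ n y ≤ gap B ρ n x :=
  exists_isMax_of_periodic (h.smooth_gap n).continuous (h.gap_add_one n)

lemma exists_gap_min (n : ℕ) : ∃ x, ∀ y, gap B ρ n x ≤ gap B ρ n y := by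
  obtain ⟨x, hx⟩ := exists_isMax_of_periodic (f := fun x => -gap B ρ n x)
    (h.smooth_gap n).continuous.neg (fun x => by rw [h.gap_add_one])
  exact ⟨x, fun y => by have := hx y; linarith⟩

lemma exists_gap_eq_maxGap (n : ℕ) : ∃ x, gap B ρ n x = maxGap B ρ n := by
  obtain ⟨x, hx⟩ := h.exists_gap_max n
  refine ⟨x, le_antisymm (le_ciSup (f := gap B ρ n) ⟨gap B ρ n x, ?_⟩ x) (ciSup_le hx)⟩
  rintro _ ⟨y, rfl⟩
  exact hx y

lemma gap_le_maxGap (n : ℕ) (y : ℝ) : gap B ρ n y ≤ maxGap B ρ n := by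
  obtain ⟨x, hx⟩ := h.exists_gap_max n
  refine le_ciSup (f := gap B ρ n) ⟨gap B ρ n x, ?_⟩ y
  rintro _ ⟨y, rfl⟩
  exact hx y

lemma maxGap_pos (n : ℕ) : 0 < maxGap B ρ n := (h.gap_pos n 0).trans_le (h.gap_le_maxGap n 0)

omit h in
lemma gap_zero (x : ℝ) : gap B ρ 0 x = 1 := by
  simp [gap, ret, tr, cfSign, cfDen, cfNum]

lemma maxGap_zero : maxGap B ρ 0 = 1 := by
  obtain ⟨x, hx⟩ := h.exists_gap_eq_maxGap 0
  rw [← hx, gap_zero]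

lemma maxGap_succ_le (n : ℕ) : maxGap B ρ (n + 1) ≤ maxGap B ρ n := by
  obtain ⟨x, hx⟩ := h.exists_gap_eq_maxGap (n + 1)
  rw [← hx]
  exact (h.gap_succ_le n x).trans (h.gap_le_maxGap n _)

lemma maxGap_antitone : Antitone (maxGap B ρ) := antitone_nat_of_succ_le h.maxGap_succ_le

lemma maxGap_le_one (n : ℕ) : maxGap B ρ n ≤ 1 := by
  rw [← h.maxGap_zero]
  exact h.maxGap_antitone (Nat.zero_le n)

omit h in
lemma cfSign_ret_iterate (n j : ℕ) (x : ℝ) : cfSign n * (ret B ρ n)^[j] x - cfSign n * x =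
    ∑ i ∈ Finset.range j, gap B ρ n ((ret B ρ n)^[i] x) := by
  induction j with
  | zero => simp
  | succ j ih =>
    rw [Finset.sum_range_succ, ← ih, gap, Function.iterate_succ_apply']
    ring

lemma ret_iterate (n j : ℕ) (x : ℝ) :
    (ret B ρ n)^[j] x = tr B (j * cfDen ρ n) (j * -cfNum ρ n) x := by
  induction j with
  | zero => simp [tr]
  | succ j ih =>
    rw [Function.iterate_succ_apply', ih, ret, h.tr_tr]
    push_cast
    congr 1 <;> ring

omit h in
lemma cfSign_mul_iterate (n j : ℕ) : cfSign n * (((j * cfDen ρ n : ℕ) : ℝ) * ρ +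
    ((j * -cfNum ρ n : ℤ) : ℝ)) = j * cfDist ρ n := by
  rw [cfDist_eq]
  push_cast
  ring

omit h in
/-- The integer `k`, with the sign of the level `n`, as a translation. -/
lemma exists_sign_translation (n k : ℕ) : ∃ e : ℤ, cfSign n * e = k := by
  rcases cfSign_eq n with e | e
  · exact ⟨k, by simp [e]⟩
  · exact ⟨-k, by simp [e]⟩

lemma exists_cfDist_le_gap (n : ℕ) : ∃ x, cfDist ρ n ≤ gap B ρ n x := by
  obtain ⟨x, hx⟩ := h.exists_gap_max n
  refine ⟨x, ?_⟩
  by_contra hlt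
  push Not at hlt
  obtain ⟨j, hj⟩ := exists_nat_gt (1 / (cfDist ρ n - gap B ρ n x))
  rw [div_lt_iff₀ (by linarith)] at hj
  obtain ⟨e, he⟩ := exists_sign_translation n ⌈(j : ℝ) * gap B ρ n x⌉₊
  have h1 := Nat.le_ceil ((j : ℝ) * gap B ρ n x)
  have h2 := Nat.ceil_lt_add_one (mul_nonneg (Nat.cast_nonneg j) (h.gap_pos n x).le)
  have h3 := h.sign_lt n 0 (j * cfDen ρ n) e (j * -cfNum ρ n) x (by
    rw [cfSign_mul_iterate, Nat.cast_zero, zero_mul, zero_add, he]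
    linarith)
  rw [← h.ret_iterate] at h3
  have h4 := cfSign_ret_iterate (B := B) (ρ := ρ) n j x
  have h5 : ∑ i ∈ Finset.range j, gap B ρ n ((ret B ρ n)^[i] x) ≤ j * gap B ρ n x := by
    simpa using Finset.sum_le_card_nsmul (Finset.range j) _ _ fun i _ => hx _
  simp only [tr, Function.iterate_zero, id, mul_add, he] at h3
  linarith

lemma exists_gap_le_cfDist (n : ℕ) : ∃ x, gap B ρ n x ≤ cfDist ρ n := by
  obtain ⟨x, hx⟩ := h.exists_gap_min n
  refine ⟨x, ?_⟩
  by_contra hlt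
  push Not at hlt
  have hpos := cfDist_pos h.irr n
  obtain ⟨j, hj⟩ := exists_nat_gt (1 / (gap B ρ n x - cfDist ρ n))
  rw [div_lt_iff₀ (by linarith)] at hj
  obtain ⟨e, he⟩ := exists_sign_translation n ⌈(j : ℝ) * cfDist ρ n⌉₊
  have h1 := Nat.le_ceil ((j : ℝ) * cfDist ρ n)
  have h2 := Nat.ceil_lt_add_one (mul_nonneg (Nat.cast_nonneg j) hpos.le)
  have h3 := h.sign_le n (j * cfDen ρ n) 0 (j * -cfNum ρ n) e x (by
    rw [cfSign_mul_iterate, Nat.cast_zero, zero_mul, zero_add, he]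
    linarith)
  rw [← h.ret_iterate] at h3
  have h4 := cfSign_ret_iterate (B := B) (ρ := ρ) n j x
  have h5 : j * gap B ρ n x ≤ ∑ i ∈ Finset.range j, gap B ρ n ((ret B ρ n)^[i] x) := by
    simpa using Finset.card_nsmul_le_sum (Finset.range j) _ _ fun i _ => hx _
  simp only [tr, Function.iterate_zero, id, mul_add, he] at h3
  linarith

lemma cfDist_le_maxGap (n : ℕ) : cfDist ρ n ≤ maxGap B ρ n := by
  obtain ⟨x, hx⟩ := h.exists_cfDist_le_gap n
  exact hx.trans (h.gap_le_maxGap n x)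

lemma ret_add_two (n : ℕ) (x : ℝ) :
    ret B ρ (n + 2) x = (ret B ρ (n + 1))^[cfCoeff ρ n] (ret B ρ n x) := by
  rw [h.ret_iterate, ret, ret, h.tr_tr]
  simp only [cfDen, cfNum]
  congr 1
  ring

/-- The steps of `ret (n + 1)` between `ret (n + 2) x` and `ret n x` fit into the gap at `x`. -/
lemma sum_gap_le (n : ℕ) (x : ℝ) :
    ∑ i ∈ Finset.range (cfCoeff ρ n), gap B ρ (n + 1) ((ret B ρ (n + 1))^[i] (ret B ρ n x)) =
      gap B ρ n x - gap B ρ (n + 2) x := by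
  rw [← cfSign_ret_iterate, ← h.ret_add_two, gap, gap, cfSign_succ (n + 1), cfSign_succ]
  ring

lemma maxGap_decay : ∃ r, 0 < r ∧ r < 1 ∧ ∀ n, maxGap B ρ (n + 2) ≤ r * maxGap B ρ n := by
  obtain ⟨E, hE, hEb⟩ := h.exists_abs_logD_le
  have hexp := Real.exp_pos E
  refine ⟨Real.exp E / (Real.exp E + 1), by positivity, by rw [div_lt_one (by positivity)]; linarith,
    fun n => ?_⟩
  obtain ⟨x, hx⟩ := h.exists_gap_eq_maxGap (n + 2)
  rw [← hx, div_mul_eq_mul_div, le_div_iff₀ (by positivity)]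
  obtain ⟨a, ha⟩ := Nat.exists_eq_add_of_le' (one_le_cfCoeff h.irr n)
  have hs := h.sum_gap_le n x
  rw [ha, Finset.sum_range_succ] at hs
  have h0 : 0 ≤ ∑ i ∈ Finset.range a, gap B ρ (n + 1) ((ret B ρ (n + 1))^[i] (ret B ρ n x)) :=
    Finset.sum_nonneg fun i _ => (h.gap_pos _ _).le
  set t := (ret B ρ (n + 1))^[a] (ret B ρ n x) with ht
  have ht' : ret B ρ (n + 1) t = ret B ρ (n + 2) x := by
    rw [h.ret_add_two, ha, Function.iterate_succ_apply']
  have h1 := (h.gap_compare (hEb (n + 1)) (x := t) (z := ret B ρ (n + 1) t) (by simp)).1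
  rw [ht'] at h1
  have h2 := h.gap_succ_le (n + 1) x
  have h3 := h.gap_le_maxGap n x
  nlinarith [h.gap_pos (n + 2) x]

/-! #### Sums of derivatives along an orbit -/

lemma exists_deriv_iter_compare (K : ℕ) : ∃ C, 0 ≤ C ∧ ∀ n, ∀ l ≤ K * cfDen ρ (n + 1), ∀ x (k : ℤ),
    deriv B^[l] x * gap B ρ n x ≤ C * gap B ρ n (tr B l k x) ∧
      gap B ρ n (tr B l k x) ≤ C * (deriv B^[l] x * gap B ρ n x) := by
  obtain ⟨δ, hδ, hD⟩ := h.exists_hasDist K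
  refine ⟨Real.exp δ, (Real.exp_pos _).le, fun n l hl x k => ?_⟩
  obtain ⟨ξ, hξ, e⟩ := h.gap_tr_eq_deriv n l k x
  rw [e, ← h.exp_logD, ← h.exp_logD, ← mul_assoc, ← mul_assoc, ← Real.exp_add, ← Real.exp_add]
  obtain ⟨h1, h2⟩ := abs_le.1 (hD n l hl x ξ hξ)
  constructor <;> refine mul_le_mul_of_nonneg_right (Real.exp_le_exp.2 ?_) (h.gap_pos n x).le <;>
    linarith

lemma exists_sum_deriv_iter_le (K : ℕ) : ∃ C, 0 ≤ C ∧ ∀ n, ∀ l ≤ K * cfDen ρ (n + 1), ∀ x,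
    (∑ i ∈ Finset.range l, deriv B^[i] x) * gap B ρ n x ≤ C := by
  obtain ⟨C, hC, hb⟩ := h.exists_deriv_iter_compare K
  refine ⟨C * K, by positivity, fun n l hl x => ?_⟩
  rw [Finset.sum_mul]
  calc _ ≤ ∑ i ∈ Finset.range l, C * |B^[i] (ret B ρ n x) - B^[i] x| := by
        refine Finset.sum_le_sum fun i hi => ?_
        rw [← h.gap_tr_eq_abs n i 0]
        exact (hb n i ((Finset.mem_range.1 hi).le.trans hl) x 0).1
    _ ≤ _ := by
        rw [← Finset.mul_sum]
        exact mul_le_mul_of_nonneg_left (h.sum_abs_sub_le_mul n K l hl x) hC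

lemma exists_sum_sq_deriv_iter_le (K : ℕ) : ∃ C, 0 ≤ C ∧ ∀ n, ∀ l ≤ K * cfDen ρ (n + 1), ∀ x,
    (∑ i ∈ Finset.range l, deriv B^[i] x ^ 2) * gap B ρ n x ^ 2 ≤ C * maxGap B ρ n := by
  obtain ⟨C, hC, hb⟩ := h.exists_deriv_iter_compare K
  obtain ⟨D, hD, hs⟩ := h.exists_sum_deriv_iter_le K
  refine ⟨C * D, by positivity, fun n l hl x => ?_⟩
  have hg := h.gap_pos n x
  have hM := h.maxGap_pos n
  calc _ = ∑ i ∈ Finset.range l, (deriv B^[i] x * gap B ρ n x) * (deriv B^[i] x * gap B ρ n x) := by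
        rw [Finset.sum_mul]
        exact Finset.sum_congr rfl fun i _ => by ring
    _ ≤ ∑ i ∈ Finset.range l, C * maxGap B ρ n * (deriv B^[i] x * gap B ρ n x) := by
        refine Finset.sum_le_sum fun i hi => ?_
        refine mul_le_mul_of_nonneg_right ?_ (mul_pos (h.deriv_iter_pos i x) hg).le
        refine (hb n i ((Finset.mem_range.1 hi).le.trans hl) x 0).1.trans ?_
        exact mul_le_mul_of_nonneg_left (h.gap_le_maxGap n _) hC
    _ = C * maxGap B ρ n * ((∑ i ∈ Finset.range l, deriv B^[i] x) * gap B ρ n x) := by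
        rw [← Finset.mul_sum, Finset.sum_mul]
    _ ≤ C * maxGap B ρ n * D := mul_le_mul_of_nonneg_left (hs n l hl x) (by positivity)
    _ = _ := by ring

end DioLift

/-- Nonlinearity (logarithmic derivative of the derivative) of an iterate. -/
noncomputable def nonlin (B : ℝ → ℝ) (l : ℕ) : ℝ → ℝ := deriv (logD B l)

/-- The Schwarzian derivative of `B`. -/
noncomputable def schw (B : ℝ → ℝ) (x : ℝ) : ℝ :=
  deriv (nonlin B 1) x - nonlin B 1 x ^ 2 / 2

/-- The scale `√M_n / m_n(x)`. -/
noncomputable def invScale (B : ℝ → ℝ) (ρ : ℝ) (n : ℕ) (x : ℝ) : ℝ :=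
  √(maxGap B ρ n) / gap B ρ n x

/-- Indices for the iterates considered at level `n`, with a base point. -/
abbrev OrbitIndex (ρ : ℝ) (K : ℕ) : Type :=
  {p : ℕ × ℕ × ℝ // p.2.1 ≤ K * cfDen ρ (p.1 + 1)}

namespace DioLift

variable {B : ℝ → ℝ} {ρ : ℝ} (h : DioLift B ρ)
include h

lemma smooth_nonlin (l : ℕ) : ContDiff ℝ ∞ (nonlin B l) := smooth_deriv (h.smooth_logD l)

lemma hasDerivAt_logD (l : ℕ) (x : ℝ) : HasDerivAt (logD B l) (nonlin B l x) x :=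
  ((h.smooth_logD l).diff_infty x).hasDerivAt

lemma nonlin_add (l i : ℕ) (x : ℝ) :
    nonlin B (l + i) x = nonlin B l (B^[i] x) * deriv B^[i] x + nonlin B i x := by
  have h1 := ((h.hasDerivAt_logD l (B^[i] x)).comp x
    ((h.smooth_iter i).diff_infty x).hasDerivAt).add (h.hasDerivAt_logD i x)
  have h2 : logD B (l + i) = (logD B l ∘ B^[i]) + logD B i := funext fun x => h.logD_add l i x
  rw [nonlin, h2]
  exact h1.deriv

lemma nonlin_periodic (l : ℕ) (x : ℝ) : nonlin B l (x + 1) = nonlin B l x :=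
  deriv_periodic (h.logD_periodic l) x

lemma nonlin_tr (l i : ℕ) (k : ℤ) (x : ℝ) : nonlin B l (tr B i k x) = nonlin B l (B^[i] x) := by
  have : (fun x => logD B l (x + k)) = logD B l := funext (h.logD_add_int l k)
  rw [tr, nonlin, ← deriv_comp_add_const, this]

omit h in
lemma nonlin_zero (x : ℝ) : nonlin B 0 x = 0 := by
  have : logD B 0 = fun _ => 0 := funext logD_zero
  simp [nonlin, this]

lemma hasDerivAt_deriv_iter (l : ℕ) (x : ℝ) :
    HasDerivAt (deriv B^[l]) (nonlin B l x * deriv B^[l] x) x := by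
  have h1 := (h.hasDerivAt_logD l x).exp
  rw [h.exp_logD, mul_comm] at h1
  exact h1.congr_of_eventuallyEq (Eventually.of_forall fun y => (h.exp_logD l y).symm)

lemma deriv_nonlin (l : ℕ) (x : ℝ) : deriv (nonlin B l) x = nonlin B l x ^ 2 / 2 +
    ∑ i ∈ Finset.range l, schw B (B^[i] x) * deriv B^[i] x ^ 2 := by
  induction l with
  | zero =>
    have : nonlin B 0 = fun _ => 0 := funext nonlin_zero
    simp [this]
  | succ l ih =>
    have h1 : nonlin B (l + 1) = fun x => nonlin B 1 (B^[l] x) * deriv B^[l] x + nonlin B l x := by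
      funext x
      rw [add_comm, h.nonlin_add]
    have h2 := ((((h.smooth_nonlin 1).diff_infty (B^[l] x)).hasDerivAt.comp x
      ((h.smooth_iter l).diff_infty x).hasDerivAt).mul (h.hasDerivAt_deriv_iter l x)).add
      ((h.smooth_nonlin l).diff_infty x).hasDerivAt
    rw [Finset.sum_range_succ, h1]
    refine h2.deriv.trans ?_
    rw [ih]
    simp only [schw, Function.comp]
    ring

lemma smooth_schw : ContDiff ℝ ∞ (schw B) :=
  (smooth_deriv (h.smooth_nonlin 1)).sub (((h.smooth_nonlin 1).pow 2).div_const _)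

lemma schw_periodic (x : ℝ) : schw B (x + 1) = schw B x := by
  rw [schw, deriv_periodic (h.nonlin_periodic 1), h.nonlin_periodic]; rfl

lemma exists_nonlin_le_min (K : ℕ) : ∃ C, 0 ≤ C ∧ ∀ n, ∀ l ≤ K * cfDen ρ (n + 1), ∀ x y,
    (∀ z, gap B ρ n x ≤ gap B ρ n z) →
      nonlin B l y ^ 2 * gap B ρ n x ^ 2 ≤ C * maxGap B ρ n := by
  obtain ⟨V, hV, hVb⟩ := exists_abs_le_of_periodic h.smooth_schw.continuous h.schw_periodic
  obtain ⟨C, hC, hb⟩ := h.exists_sum_sq_deriv_iter_le K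
  refine ⟨2 * V * C, by positivity, fun n l hl x y hx => ?_⟩
  have hM := h.maxGap_pos n
  obtain ⟨w, hw⟩ := exists_isMax_of_periodic (f := fun y => nonlin B l y ^ 2)
    ((h.smooth_nonlin l).continuous.pow 2) (fun y => by rw [h.nonlin_periodic])
  have h0 : nonlin B l w * deriv (nonlin B l) w = 0 := by
    have h1 : IsLocalMax (fun y => nonlin B l y ^ 2) w := Eventually.of_forall hw
    have h2 := (((h.smooth_nonlin l).diff_infty w).hasDerivAt.pow 2).deriv
    have h3 := h1.deriv_eq_zero
    have h4 : deriv (fun y => nonlin B l y ^ 2) w = deriv (nonlin B l ^ 2) w := rfl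
    rw [h4, h2] at h3
    simp at h3
    simpa using h3
  have hgx := h.gap_pos n x
  have key : nonlin B l w ^ 2 * gap B ρ n w ^ 2 ≤ 2 * V * C * maxGap B ρ n := by
    rcases mul_eq_zero.1 h0 with h1 | h1
    · rw [h1]; simp; positivity
    · rw [h.deriv_nonlin] at h1
      have h2 : |∑ i ∈ Finset.range l, schw B (B^[i] w) * deriv B^[i] w ^ 2| ≤
          V * ∑ i ∈ Finset.range l, deriv B^[i] w ^ 2 := by
        refine (Finset.abs_sum_le_sum_abs _ _).trans ?_
        rw [Finset.mul_sum]
        refine Finset.sum_le_sum fun i _ => ?_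
        rw [abs_mul, abs_of_nonneg (sq_nonneg (deriv B^[i] w))]
        exact mul_le_mul_of_nonneg_right (hVb _) (sq_nonneg _)
      have h3 : nonlin B l w ^ 2 ≤ 2 * (V * ∑ i ∈ Finset.range l, deriv B^[i] w ^ 2) := by
        have := (abs_le.1 h2).1
        linarith
      have h4 := hb n l hl w
      calc _ ≤ 2 * (V * ∑ i ∈ Finset.range l, deriv B^[i] w ^ 2) * gap B ρ n w ^ 2 :=
            mul_le_mul_of_nonneg_right h3 (sq_nonneg _)
        _ = 2 * V * ((∑ i ∈ Finset.range l, deriv B^[i] w ^ 2) * gap B ρ n w ^ 2) := by ring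
        _ ≤ 2 * V * (C * maxGap B ρ n) := mul_le_mul_of_nonneg_left h4 (by positivity)
        _ = _ := by ring
  refine le_trans ?_ key
  exact mul_le_mul (hw y) (pow_le_pow_left₀ hgx.le (hx w) 2) (sq_nonneg _) (sq_nonneg _)

lemma exists_nonlin_le (K : ℕ) : ∃ C, 0 ≤ C ∧ ∀ n, ∀ l ≤ K * cfDen ρ (n + 1), ∀ z,
    |nonlin B l z| * gap B ρ n z ≤ C * √(maxGap B ρ n) := by
  obtain ⟨C, hC, hb⟩ := h.exists_nonlin_le_min (K + 2)
  obtain ⟨D, hD, hc⟩ := h.exists_deriv_iter_compare 2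
  obtain ⟨E, hE, hEb⟩ := h.exists_abs_logD_le
  set F := D * Real.exp E with hF
  have hF0 : 0 ≤ F := mul_nonneg hD (Real.exp_pos _).le
  refine ⟨√(F ^ 2 * (4 * C)), by positivity, fun n l hl z => ?_⟩
  have hM := h.maxGap_pos n
  rw [← Real.sqrt_mul (by positivity)]
  refine Real.le_sqrt_of_sq_le ?_
  rw [mul_pow, sq_abs]
  obtain ⟨x, hx⟩ := h.exists_gap_min n
  obtain ⟨i, hi, k, y, hy, rfl⟩ := h.exists_cover n x z
  have h1 := hb n (l + i) (by rw [add_mul]; omega) x y hx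
  have h2 := hb n i (by rw [add_mul]; omega) x y hx
  have h3 := (hc n i hi.le y k).2
  have h4 := (h.gap_compare (hEb n) hy).1
  have h5 := h.nonlin_add l i y
  rw [← h.nonlin_tr l i k] at h5
  have hd := h.deriv_iter_pos i y
  have hgx := h.gap_pos n x
  have h6 : gap B ρ n (tr B i k y) ≤ F * (deriv B^[i] y * gap B ρ n x) := by
    calc _ ≤ _ := h3
      _ ≤ D * (deriv B^[i] y * (Real.exp E * gap B ρ n x)) := by gcongr
      _ = _ := by rw [hF]; ring
  have h7 : (nonlin B l (tr B i k y) * deriv B^[i] y) ^ 2 ≤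
      2 * nonlin B (l + i) y ^ 2 + 2 * nonlin B i y ^ 2 := by
    rw [show nonlin B l (tr B i k y) * deriv B^[i] y = nonlin B (l + i) y - nonlin B i y by
      rw [h5]; ring]
    nlinarith [sq_nonneg (nonlin B (l + i) y + nonlin B i y)]
  calc nonlin B l (tr B i k y) ^ 2 * gap B ρ n (tr B i k y) ^ 2
      ≤ nonlin B l (tr B i k y) ^ 2 * (F * (deriv B^[i] y * gap B ρ n x)) ^ 2 :=
        mul_le_mul_of_nonneg_left (pow_le_pow_left₀ (h.gap_pos _ _).le h6 2) (sq_nonneg _)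
    _ = F ^ 2 * ((nonlin B l (tr B i k y) * deriv B^[i] y) ^ 2 * gap B ρ n x ^ 2) := by ring
    _ ≤ F ^ 2 * ((2 * nonlin B (l + i) y ^ 2 + 2 * nonlin B i y ^ 2) * gap B ρ n x ^ 2) := by
        gcongr
    _ = F ^ 2 * (2 * (nonlin B (l + i) y ^ 2 * gap B ρ n x ^ 2) +
          2 * (nonlin B i y ^ 2 * gap B ρ n x ^ 2)) := by ring
    _ ≤ F ^ 2 * (2 * (C * maxGap B ρ n) + 2 * (C * maxGap B ρ n)) := by gcongr
    _ = _ := by ring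

/-- Distortion estimates improve as the square root of the maximal gap. -/
lemma exists_hasDist_sqrt (K : ℕ) :
    ∃ C, 0 ≤ C ∧ ∀ n, HasDist B ρ K n (C * √(maxGap B ρ n)) := by
  obtain ⟨C, hC, hb⟩ := h.exists_nonlin_le K
  obtain ⟨E, hE, hEb⟩ := h.exists_abs_logD_le
  refine ⟨C * Real.exp E, mul_nonneg hC (Real.exp_pos _).le, fun n l hl x z hz => ?_⟩
  obtain ⟨ξ, hξ, e⟩ := exists_sub_eq_deriv_mul (h.smooth_logD l).diff_infty x z
  have hξ' : ξ ∈ Set.uIcc x (ret B ρ n x) :=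
    Set.uIcc_subset_uIcc Set.left_mem_uIcc hz hξ
  have h1 : |z - x| ≤ gap B ρ n x := by
    rw [h.gap_eq_abs]
    exact Set.abs_sub_left_of_mem_uIcc hz
  have h2 := (h.gap_compare (hEb n) hξ').2
  rw [e, abs_mul]
  calc |nonlin B l ξ| * |z - x| ≤ |nonlin B l ξ| * (Real.exp E * gap B ρ n ξ) :=
        mul_le_mul_of_nonneg_left (h1.trans h2) (abs_nonneg _)
    _ = Real.exp E * (|nonlin B l ξ| * gap B ρ n ξ) := by ring
    _ ≤ Real.exp E * (C * √(maxGap B ρ n)) :=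
        mul_le_mul_of_nonneg_left (hb n l hl ξ) (Real.exp_pos E).le
    _ = _ := by ring

lemma exists_abs_logD_le_sqrt :
    ∃ C, 0 ≤ C ∧ ∀ n x, |logD B (cfDen ρ (n + 1)) x| ≤ C * √(maxGap B ρ n) := by
  obtain ⟨C, hC, hb⟩ := h.exists_hasDist_sqrt 2
  refine ⟨2 * C, by positivity, fun n x => ?_⟩
  have := h.abs_logD_succ_le (hb n) x
  linarith

/-! #### Higher derivatives of the iterates -/

lemma one_le_invScale (n : ℕ) (x : ℝ) : 1 ≤ invScale B ρ n x := by
  rw [invScale, one_le_div (h.gap_pos n x)]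
  refine (h.gap_le_maxGap n x).trans (Real.le_sqrt_of_sq_le ?_)
  have h1 := h.maxGap_le_one n
  have h2 := h.maxGap_pos n
  nlinarith

lemma invScale_pos (n : ℕ) (x : ℝ) : 0 < invScale B ρ n x :=
  one_pos.trans_le (h.one_le_invScale n x)

lemma exists_deriv_iter_le_invScale (K : ℕ) : ∃ C, 0 ≤ C ∧ ∀ n, ∀ l ≤ K * cfDen ρ (n + 1), ∀ x,
    deriv B^[l] x ≤ C * invScale B ρ n x := by
  obtain ⟨C, hC, hb⟩ := h.exists_deriv_iter_compare K
  refine ⟨C, hC, fun n l hl x => ?_⟩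
  have hg := h.gap_pos n x
  have hM := h.maxGap_pos n
  rw [invScale, mul_div_assoc', le_div_iff₀ hg]
  refine (hb n l hl x 0).1.trans (mul_le_mul_of_nonneg_left ?_ hC)
  refine (h.gap_le_maxGap n _).trans (Real.le_sqrt_of_sq_le ?_)
  have h1 := h.maxGap_le_one n
  nlinarith

lemma exists_sum_sq_le_invScale (K : ℕ) : ∃ C, 0 ≤ C ∧ ∀ n, ∀ l ≤ K * cfDen ρ (n + 1), ∀ x,
    ∑ i ∈ Finset.range l, deriv B^[i] x ^ 2 ≤ C * invScale B ρ n x ^ 2 := by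
  obtain ⟨C, hC, hb⟩ := h.exists_sum_sq_deriv_iter_le K
  refine ⟨C, hC, fun n l hl x => ?_⟩
  have hg := h.gap_pos n x
  rw [invScale, div_pow, Real.sq_sqrt (h.maxGap_pos n).le, mul_div_assoc', le_div_iff₀ (by positivity)]
  exact hb n l hl x

lemma derivBound_deriv_iter {K r : ℕ}
    (hr : DerivBound r (fun i : OrbitIndex ρ K => nonlin B i.1.2.1) (fun i => i.1.2.2)
      (fun i j => invScale B ρ i.1.1 i.1.2.2 ^ (j + 1))) :
    DerivBound (r + 1) (fun i : OrbitIndex ρ K => deriv B^[i.1.2.1]) (fun i => i.1.2.2)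
      (fun i j => deriv B^[i.1.2.1] i.1.2.2 * invScale B ρ i.1.1 i.1.2.2 ^ j) := by
  have hW : ∀ (i : OrbitIndex ρ K) (j : ℕ),
      0 ≤ deriv B^[i.1.2.1] i.1.2.2 * invScale B ρ i.1.1 i.1.2.2 ^ j := fun i j =>
    mul_nonneg (h.deriv_iter_pos _ _).le (pow_nonneg (h.invScale_pos _ _).le _)
  have h0 : DerivBound 0 (fun i : OrbitIndex ρ K => deriv B^[i.1.2.1]) (fun i => i.1.2.2)
      (fun i j => deriv B^[i.1.2.1] i.1.2.2 * invScale B ρ i.1.1 i.1.2.2 ^ j) :=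
    DerivBound.of_zero 1 zero_le_one fun i => by simp [abs_of_pos (h.deriv_iter_pos _ _)]
  have hd : ∀ i : OrbitIndex ρ K, deriv (deriv B^[i.1.2.1]) =
      fun x => nonlin B i.1.2.1 x * deriv B^[i.1.2.1] x := fun i =>
    funext fun x => (h.hasDerivAt_deriv_iter _ x).deriv
  have key : ∀ s ≤ r + 1, DerivBound s (fun i : OrbitIndex ρ K => deriv B^[i.1.2.1])
      (fun i => i.1.2.2)
      (fun i j => deriv B^[i.1.2.1] i.1.2.2 * invScale B ρ i.1.1 i.1.2.2 ^ j) := by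
    intro s hs
    induction s with
    | zero => exact h0
    | succ s ih =>
      refine DerivBound.of_deriv h0 ?_ hW
      simp only [hd]
      refine DerivBound.mul (fun i => h.smooth_nonlin _) (fun i => smooth_deriv (h.smooth_iter _))
        (hr.mono (by omega)) (ih (by omega)) (fun i j => pow_nonneg (h.invScale_pos _ _).le _)
        fun i a b _ => le_of_eq ?_
      ring
  exact key _ le_rfl

omit h in
lemma derivBound_const_family {ι : Type*} {φ : ℝ → ℝ} (hφ : ContDiff ℝ ∞ φ)
    (hp : ∀ x, φ (x + 1) = φ x) (N : ℕ) (x : ι → ℝ) :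
    DerivBound N (fun _ => φ) x (fun _ _ => 1) := by
  have : ∀ j : ℕ, ∃ C, 0 ≤ C ∧ ∀ x, |iteratedDeriv j φ x| ≤ C := fun j =>
    exists_abs_le_of_periodic (smooth_iteratedDeriv hφ j).continuous (iteratedDeriv_periodic hp j)
  choose C hC hb using this
  refine ⟨∑ j ∈ Finset.range (N + 1), C j, Finset.sum_nonneg fun j _ => hC j, fun i j hj => ?_⟩
  rw [mul_one]
  exact (hb j _).trans (Finset.single_le_sum (f := C) (fun j _ => hC j)
    (by simp; omega))

lemma invScale_pow_nonneg (n : ℕ) (x : ℝ) (j : ℕ) : 0 ≤ invScale B ρ n x ^ j :=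
  pow_nonneg (h.invScale_pos n x).le j

lemma smooth_deriv_iter (l : ℕ) : ContDiff ℝ ∞ (deriv B^[l]) := smooth_deriv (h.smooth_iter l)

lemma smooth_schw_iter (l : ℕ) : ContDiff ℝ ∞ fun x => schw B (B^[l] x) :=
  h.smooth_schw.comp (h.smooth_iter l)

lemma derivBound_schw_iter {K r : ℕ}
    (hD : DerivBound r (fun i : OrbitIndex ρ K => deriv B^[i.1.2.1]) (fun i => i.1.2.2)
      (fun i j => deriv B^[i.1.2.1] i.1.2.2 * invScale B ρ i.1.1 i.1.2.2 ^ j)) :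
    DerivBound r (fun (i : OrbitIndex ρ K) x => schw B (B^[i.1.2.1] x))
      (fun i => i.1.2.2) (fun i j => invScale B ρ i.1.1 i.1.2.2 ^ j) := by
  obtain ⟨C, hC, hb⟩ := h.exists_deriv_iter_le_invScale K
  have h1 : DerivBound r (fun _ : OrbitIndex ρ K => schw B) (fun i => B^[i.1.2.1] i.1.2.2)
      (fun i _ => invScale B ρ i.1.1 i.1.2.2 ^ 0) := by
    simp only [pow_zero]
    exact derivBound_const_family h.smooth_schw h.schw_periodic r _
  have h2 : DerivBound r (fun i : OrbitIndex ρ K => deriv B^[i.1.2.1]) (fun i => i.1.2.2)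
      (fun i j => invScale B ρ i.1.1 i.1.2.2 ^ (j + 1)) := by
    refine hD.weaken C hC fun i j _ => ?_
    calc _ ≤ (C * invScale B ρ i.1.1 i.1.2.2) * invScale B ρ i.1.1 i.1.2.2 ^ j :=
          mul_le_mul_of_nonneg_right (hb _ _ i.2 _) (h.invScale_pow_nonneg _ _ _)
      _ = _ := by ring
  have hX : ∀ (i : OrbitIndex ρ K) (s a : ℕ), 0 ≤ invScale B ρ i.1.1 i.1.2.2 ^ a :=
    fun i _ a => h.invScale_pow_nonneg _ _ _
  have hXZ : ∀ (i : OrbitIndex ρ K) (s a b : ℕ), invScale B ρ i.1.1 i.1.2.2 ^ a *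
      invScale B ρ i.1.1 i.1.2.2 ^ (b + 1) ≤ invScale B ρ i.1.1 i.1.2.2 ^ (a + b + 1) :=
    fun i _ a b => le_of_eq (by rw [← pow_add, add_assoc])
  have h3 := DerivBound.comp (φ := fun _ : OrbitIndex ρ K => schw B)
    (u := fun i : OrbitIndex ρ K => B^[i.1.2.1]) (x := fun i : OrbitIndex ρ K => i.1.2.2)
    (X := fun i _ a => invScale B ρ i.1.1 i.1.2.2 ^ a)
    (fun _ => h.smooth_schw) (fun i => h.smooth_iter _) h1 h2 hX hXZ
  beta_reduce at h3
  exact h3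

lemma derivBound_schw_mul_sq {K r : ℕ}
    (hD : DerivBound r (fun i : OrbitIndex ρ K => deriv B^[i.1.2.1]) (fun i => i.1.2.2)
      (fun i j => deriv B^[i.1.2.1] i.1.2.2 * invScale B ρ i.1.1 i.1.2.2 ^ j)) :
    DerivBound r
      (fun (i : OrbitIndex ρ K) x => schw B (B^[i.1.2.1] x) * deriv B^[i.1.2.1] x ^ 2)
      (fun i => i.1.2.2)
      (fun i j => deriv B^[i.1.2.1] i.1.2.2 ^ 2 * invScale B ρ i.1.1 i.1.2.2 ^ j) := by
  have hD2 : DerivBound r (fun (i : OrbitIndex ρ K) x => deriv B^[i.1.2.1] x * deriv B^[i.1.2.1] x)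
      (fun i => i.1.2.2)
      (fun i j => deriv B^[i.1.2.1] i.1.2.2 ^ 2 * invScale B ρ i.1.1 i.1.2.2 ^ j) :=
    DerivBound.mul (fun i => h.smooth_deriv_iter _) (fun i => h.smooth_deriv_iter _) hD hD
      (fun i j => mul_nonneg (h.deriv_iter_pos _ _).le (h.invScale_pow_nonneg _ _ _))
      fun i a b _ => le_of_eq (by ring)
  simp only [pow_two (deriv _ _)] at hD2 ⊢
  exact DerivBound.mul (fun i => h.smooth_schw_iter _)
    (fun i => (h.smooth_deriv_iter _).mul (h.smooth_deriv_iter _)) (h.derivBound_schw_iter hD) hD2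
    (fun i j => h.invScale_pow_nonneg _ _ _) fun i a b _ => le_of_eq (by ring)

lemma derivBound_sum_schw {K r : ℕ}
    (hD : DerivBound r (fun i : OrbitIndex ρ K => deriv B^[i.1.2.1]) (fun i => i.1.2.2)
      (fun i j => deriv B^[i.1.2.1] i.1.2.2 * invScale B ρ i.1.1 i.1.2.2 ^ j)) :
    DerivBound r (fun (i : OrbitIndex ρ K) x => ∑ m ∈ Finset.range i.1.2.1,
      schw B (B^[m] x) * deriv B^[m] x ^ 2) (fun i => i.1.2.2)
      (fun i j => invScale B ρ i.1.1 i.1.2.2 ^ (j + 2)) := by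
  obtain ⟨C, hC, hb⟩ := h.derivBound_schw_mul_sq hD
  obtain ⟨D, hD, hs⟩ := h.exists_sum_sq_le_invScale K
  refine ⟨C * D, by positivity, fun i j hj => ?_⟩
  have hsm : ∀ m : ℕ, ContDiff ℝ ∞ (fun x => schw B (B^[m] x) * deriv B^[m] x ^ 2) := fun m =>
    (h.smooth_schw_iter m).mul ((h.smooth_deriv_iter m).pow 2)
  rw [iteratedDeriv_fun_sum fun m _ => (hsm m).at_nat j _]
  refine (Finset.abs_sum_le_sum_abs _ _).trans ?_
  calc _ ≤ ∑ m ∈ Finset.range i.1.2.1,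
        C * (deriv B^[m] i.1.2.2 ^ 2 * invScale B ρ i.1.1 i.1.2.2 ^ j) := by
        refine Finset.sum_le_sum fun m hm => ?_
        exact hb ⟨(i.1.1, m, i.1.2.2), (Finset.mem_range.1 hm).le.trans i.2⟩ j hj
    _ = C * invScale B ρ i.1.1 i.1.2.2 ^ j *
          ∑ m ∈ Finset.range i.1.2.1, deriv B^[m] i.1.2.2 ^ 2 := by
        rw [Finset.mul_sum]
        exact Finset.sum_congr rfl fun m _ => by ring
    _ ≤ C * invScale B ρ i.1.1 i.1.2.2 ^ j * (D * invScale B ρ i.1.1 i.1.2.2 ^ 2) :=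
        mul_le_mul_of_nonneg_left (hs _ _ i.2 _) (mul_nonneg hC (h.invScale_pow_nonneg _ _ _))
    _ = _ := by ring

lemma derivBound_nonlin (K r : ℕ) :
    DerivBound r (fun i : OrbitIndex ρ K => nonlin B i.1.2.1) (fun i => i.1.2.2)
      (fun i j => invScale B ρ i.1.1 i.1.2.2 ^ (j + 1)) := by
  induction r with
  | zero =>
    obtain ⟨C, hC, hb⟩ := h.exists_nonlin_le K
    refine DerivBound.of_zero C hC fun i => ?_
    rw [zero_add, pow_one, invScale, mul_div_assoc', le_div_iff₀ (h.gap_pos _ _)]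
    exact hb _ _ i.2 _
  | succ r ih =>
    refine DerivBound.of_deriv (ih.mono (Nat.zero_le _)) ?_ fun i j => h.invScale_pow_nonneg _ _ _
    have hd : ∀ i : OrbitIndex ρ K, deriv (nonlin B i.1.2.1) = fun x =>
        (1 / 2) * (nonlin B i.1.2.1 x * nonlin B i.1.2.1 x) +
          ∑ m ∈ Finset.range i.1.2.1, schw B (B^[m] x) * deriv B^[m] x ^ 2 := fun i =>
      funext fun x => by rw [h.deriv_nonlin]; ring
    have hn : ∀ i : OrbitIndex ρ K, ContDiff ℝ ∞ (nonlin B i.1.2.1) := fun i => h.smooth_nonlin _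
    have hsq : DerivBound r (fun (i : OrbitIndex ρ K) x => nonlin B i.1.2.1 x * nonlin B i.1.2.1 x)
        (fun i => i.1.2.2) (fun i j => invScale B ρ i.1.1 i.1.2.2 ^ (j + 2)) :=
      DerivBound.mul hn hn ih ih (fun i j => h.invScale_pow_nonneg _ _ _)
        fun i a b _ => le_of_eq (by ring)
    have hsq' : DerivBound r
        (fun (i : OrbitIndex ρ K) x => (1 / 2) * (nonlin B i.1.2.1 x * nonlin B i.1.2.1 x))
        (fun i => i.1.2.2) (fun i j => invScale B ρ i.1.1 i.1.2.2 ^ (j + 2)) :=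
      hsq.const_mul (fun _ => 1 / 2) 1 zero_le_one fun i j _ => by
        rw [abs_of_pos (by norm_num)]
        linarith [h.invScale_pow_nonneg i.1.1 i.1.2.2 (j + 2)]
    simp only [hd]
    refine DerivBound.add (fun i => contDiff_const.mul ((hn i).mul (hn i)))
      (fun i => ContDiff.sum fun m _ => (h.smooth_schw_iter m).mul ((h.smooth_deriv_iter m).pow 2))
      hsq' ?_
    exact h.derivBound_sum_schw ((h.derivBound_deriv_iter ih).mono (Nat.le_succ r))

lemma exists_iteratedDeriv_ret_le (k : ℕ) : ∃ C, 0 ≤ C ∧ ∀ n x,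
    |iteratedDeriv (k + 1) (ret B ρ (n + 1)) x| ≤ C * invScale B ρ n x ^ k := by
  obtain ⟨C, hC, hb⟩ := h.derivBound_deriv_iter (h.derivBound_nonlin 1 k)
  obtain ⟨E, hE, hEb⟩ := h.exists_abs_logD_le
  refine ⟨C * Real.exp E, mul_nonneg hC (Real.exp_pos _).le, fun n x => ?_⟩
  have h1 := hb ⟨(n, cfDen ρ (n + 1), x), by simp⟩ k (by omega)
  have h2 : deriv (ret B ρ (n + 1)) = deriv B^[cfDen ρ (n + 1)] := funext (deriv_ret _)
  rw [iteratedDeriv_succ', h2]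
  refine h1.trans ?_
  have h3 : deriv B^[cfDen ρ (n + 1)] x ≤ Real.exp E := by
    rw [← h.exp_logD]
    exact Real.exp_le_exp.2 (abs_le.1 (hEb _ _)).2
  rw [mul_assoc]
  exact mul_le_mul_of_nonneg_left (mul_le_mul_of_nonneg_right h3
    (pow_nonneg (h.invScale_pos _ _).le _)) hC

end DioLift

/-- The interpolation bound along a monotone sequence of nodes of either direction. -/
lemma exists_interpolation_bound_sign (k : ℕ) (D : ℝ) (hD : 0 ≤ D) :
    ∃ C : ℝ, 0 ≤ C ∧ ∀ (f : ℝ → ℝ) (s : ℝ) (z : ℕ → ℝ) (a b m η Q : ℝ), s * s = 1 →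
      ContDiff ℝ ∞ f → 0 < m → s * b - s * a ≤ D * m →
      (∀ i < 2 ^ (k + 1), s * z i ∈ Set.Icc (s * a) (s * b)) →
      (∀ i, i + 1 < 2 ^ (k + 1) → s * z i + m ≤ s * z (i + 1)) →
      (∀ i < 2 ^ (k + 1), |f (z i)| ≤ η) →
      (∀ x, s * x ∈ Set.Icc (s * a) (s * b) → |iteratedDeriv (k + 1) f x| ≤ Q) →
      ∀ x, s * x ∈ Set.Icc (s * a) (s * b) → |f x| ≤ C * (η + Q * m ^ (k + 1)) := by
  obtain ⟨C, hC, hb⟩ := exists_interpolation_bound (k + 1) D hD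
  refine ⟨C, hC, fun f s z a b m η Q hs hf hm hab hz hgap hη hQ x hx => ?_⟩
  have hss : ∀ y, s * (s * y) = y := fun y => by rw [← mul_assoc, hs, one_mul]
  have hs1 : |s| = 1 := by
    have h1 : |s| * |s| = 1 := by rw [← abs_mul, hs, abs_one]
    nlinarith [abs_nonneg s]
  have := hb (fun t => f (s * t)) (fun i => s * z i) (s * a) (s * b) m η Q
    (hf.comp (contDiff_const.mul contDiff_id)) hm hab hz hgap
    (fun i hi => by simpa only [hss] using hη i hi)
    (fun t ht => by
      rw [iteratedDeriv_comp_const_mul (hf.of_le (by exact_mod_cast le_top)), abs_mul, abs_pow, hs1,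
        one_pow, one_mul]
      exact hQ _ (by rwa [hss])) 0 k.succ_pos (s * x) hx
  simpa [hss] using this

namespace DioLift

variable {B : ℝ → ℝ} {ρ : ℝ} (h : DioLift B ρ)
include h

lemma ret_lt (n : ℕ) (x : ℝ) : cfSign n * x < cfSign n * ret B ρ n x := by
  have := h.gap_pos n x
  rw [gap] at this
  linarith

lemma ret_strictMono (n : ℕ) {x y : ℝ} (hxy : cfSign n * x ≤ cfSign n * y) :
    cfSign n * ret B ρ n x ≤ cfSign n * ret B ρ n y := by
  have hm := (h.strictMono_tr (cfDen ρ n) (-cfNum ρ n)).monotone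
  rcases cfSign_eq n with e | e <;> rw [e] at hxy ⊢
  · have := hm (by linarith : x ≤ y)
    simp only [ret]; linarith
  · have := hm (by linarith : y ≤ x)
    simp only [ret]; linarith

lemma ret_iterate_mono (n j : ℕ) {x y : ℝ} (hxy : cfSign n * x ≤ cfSign n * y) :
    cfSign n * (ret B ρ n)^[j] x ≤ cfSign n * (ret B ρ n)^[j] y := by
  induction j with
  | zero => exact hxy
  | succ j ih =>
    rw [Function.iterate_succ_apply', Function.iterate_succ_apply']
    exact h.ret_strictMono n ih

lemma le_ret_iterate (n i j : ℕ) (hij : i ≤ j) (x : ℝ) :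
    cfSign n * (ret B ρ n)^[i] x ≤ cfSign n * (ret B ρ n)^[j] x := by
  induction j, hij using Nat.le_induction with
  | base => exact le_rfl
  | succ j _ ih =>
    rw [Function.iterate_succ_apply']
    exact ih.trans (h.ret_lt n _).le

lemma gap_compare_iterate {n : ℕ} {e : ℝ} (he : ∀ x, |logD B (cfDen ρ n) x| ≤ e) (j : ℕ) {x z : ℝ}
    (h1 : cfSign n * x ≤ cfSign n * z) (h2 : cfSign n * z ≤ cfSign n * (ret B ρ n)^[j] x) :
    gap B ρ n z ≤ Real.exp (j * e) * gap B ρ n x ∧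
      gap B ρ n x ≤ Real.exp (j * e) * gap B ρ n z := by
  have he0 : 0 ≤ e := (abs_nonneg _).trans (he x)
  induction j generalizing x with
  | zero =>
    have : cfSign n ≠ 0 := by rcases cfSign_eq n with e | e <;> rw [e] <;> norm_num
    obtain rfl : z = x := mul_left_cancel₀ this (le_antisymm h2 h1)
    simp
  | succ j ih =>
    have hx : gap B ρ n (ret B ρ n x) ≤ Real.exp e * gap B ρ n x ∧
        gap B ρ n x ≤ Real.exp e * gap B ρ n (ret B ρ n x) :=
      h.gap_compare he Set.right_mem_uIcc
    have hexp : Real.exp ((j + 1 : ℕ) * e) = Real.exp (j * e) * Real.exp e := by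
      rw [← Real.exp_add]; push_cast; ring_nf
    rw [hexp]
    rcases le_total (cfSign n * z) (cfSign n * ret B ρ n x) with h3 | h3
    · obtain ⟨h4, h5⟩ := h.gap_compare he (h.mem_seg.2 ⟨h1, h3⟩)
      have h6 : 1 ≤ Real.exp (j * e) := Real.one_le_exp (by positivity)
      have h7 := h.gap_pos n x
      have h8 := h.gap_pos n z
      rw [mul_assoc, mul_assoc]
      exact ⟨h4.trans (le_mul_of_one_le_left (by positivity) h6),
        h5.trans (le_mul_of_one_le_left (by positivity) h6)⟩
    · obtain ⟨h4, h5⟩ := ih h3 h2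
      constructor
      · calc _ ≤ _ := h4
          _ ≤ Real.exp (j * e) * (Real.exp e * gap B ρ n x) :=
            mul_le_mul_of_nonneg_left hx.1 (Real.exp_pos _).le
          _ = _ := by ring
      · calc _ ≤ _ := hx.2
          _ ≤ Real.exp e * (Real.exp (j * e) * gap B ρ n z) :=
            mul_le_mul_of_nonneg_left h5 (Real.exp_pos _).le
          _ = _ := by ring

omit h in
lemma abs_sub_le_of_exp {t E u v : ℝ} (ht : 0 ≤ t) (hE : t ≤ E) (hv : 0 ≤ v)
    (h1 : u ≤ Real.exp t * v) (h2 : v ≤ Real.exp t * u) :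
    |u - v| ≤ t * Real.exp E * v := by
  have h3 : Real.exp t - 1 ≤ t * Real.exp t := by
    have := Real.add_one_le_exp (-t)
    have h4 : Real.exp (-t) * Real.exp t = 1 := by rw [← Real.exp_add]; simp
    nlinarith [Real.exp_pos t]
  have h5 : t * Real.exp t ≤ t * Real.exp E :=
    mul_le_mul_of_nonneg_left (Real.exp_le_exp.2 hE) ht
  have h4 : Real.exp (-t) * Real.exp t = 1 := by rw [← Real.exp_add]; simp
  have h6 : Real.exp (-t) * v ≤ u := by
    calc _ ≤ Real.exp (-t) * (Real.exp t * u) :=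
          mul_le_mul_of_nonneg_left h2 (Real.exp_pos _).le
      _ = u := by rw [← mul_assoc, h4, one_mul]
  have h7 := Real.add_one_le_exp (-t)
  have h8 : t ≤ t * Real.exp E := le_mul_of_one_le_right ht (Real.one_le_exp (ht.trans hE))
  rw [abs_le]
  constructor <;> nlinarith

lemma gap_ret_compare (n m : ℕ) {e : ℝ} (he : ∀ x, |logD B (cfDen ρ n) x| ≤ e) (x : ℝ) :
    gap B ρ m (ret B ρ n x) ≤ Real.exp e * gap B ρ m x ∧
      gap B ρ m x ≤ Real.exp e * gap B ρ m (ret B ρ n x) := by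
  obtain ⟨ξ, -, hξ⟩ := h.gap_tr_eq_deriv m (cfDen ρ n) (-cfNum ρ n) x
  rw [← h.exp_logD] at hξ
  obtain ⟨h3, h4⟩ := abs_le.1 (he ξ)
  have hg := h.gap_pos m x
  rw [ret, hξ]
  constructor
  · exact mul_le_mul_of_nonneg_right (Real.exp_le_exp.2 h4) hg.le
  · rw [← mul_assoc, ← Real.exp_add]
    exact le_mul_of_one_le_left hg.le (Real.one_le_exp (by linarith))

lemma gap_ret_iterate_compare (n m j : ℕ) {e : ℝ} (he : ∀ x, |logD B (cfDen ρ n) x| ≤ e) (x : ℝ) :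
    gap B ρ m ((ret B ρ n)^[j] x) ≤ Real.exp (j * e) * gap B ρ m x ∧
      gap B ρ m x ≤ Real.exp (j * e) * gap B ρ m ((ret B ρ n)^[j] x) := by
  induction j with
  | zero => simp
  | succ j ih =>
    have hx := h.gap_ret_compare n m he ((ret B ρ n)^[j] x)
    have hexp : Real.exp ((j + 1 : ℕ) * e) = Real.exp (j * e) * Real.exp e := by
      rw [← Real.exp_add]; push_cast; ring_nf
    rw [hexp, Function.iterate_succ_apply']
    constructor
    · calc _ ≤ _ := hx.1
        _ ≤ Real.exp e * (Real.exp (j * e) * gap B ρ m x) :=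
          mul_le_mul_of_nonneg_left ih.1 (Real.exp_pos _).le
        _ = _ := by ring
    · calc _ ≤ _ := ih.2
        _ ≤ Real.exp (j * e) * (Real.exp e * _) :=
          mul_le_mul_of_nonneg_left hx.2 (Real.exp_pos _).le
        _ = _ := by ring

omit h in
lemma gap_eq (n : ℕ) : gap B ρ n = fun x => cfSign n * (ret B ρ n x - x) := rfl

lemma abs_iteratedDeriv_gap (n k : ℕ) (x : ℝ) :
    |iteratedDeriv (k + 2) (gap B ρ n) x| = |iteratedDeriv (k + 2) (ret B ρ n) x| := by
  rw [gap_eq, iteratedDeriv_const_mul_field, abs_mul, abs_cfSign, one_mul,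
    iteratedDeriv_fun_sub (g := fun x => x) ((h.smooth_ret n).at_nat _ _) contDiff_id.contDiffAt,
    iteratedDeriv_fun_id]
  simp

lemma iteratedDeriv_gap_sub_const (n k : ℕ) (c x : ℝ) :
    iteratedDeriv (k + 1) (fun y => gap B ρ n y - c) x = iteratedDeriv (k + 1) (gap B ρ n) x := by
  rw [iteratedDeriv_fun_sub ((h.smooth_gap n).at_nat _ _) contDiff_const.contDiffAt,
    iteratedDeriv_const]
  simp

/-- Near-constancy of the next gap over a segment. -/
lemma exists_gap_succ_sub_le (K : ℕ) : ∃ C, 0 ≤ C ∧ ∀ n e w x y,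
    (∀ z, |logD B (cfDen ρ n) z| ≤ e) → x ∈ Set.uIcc w (ret B ρ n w) →
    y ∈ Set.uIcc w (ret B ρ n w) → |gap B ρ (n + 1) x - gap B ρ (n + 1) y| ≤
      C * (e * gap B ρ (n + 1) y + maxGap B ρ n ^ (K + 1) * gap B ρ n w) := by
  obtain ⟨E, hE, hEb⟩ := h.exists_abs_logD_le
  obtain ⟨C₁, hC₁, hret⟩ := h.exists_iteratedDeriv_ret_le (2 * K + 2)
  set N : ℕ := 2 ^ (2 * K + 2 + 1) with hN
  set F : ℝ := Real.exp (N * E) with hF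
  have hF1 : 1 ≤ F := Real.one_le_exp (by positivity)
  have hF0 : 0 < F := one_pos.trans_le hF1
  obtain ⟨C₀, hC₀, hinterp⟩ := exists_interpolation_bound_sign (2 * K + 2) (N * F * F) (by positivity)
  set C₂ : ℝ := N * F + C₁ * F ^ (2 * K + 2) with hC₂
  refine ⟨C₀ * C₂, by positivity, fun n e' w x y he' hx hy => ?_⟩
  obtain ⟨e, he, hee', heE⟩ : ∃ e, (∀ z, |logD B (cfDen ρ n) z| ≤ e) ∧ e ≤ e' ∧ e ≤ E :=
    ⟨min e' E, fun z => le_min (he' z) (hEb n z), min_le_left _ _, min_le_right _ _⟩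
  have he0 : 0 ≤ e := (abs_nonneg _).trans (he 0)
  have hgw := h.gap_pos n w
  have hgy := h.gap_pos (n + 1) y
  have hM := h.maxGap_pos n
  have hN1 : 1 ≤ N := Nat.one_le_two_pow
  have hexp : ∀ j : ℕ, j ≤ N → Real.exp (j * E) ≤ F := fun j hj =>
    Real.exp_le_exp.2 (mul_le_mul_of_nonneg_right (by exact_mod_cast hj) hE)
  have hcmp : ∀ z, cfSign n * w ≤ cfSign n * z → cfSign n * z ≤ cfSign n * (ret B ρ n)^[N] w →
      gap B ρ n z ≤ F * gap B ρ n w ∧ gap B ρ n w ≤ F * gap B ρ n z := fun z =>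
    h.gap_compare_iterate (hEb n) N
  set m : ℝ := gap B ρ n w / F with hm
  have hm0 : 0 < m := by positivity
  have hwm : gap B ρ n w = F * m := by rw [hm]; field_simp
  obtain ⟨hy1, hy2⟩ := h.mem_seg.1 hy
  obtain ⟨hx1, hx2⟩ := h.mem_seg.1 hx
  have hnode : ∀ i < N, cfSign n * w ≤ cfSign n * (ret B ρ n)^[i] y ∧
      cfSign n * (ret B ρ n)^[i] y ≤ cfSign n * (ret B ρ n)^[N] w := by
    intro i hi
    constructor
    · exact hy1.trans (h.le_ret_iterate n 0 i (Nat.zero_le _) y)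
    · refine (h.ret_iterate_mono n i hy2).trans ?_
      rw [← Function.iterate_succ_apply]
      exact h.le_ret_iterate n _ _ hi w
  have hlen : cfSign n * (ret B ρ n)^[N] w - cfSign n * w ≤ N * F * F * m := by
    rw [cfSign_ret_iterate]
    calc _ ≤ ∑ i ∈ Finset.range N, F * gap B ρ n w := by
          refine Finset.sum_le_sum fun i hi => ?_
          have hi' := (Finset.mem_range.1 hi).le
          refine ((h.gap_ret_iterate_compare n n i (hEb n) w).1).trans ?_
          exact mul_le_mul_of_nonneg_right (hexp i hi') hgw.le
      _ = _ := by rw [Finset.sum_const, Finset.card_range, hwm, nsmul_eq_mul]; ring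
  have key := hinterp (fun z => gap B ρ (n + 1) z - gap B ρ (n + 1) y) (cfSign n)
    (fun i => (ret B ρ n)^[i] y) w ((ret B ρ n)^[N] w) m (N * e * F * gap B ρ (n + 1) y)
    (C₁ * (F * √(maxGap B ρ n) / gap B ρ n w) ^ (2 * K + 2)) (cfSign_mul_self n)
    ((h.smooth_gap _).sub contDiff_const) hm0 hlen hnode ?_ ?_ ?_ x
    ⟨hx1, hx2.trans (h.le_ret_iterate n 1 N hN1 w)⟩
  · refine key.trans ?_
    rw [mul_assoc C₀ C₂]
    refine mul_le_mul_of_nonneg_left ?_ hC₀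
    have h1 : C₁ * (F * √(maxGap B ρ n) / gap B ρ n w) ^ (2 * K + 2) * m ^ (2 * K + 2 + 1) ≤
        C₁ * F ^ (2 * K + 2) * (maxGap B ρ n ^ (K + 1) * gap B ρ n w) := by
      have h2 : √(maxGap B ρ n) ^ (2 * K + 2) = maxGap B ρ n ^ (K + 1) := by
        rw [show 2 * K + 2 = 2 * (K + 1) by ring, pow_mul, Real.sq_sqrt hM.le]
      have h3 : m ≤ gap B ρ n w := by rw [hm]; exact div_le_self hgw.le hF1
      have h4 : m ^ (2 * K + 2 + 1) ≤ gap B ρ n w ^ (2 * K + 2 + 1) :=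
        pow_le_pow_left₀ hm0.le h3 _
      rw [div_pow, mul_pow, h2]
      calc _ ≤ C₁ * (F ^ (2 * K + 2) * maxGap B ρ n ^ (K + 1) / gap B ρ n w ^ (2 * K + 2)) *
            gap B ρ n w ^ (2 * K + 2 + 1) :=
            mul_le_mul_of_nonneg_left h4 (by positivity)
        _ = _ := by field_simp; ring
    have h5 : N * e * F * gap B ρ (n + 1) y ≤ N * F * (e' * gap B ρ (n + 1) y) := by
      have : e * gap B ρ (n + 1) y ≤ e' * gap B ρ (n + 1) y :=
        mul_le_mul_of_nonneg_right hee' hgy.le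
      calc _ = N * F * (e * gap B ρ (n + 1) y) := by ring
        _ ≤ _ := mul_le_mul_of_nonneg_left this (by positivity)
    have h6 : 0 ≤ C₁ * F ^ (2 * K + 2) * (e' * gap B ρ (n + 1) y) := by
      have := he0.trans hee'
      positivity
    have h7 : 0 ≤ N * F * (maxGap B ρ n ^ (K + 1) * gap B ρ n w) := by positivity
    rw [hC₂]
    linarith
  · intro i hi
    have hi' : i < N := by omega
    obtain ⟨h1, h2⟩ := hnode i hi'
    have h3 := (hcmp _ h1 h2).2
    have h4 : m ≤ gap B ρ n ((ret B ρ n)^[i] y) := by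
      rw [hm, div_le_iff₀ hF0, mul_comm]
      exact h3
    rw [gap] at h4
    rw [Function.iterate_succ_apply']
    linarith
  · intro i hi
    obtain ⟨h1, h2⟩ := h.gap_ret_iterate_compare n (n + 1) i he y
    have hiN : (i : ℝ) ≤ N := by exact_mod_cast hi.le
    have h3 : i * e ≤ N * e := mul_le_mul_of_nonneg_right hiN he0
    have h4 : (i : ℝ) * e ≤ N * E := h3.trans (mul_le_mul_of_nonneg_left heE (by positivity))
    refine (abs_sub_le_of_exp (by positivity) h4 hgy.le h1 h2).trans ?_
    exact mul_le_mul_of_nonneg_right (mul_le_mul_of_nonneg_right h3 hF0.le) hgy.le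
  · rintro z ⟨hz1, hz2⟩
    rw [show 2 * K + 2 + 1 = (2 * K + 1) + 1 + 1 by ring, h.iteratedDeriv_gap_sub_const,
      h.abs_iteratedDeriv_gap]
    refine (hret n z).trans ?_
    refine mul_le_mul_of_nonneg_left (pow_le_pow_left₀ (h.invScale_pos n z).le ?_ _) hC₁
    rw [invScale, div_le_div_iff₀ (h.gap_pos n z) hgw]
    have := (hcmp z hz1 hz2).2
    calc _ ≤ √(maxGap B ρ n) * (F * gap B ρ n z) :=
          mul_le_mul_of_nonneg_left this (Real.sqrt_nonneg _)
      _ = _ := by ring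

lemma exists_gap_succ_le_div (n : ℕ) (x : ℝ) : ∃ y ∈ Set.uIcc x (ret B ρ n x),
    gap B ρ (n + 1) y * cfDist ρ n ≤ 2 * cfDist ρ (n + 1) * gap B ρ n x := by
  have hs := h.sum_gap_le n x
  have ha := one_le_cfCoeff h.irr n
  set a := cfCoeff ρ n
  obtain ⟨j, hj, hle⟩ : ∃ j ∈ Finset.range a,
      gap B ρ (n + 1) ((ret B ρ (n + 1))^[j] (ret B ρ n x)) * a ≤ gap B ρ n x := by
    by_contra! hcon
    have h1 : ∑ _j ∈ Finset.range a, gap B ρ n x <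
        ∑ j ∈ Finset.range a, gap B ρ (n + 1) ((ret B ρ (n + 1))^[j] (ret B ρ n x)) * a :=
      Finset.sum_lt_sum_of_nonempty ⟨0, by simp; omega⟩ hcon
    rw [← Finset.sum_mul, hs, Finset.sum_const, Finset.card_range, nsmul_eq_mul] at h1
    have h2 := h.gap_pos (n + 2) x
    have h3 : (0 : ℝ) < a := by exact_mod_cast ha
    nlinarith
  refine ⟨(ret B ρ (n + 1))^[j] (ret B ρ n x), h.mem_seg.2 ?_, ?_⟩
  rotate_left
  · have h1 := cfDist_le_coeff h.irr n
    have h2 := h.gap_pos (n + 1) ((ret B ρ (n + 1))^[j] (ret B ρ n x))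
    have h3 := cfDist_pos h.irr (n + 1)
    calc _ ≤ gap B ρ (n + 1) ((ret B ρ (n + 1))^[j] (ret B ρ n x)) *
            (2 * a * cfDist ρ (n + 1)) := mul_le_mul_of_nonneg_left h1 h2.le
      _ = 2 * cfDist ρ (n + 1) * (gap B ρ (n + 1) ((ret B ρ (n + 1))^[j] (ret B ρ n x)) * a) := by
          ring
      _ ≤ _ := mul_le_mul_of_nonneg_left hle (by positivity)
  · have h1 := h.le_ret_iterate (n + 1) 0 j (Nat.zero_le _) (ret B ρ n x)
    have h2 := h.le_ret_iterate (n + 1) j a (Finset.mem_range.1 hj).le (ret B ρ n x)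
    have h3 := h.ret_lt (n + 2) x
    rw [← h.ret_add_two] at h2
    simp only [cfSign_succ, Function.iterate_zero, id] at h1 h2 h3
    constructor <;> linarith

/-- The maximal gaps decay nearly as fast as the distances `|q_n ρ - p_n|`. -/
lemma exists_maxGap_succ_le (K : ℕ) : ∃ C, 0 ≤ C ∧ ∀ n, maxGap B ρ (n + 1) ≤
    C * (cfDist ρ (n + 1) / cfDist ρ n + maxGap B ρ n ^ (K + 1)) * maxGap B ρ n := by
  obtain ⟨E, hE, hEb⟩ := h.exists_abs_logD_le
  obtain ⟨C, hC, hb⟩ := h.exists_gap_succ_sub_le K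
  refine ⟨2 * (1 + C * E) + C, by positivity, fun n => ?_⟩
  obtain ⟨x, hx⟩ := h.exists_gap_eq_maxGap (n + 1)
  obtain ⟨y, hy, hle⟩ := h.exists_gap_succ_le_div n x
  have h1 := (abs_le.1 (hb n E x x y (hEb n) Set.left_mem_uIcc hy)).2
  have h2 := h.gap_le_maxGap n x
  have hα := cfDist_pos h.irr n
  have hα' := cfDist_pos h.irr (n + 1)
  have hM := h.maxGap_pos n
  have h3 : gap B ρ (n + 1) y ≤ 2 * (cfDist ρ (n + 1) / cfDist ρ n) * maxGap B ρ n := by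
    rw [← le_div_iff₀ hα] at hle
    refine hle.trans ?_
    rw [show 2 * (cfDist ρ (n + 1) / cfDist ρ n) * maxGap B ρ n =
      2 * cfDist ρ (n + 1) * maxGap B ρ n / cfDist ρ n by ring]
    gcongr
  have h4 : maxGap B ρ n ^ (K + 1) * gap B ρ n x ≤ maxGap B ρ n ^ (K + 1) * maxGap B ρ n := by
    gcongr
  rw [← hx]
  have h5 : 0 ≤ maxGap B ρ n ^ (K + 1) * maxGap B ρ n := by positivity
  have h6 : 0 ≤ cfDist ρ (n + 1) / cfDist ρ n * maxGap B ρ n := by positivity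
  calc gap B ρ (n + 1) x ≤ (1 + C * E) * gap B ρ (n + 1) y +
        C * (maxGap B ρ n ^ (K + 1) * gap B ρ n x) := by linarith
    _ ≤ (1 + C * E) * (2 * (cfDist ρ (n + 1) / cfDist ρ n) * maxGap B ρ n) +
        C * (maxGap B ρ n ^ (K + 1) * maxGap B ρ n) := by gcongr
    _ ≤ _ := by
      have h7 : 0 ≤ C * (cfDist ρ (n + 1) / cfDist ρ n * maxGap B ρ n) := by positivity
      have h8 : 0 ≤ (1 + C * E) * (maxGap B ρ n ^ (K + 1) * maxGap B ρ n) := by positivity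
      linarith

end DioLift

namespace DioLift

variable {B : ℝ → ℝ} {ρ : ℝ} (h : DioLift B ρ)
include h

omit h in
lemma exp_mul_le_one_add {c s : ℝ} (hc : 0 ≤ c) (hs : 0 ≤ s) (hs1 : s ≤ 1) :
    Real.exp (c * s) ≤ 1 + c * Real.exp c * s := by
  have h1 := Real.add_one_le_exp (-(c * s))
  have h2 : Real.exp (-(c * s)) * Real.exp (c * s) = 1 := by rw [← Real.exp_add]; simp
  have h3 : Real.exp (c * s) ≤ Real.exp c := Real.exp_le_exp.2 (by nlinarith)
  have h4 : 0 ≤ c * s := by positivity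
  nlinarith [Real.exp_pos (c * s)]

/-- The ratio of consecutive gaps transported along the orbit of a segment. -/
lemma gap_ratio_tr_le {n : ℕ} {δ : ℝ} (hδ : HasDist B ρ 2 n δ) {i : ℕ}
    (hi : i ≤ 2 * cfDen ρ (n + 1)) (k : ℤ) (x : ℝ) :
    gap B ρ (n + 1) (tr B i k x) / gap B ρ n (tr B i k x) ≤
      Real.exp (3 * δ) * (gap B ρ (n + 1) x / gap B ρ n x) := by
  obtain ⟨ξ, hξ, e1⟩ := h.gap_tr_eq_deriv (n + 1) i k x
  obtain ⟨ζ, hζ, e2⟩ := h.gap_tr_eq_deriv n i k x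
  have hmem := h.ret_succ_mem n x
  have hξ' : ξ ∈ Set.uIcc (ret B ρ (n + 1) x) (ret B ρ n (ret B ρ (n + 1) x)) :=
    Set.uIcc_subset_uIcc hmem Set.left_mem_uIcc hξ
  have d1 := (abs_le.1 (hδ i hi _ _ hξ')).2
  have d2 := (abs_le.1 (hδ i hi _ _ hmem)).1
  have d3 := (abs_le.1 (hδ i hi _ _ hζ)).1
  have hd : deriv B^[i] ξ ≤ Real.exp (3 * δ) * deriv B^[i] ζ := by
    rw [← h.exp_logD, ← h.exp_logD, ← Real.exp_add]
    exact Real.exp_le_exp.2 (by linarith)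
  have hp := h.deriv_iter_pos i ζ
  have hg := h.gap_pos n x
  have hg' := h.gap_pos (n + 1) x
  rw [e1, e2, div_le_iff₀ (by positivity)]
  calc _ ≤ Real.exp (3 * δ) * deriv B^[i] ζ * gap B ρ (n + 1) x :=
        mul_le_mul_of_nonneg_right hd hg'.le
    _ = _ := by field_simp

/-- Ratios of consecutive gaps are nearly constant. -/
lemma exists_gap_ratio_le (K : ℕ) : ∃ C, 0 ≤ C ∧ ∀ n w x,
    gap B ρ (n + 2) w / gap B ρ (n + 1) w ≤
      (1 + C * √(maxGap B ρ n)) * (gap B ρ (n + 2) x / gap B ρ (n + 1) x) +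
        C * maxGap B ρ (n + 1) ^ (K + 1) := by
  obtain ⟨A, hA, hdist⟩ := h.exists_hasDist_sqrt 2
  obtain ⟨L, hL, hlog⟩ := h.exists_abs_logD_le_sqrt
  obtain ⟨C, hC, hsub⟩ := h.exists_gap_succ_sub_le K
  set c := 3 * A + L with hc
  have hc0 : 0 ≤ c := by positivity
  set G := Real.exp c with hG
  have hG1 : 1 ≤ G := Real.one_le_exp hc0
  refine ⟨c * G + G * (C * L) + G * C, by positivity, fun n w x => ?_⟩
  obtain ⟨i, hi, k, y, hy, rfl⟩ := h.exists_cover (n + 1) x w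
  set s := √(maxGap B ρ n) with hs
  have hs0 : 0 ≤ s := Real.sqrt_nonneg _
  have hs1 : s ≤ 1 := Real.sqrt_le_one.2 (h.maxGap_le_one n)
  have hss : √(maxGap B ρ (n + 1)) ≤ s := Real.sqrt_le_sqrt (h.maxGap_succ_le n)
  have hx := h.gap_pos (n + 1) x
  have hx' := h.gap_pos (n + 2) x
  have hy' := h.gap_pos (n + 1) y
  have hM := h.maxGap_pos (n + 1)
  have h1 := h.gap_ratio_tr_le (hdist (n + 1)) hi.le k y
  have h2 := (abs_le.1 (hsub (n + 1) (L * s) x y x (hlog n) hy Set.left_mem_uIcc)).2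
  have h3 := (h.gap_compare (hlog n) hy).2
  have h4 : gap B ρ (n + 2) y / gap B ρ (n + 1) y ≤ Real.exp (L * s) *
      ((1 + C * (L * s)) * (gap B ρ (n + 2) x / gap B ρ (n + 1) x) +
        C * maxGap B ρ (n + 1) ^ (K + 1)) := by
    rw [div_le_iff₀ hy']
    calc gap B ρ (n + 2) y ≤ ((1 + C * (L * s)) * (gap B ρ (n + 2) x / gap B ρ (n + 1) x) +
          C * maxGap B ρ (n + 1) ^ (K + 1)) * gap B ρ (n + 1) x := by
          rw [add_mul, mul_assoc (1 + C * (L * s)), div_mul_cancel₀ _ hx.ne']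
          linarith
      _ ≤ ((1 + C * (L * s)) * (gap B ρ (n + 2) x / gap B ρ (n + 1) x) +
          C * maxGap B ρ (n + 1) ^ (K + 1)) * (Real.exp (L * s) * gap B ρ (n + 1) y) :=
          mul_le_mul_of_nonneg_left h3 (by positivity)
      _ = _ := by ring
  set R := gap B ρ (n + 2) x / gap B ρ (n + 1) x with hR
  have hR0 : 0 < R := by positivity
  have h5 : Real.exp (3 * (A * √(maxGap B ρ (n + 1)))) * Real.exp (L * s) ≤ Real.exp (c * s) := by
    rw [← Real.exp_add]
    refine Real.exp_le_exp.2 ?_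
    have := mul_le_mul_of_nonneg_left hss hA
    rw [hc]
    linarith
  have h6 := exp_mul_le_one_add hc0 hs0 hs1
  have h7 : Real.exp (c * s) ≤ G := Real.exp_le_exp.2 (by nlinarith)
  calc _ ≤ _ := h1
    _ ≤ Real.exp (3 * (A * √(maxGap B ρ (n + 1)))) * (Real.exp (L * s) *
      ((1 + C * (L * s)) * R + C * maxGap B ρ (n + 1) ^ (K + 1))) :=
        mul_le_mul_of_nonneg_left h4 (Real.exp_pos _).le
    _ = (Real.exp (3 * (A * √(maxGap B ρ (n + 1)))) * Real.exp (L * s)) *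
      ((1 + C * (L * s)) * R + C * maxGap B ρ (n + 1) ^ (K + 1)) := by ring
    _ ≤ Real.exp (c * s) * ((1 + C * (L * s)) * R + C * maxGap B ρ (n + 1) ^ (K + 1)) :=
        mul_le_mul_of_nonneg_right h5 (by positivity)
    _ = Real.exp (c * s) * R + Real.exp (c * s) * (C * L * s * R) +
        Real.exp (c * s) * (C * maxGap B ρ (n + 1) ^ (K + 1)) := by ring
    _ ≤ (1 + c * G * s) * R + G * (C * L * s * R) + G * (C * maxGap B ρ (n + 1) ^ (K + 1)) := by
        gcongr
    _ ≤ _ := by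
        have e1 : 0 ≤ G * C * s * R := by positivity
        have e2 : 0 ≤ (c * G + G * (C * L)) * maxGap B ρ (n + 1) ^ (K + 1) := by positivity
        linarith

end DioLift

lemma exists_forall_le_of_add_le {L : ℕ → ℝ} {κ : ℝ} (hκ : 0 < κ) (hL0 : 0 ≤ L 0)
    (hLm : Monotone L) (hLk : ∀ n, L n + κ ≤ L (n + 2)) (T : ℝ) : ∃ n₀, ∀ n ≥ n₀, T ≤ L n := by
  have h1 : ∀ j : ℕ, j * κ ≤ L (2 * j) := by
    intro j
    induction j with
    | zero => simpa using hL0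
    | succ j ih =>
      have := hLk (2 * j)
      rw [mul_add, mul_one]
      push_cast
      linarith
  obtain ⟨j, hj⟩ := exists_nat_ge (T / κ)
  rw [div_le_iff₀ hκ] at hj
  exact ⟨2 * j, fun n hn => (hj.trans (h1 j)).trans (hLm hn)⟩

/-- Bootstrap of the growth of `L = -log M` relative to `l = -log α`. -/
lemma exists_le_mul_of_growth {L l : ℕ → ℝ} {κ b d : ℝ} (hκ : 0 < κ) (hb : 0 ≤ b)
    (hL0 : ∀ n, 0 ≤ L n) (hLm : Monotone L) (hLk : ∀ n, L n + κ ≤ L (n + 2)) (hlm : Monotone l)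
    (hLl : ∀ n, L n ≤ l n) (hgrow : ∀ n, l (n + 1) ≤ (1 + b) * l n + d)
    (hF : ∀ K : ℕ, ∃ c, ∀ n, L n + min (l (n + 1) - l n) ((K + 1) * L n) - c ≤ L (n + 1)) :
    ∃ K₀ n₀ : ℕ, ∀ n ≥ n₀, l (n + 1) ≤ K₀ * L n := by
  obtain ⟨K, hK⟩ := exists_nat_ge (4 * (1 + b))
  obtain ⟨c, hc⟩ := hF K
  set c₀ := max c 1
  have hc1 : 1 ≤ c₀ := le_max_right _ _
  have hc₀ : ∀ n, L n + min (l (n + 1) - l n) ((K + 1) * L n) - c₀ ≤ L (n + 1) := fun n => by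
    have := hc n
    have := le_max_left c 1
    linarith
  obtain ⟨n₀, hn₀⟩ := exists_forall_le_of_add_le hκ (hL0 0) hLm hLk (max d (2 * c₀))
  have hd : ∀ n ≥ n₀, d ≤ L n := fun n hn => (le_max_left _ _).trans (hn₀ n hn)
  have hc2 : ∀ n ≥ n₀, 2 * c₀ ≤ L n := fun n hn => (le_max_right _ _).trans (hn₀ n hn)
  have hg : ∀ n ≥ n₀, l (n + 1) ≤ (2 + b) * l n := fun n hn => by
    have := hgrow n
    have := hd n hn
    have := hLl n
    linarith
  have hl0 : ∀ n, 0 ≤ l n := fun n => (hL0 n).trans (hLl n)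
  have hl1 : 0 < l (n₀ + 1) := by
    have := hc2 (n₀ + 1) (by omega)
    have := hLl (n₀ + 1)
    linarith
  obtain ⟨τ, hτ, hτ1, hτ2, hτ3⟩ : ∃ τ : ℝ, 0 < τ ∧ τ ≤ 1 / 2 ∧ τ * (2 * c₀) ≤ κ ∧
      τ * l (n₀ + 1) ≤ L n₀ + L (n₀ + 1) := by
    have hS : 0 < L n₀ + L (n₀ + 1) := by
      have := hc2 (n₀ + 1) (by omega)
      have := hL0 n₀
      linarith
    refine ⟨min (1 / 2) (min (κ / (2 * c₀)) ((L n₀ + L (n₀ + 1)) / l (n₀ + 1))), ?_,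
      min_le_left _ _, ?_, ?_⟩
    · refine lt_min (by norm_num) (lt_min (by positivity) (by positivity))
    · rw [← le_div_iff₀ (by positivity)]
      exact (min_le_right _ _).trans (min_le_left _ _)
    · rw [← le_div_iff₀ hl1]
      exact (min_le_right _ _).trans (min_le_right _ _)
  have key : ∀ n ≥ n₀, τ * l (n + 1) ≤ L n + L (n + 1) := by
    intro n hn
    induction n, hn using Nat.le_induction with
    | base => exact hτ3
    | succ n hn ih =>
      have h1 := hLm (Nat.le_succ n)
      have h2 := hLk n
      have h3 := hlm (Nat.le_succ (n + 1))
      have h4 := hc₀ (n + 1)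
      have h5 := hc2 (n + 1) (by omega)
      have h6 := hg (n + 1) (by omega)
      have h7 := hl0 (n + 1)
      have h8 := hL0 (n + 1)
      simp only [Nat.succ_eq_add_one, add_assoc, Nat.reduceAdd] at *
      rcases lt_or_ge (l (n + 2) - l (n + 1)) (2 * c₀) with hj | hj
      · have := mul_le_mul_of_nonneg_left hj.le hτ.le
        linarith
      · rcases le_total (l (n + 2) - l (n + 1)) ((K + 1) * L (n + 1)) with hm | hm
        · rw [min_eq_left hm] at h4
          have : τ * (l (n + 2) - l (n + 1)) ≤ 1 / 2 * (l (n + 2) - l (n + 1)) :=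
            mul_le_mul_of_nonneg_right hτ1 (by linarith)
          linarith
        · rw [min_eq_right hm] at h4
          have e1 : 4 * (1 + b) * L (n + 1) ≤ K * L (n + 1) := mul_le_mul_of_nonneg_right hK h8
          have e2 : τ * l (n + 2) ≤ τ * ((2 + b) * l (n + 1)) :=
            mul_le_mul_of_nonneg_left h6 hτ.le
          have e3 : (2 + b) * (τ * l (n + 1)) ≤ (2 + b) * (L n + L (n + 1)) :=
            mul_le_mul_of_nonneg_left ih (by linarith)
          have e4 : b * L n ≤ b * L (n + 1) := mul_le_mul_of_nonneg_left h1 hb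
          linarith
  obtain ⟨K₀, hK₀⟩ := exists_nat_ge (2 * (2 + b) / τ)
  rw [div_le_iff₀ hτ] at hK₀
  refine ⟨K₀, n₀ + 1, fun n hn => ?_⟩
  obtain ⟨m, rfl⟩ : ∃ m, n = m + 1 := ⟨n - 1, by omega⟩
  have h1 := key m (by omega)
  have h2 := hLm (Nat.le_succ m)
  have h3 := hg (m + 1) (by omega)
  have h4 := hL0 (m + 1)
  simp only [Nat.succ_eq_add_one] at h2
  have h5 : τ * l (m + 1 + 1) ≤ τ * (K₀ * L (m + 1)) := by
    calc _ ≤ τ * ((2 + b) * l (m + 1)) := mul_le_mul_of_nonneg_left h3 hτ.le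
      _ = (2 + b) * (τ * l (m + 1)) := by ring
      _ ≤ (2 + b) * (2 * L (m + 1)) := mul_le_mul_of_nonneg_left (by linarith) (by linarith)
      _ = 2 * (2 + b) * L (m + 1) := by ring
      _ ≤ K₀ * τ * L (m + 1) := mul_le_mul_of_nonneg_right hK₀ h4
      _ = _ := by ring
  exact le_of_mul_le_mul_left h5 hτ

namespace DioLift

variable {B : ℝ → ℝ} {ρ : ℝ} (h : DioLift B ρ)
include h

lemma exists_maxGap_pow_le : ∃ K₀ n₀ : ℕ, ∀ n ≥ n₀, maxGap B ρ n ^ K₀ ≤ cfDist ρ (n + 1) := by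
  obtain ⟨c, hc, β, hβ, hd⟩ := h.dio
  obtain ⟨r, hr, hr1, hdec⟩ := h.maxGap_decay
  have hM := h.maxGap_pos
  have hα := cfDist_pos h.irr
  have hlog : ∀ {u v : ℝ}, 0 < u → u ≤ v → -Real.log v ≤ -Real.log u := fun hu huv =>
    neg_le_neg (Real.log_le_log hu huv)
  obtain ⟨K₀, n₀, hK⟩ := exists_le_mul_of_growth (L := fun n => -Real.log (maxGap B ρ n))
    (l := fun n => -Real.log (cfDist ρ n)) (κ := -Real.log r) (b := β) (d := -Real.log c)
    (by have := Real.log_neg hr hr1; linarith) hβ.le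
    (fun n => by
      have := Real.log_nonpos (hM n).le (h.maxGap_le_one n)
      simpa using this)
    (fun a b hab => hlog (hM b) (h.maxGap_antitone hab))
    (fun n => by
      have := hlog (hM (n + 2)) (hdec n)
      rw [Real.log_mul hr.ne' (hM n).ne'] at this
      linarith)
    (fun a b hab => hlog (hα b) (cfDist_antitone h.irr hab))
    (fun n => hlog (hα n) (h.cfDist_le_maxGap n))
    (fun n => by
      have h1 := le_cfDist_succ h.irr hc hβ hd n
      have h2 := hlog (mul_pos hc (Real.rpow_pos_of_pos (hα n) _)) h1
      rw [Real.log_mul hc.ne' (Real.rpow_pos_of_pos (hα n) _).ne', Real.log_rpow (hα n)] at h2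
      linarith)
    (fun K => by
      obtain ⟨C, hC, hb⟩ := h.exists_maxGap_succ_le K
      refine ⟨Real.log (2 * max C 1), fun n => ?_⟩
      have hC1 : 1 ≤ max C 1 := le_max_right _ _
      have hr : 0 < cfDist ρ (n + 1) / cfDist ρ n := div_pos (hα _) (hα _)
      have hp : 0 < maxGap B ρ n ^ (K + 1) := pow_pos (hM n) _
      have hmax := hr.trans_le (le_max_left _ (maxGap B ρ n ^ (K + 1)))
      have h1 : maxGap B ρ (n + 1) ≤ (2 * max C 1) *
          max (cfDist ρ (n + 1) / cfDist ρ n) (maxGap B ρ n ^ (K + 1)) * maxGap B ρ n := by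
        refine (hb n).trans (mul_le_mul_of_nonneg_right ?_ (hM n).le)
        rw [mul_comm 2, mul_assoc]
        refine mul_le_mul (le_max_left _ _) ?_ (by positivity) (by positivity)
        linarith [le_max_left (cfDist ρ (n + 1) / cfDist ρ n) (maxGap B ρ n ^ (K + 1)),
          le_max_right (cfDist ρ (n + 1) / cfDist ρ n) (maxGap B ρ n ^ (K + 1))]
      have h2 := hlog (hM _) h1
      rw [Real.log_mul (by positivity) (hM n).ne', Real.log_mul (by positivity) hmax.ne'] at h2
      have h3 : min (-Real.log (cfDist ρ (n + 1)) - -Real.log (cfDist ρ n))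
          ((K + 1) * -Real.log (maxGap B ρ n)) ≤
          -Real.log (max (cfDist ρ (n + 1) / cfDist ρ n) (maxGap B ρ n ^ (K + 1))) := by
        rcases max_choice (cfDist ρ (n + 1) / cfDist ρ n) (maxGap B ρ n ^ (K + 1)) with e | e <;>
          rw [e]
        · refine (min_le_left _ _).trans (le_of_eq ?_)
          rw [Real.log_div (hα _).ne' (hα _).ne']
          ring
        · refine (min_le_right _ _).trans (le_of_eq ?_)
          rw [Real.log_pow]
          push_cast
          ring
      linarith)
  refine ⟨K₀, n₀, fun n hn => ?_⟩
  rw [← Real.log_le_log_iff (pow_pos (hM n) _) (hα _), Real.log_pow]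
  have := hK n hn
  linarith

/-- Ratios of consecutive gaps are nearly constant at large levels. -/
lemma exists_gap_ratio_le_mul : ∃ C, 0 ≤ C ∧ ∃ n₀, ∀ n ≥ n₀, ∀ w x,
    gap B ρ (n + 2) w / gap B ρ (n + 1) w ≤
      (1 + C * √(maxGap B ρ n)) * (gap B ρ (n + 2) x / gap B ρ (n + 1) x) := by
  obtain ⟨K, n₁, hK⟩ := h.exists_maxGap_pow_le
  obtain ⟨C, hC, hR⟩ := h.exists_gap_ratio_le K
  obtain ⟨r, hr, hr1, hdec⟩ := h.maxGap_decay
  obtain ⟨n₂, hn₂⟩ : ∃ n₂, ∀ n ≥ n₂, 2 * C * maxGap B ρ n ≤ 1 := by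
    obtain ⟨n₂, hn₂⟩ := exists_forall_le_of_add_le (L := fun n => -Real.log (maxGap B ρ n))
      (κ := -Real.log r) (by have := Real.log_neg hr hr1; linarith)
      (by simpa using Real.log_nonpos (h.maxGap_pos 0).le (h.maxGap_le_one 0))
      (fun a b hab => neg_le_neg (Real.log_le_log (h.maxGap_pos b) (h.maxGap_antitone hab)))
      (fun n => by
        have := Real.log_le_log (h.maxGap_pos _) (hdec n)
        rw [Real.log_mul hr.ne' (h.maxGap_pos n).ne'] at this
        linarith) (Real.log (2 * C + 1))
    refine ⟨n₂, fun n hn => ?_⟩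
    have h1 := hn₂ n hn
    have hM := h.maxGap_pos n
    have h2 : Real.log ((2 * C + 1) * maxGap B ρ n) ≤ 0 := by
      rw [Real.log_mul (by positivity) hM.ne']
      linarith
    have h3 : (2 * C + 1) * maxGap B ρ n ≤ 1 :=
      (Real.log_nonpos_iff (by positivity)).1 h2
    linarith
  refine ⟨C + C * (2 * (1 + C)), by positivity, max n₁ n₂, fun n hn w x => ?_⟩
  have hM := h.maxGap_pos (n + 1)
  have hM1 := h.maxGap_le_one (n + 1)
  set s := √(maxGap B ρ n) with hs
  have hs0 : 0 ≤ s := Real.sqrt_nonneg _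
  have hs1 : s ≤ 1 := Real.sqrt_le_one.2 (h.maxGap_le_one n)
  have hMs : maxGap B ρ (n + 1) ≤ s := by
    refine (h.maxGap_succ_le n).trans (Real.le_sqrt_of_sq_le ?_)
    nlinarith [h.maxGap_pos n, h.maxGap_le_one n]
  obtain ⟨x', hx'⟩ := h.exists_gap_eq_maxGap (n + 2)
  have hpow : maxGap B ρ (n + 1) ^ (K + 1) ≤
      maxGap B ρ (n + 1) * (gap B ρ (n + 2) x' / gap B ρ (n + 1) x') := by
    have h1 := hK (n + 1) (by omega)
    have h2 := h.cfDist_le_maxGap (n + 2)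
    have h3 := h.gap_pos (n + 1) x'
    have h4 := h.gap_le_maxGap (n + 1) x'
    have h5 := h.maxGap_pos (n + 2)
    rw [pow_succ, mul_comm, hx']
    refine mul_le_mul_of_nonneg_left ((h1.trans h2).trans ?_) hM.le
    rw [le_div_iff₀ h3]
    exact mul_le_of_le_one_right h5.le (h4.trans hM1)
  have hRx : 0 < gap B ρ (n + 2) x / gap B ρ (n + 1) x := div_pos (h.gap_pos _ _) (h.gap_pos _ _)
  have hRx' : 0 < gap B ρ (n + 2) x' / gap B ρ (n + 1) x' :=
    div_pos (h.gap_pos _ _) (h.gap_pos _ _)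
  have hcmp := hR n x' x
  have hw := hR n w x
  have h2 := hn₂ (n + 1) (by omega)
  rw [← hs] at hcmp hw
  set R := gap B ρ (n + 2) x / gap B ρ (n + 1) x
  set R' := gap B ρ (n + 2) x' / gap B ρ (n + 1) x'
  have h3 : R' ≤ 2 * (1 + C) * R := by
    have e1 : C * maxGap B ρ (n + 1) ^ (K + 1) ≤ C * (maxGap B ρ (n + 1) * R') :=
      mul_le_mul_of_nonneg_left hpow hC
    have e2 : C * s * R ≤ C * R :=
      mul_le_mul_of_nonneg_right (mul_le_of_le_one_right hC hs1) hRx.le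
    have e3 : 2 * C * maxGap B ρ (n + 1) * R' ≤ R' := mul_le_of_le_one_left hRx'.le h2
    linarith
  calc _ ≤ _ := hw
    _ ≤ (1 + C * s) * R + C * (s * (2 * (1 + C) * R)) := by
      have e1 : maxGap B ρ (n + 1) ^ (K + 1) ≤ s * (2 * (1 + C) * R) :=
        hpow.trans (mul_le_mul hMs h3 hRx'.le hs0)
      have := mul_le_mul_of_nonneg_left e1 hC
      linarith
    _ = _ := by ring

omit h in
lemma sum_range_le_of_two_step {u : ℕ → ℝ} {q : ℝ} (hu : ∀ n, 0 ≤ u n) (hq : q < 1)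
    (hdec : ∀ n, u (n + 2) ≤ q * u n) (N : ℕ) :
    ∑ i ∈ Finset.range N, u i ≤ (u 0 + u 1) / (1 - q) := by
  rw [le_div_iff₀ (by linarith)]
  have h1 : ∑ i ∈ Finset.range (N + 2), u i = ∑ i ∈ Finset.range N, u (i + 2) + u 1 + u 0 := by
    rw [Finset.sum_range_succ', Finset.sum_range_succ']
  have h2 : ∑ i ∈ Finset.range N, u (i + 2) ≤ q * ∑ i ∈ Finset.range N, u i := by
    rw [Finset.mul_sum]
    exact Finset.sum_le_sum fun i _ => hdec i
  have h3 : ∑ i ∈ Finset.range N, u i ≤ ∑ i ∈ Finset.range (N + 2), u i :=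
    Finset.sum_le_sum_of_subset_of_nonneg (by gcongr; omega) fun i _ _ => hu i
  linarith

lemma exists_gap_le_mul (n : ℕ) : ∃ A, 0 ≤ A ∧ ∀ w x, gap B ρ n w ≤ A * gap B ρ n x := by
  obtain ⟨y, hy⟩ := h.exists_gap_min n
  have hp := h.gap_pos n y
  refine ⟨maxGap B ρ n / gap B ρ n y, div_nonneg (h.maxGap_pos n).le hp.le, fun w x => ?_⟩
  refine (h.gap_le_maxGap n w).trans ?_
  rw [div_mul_eq_mul_div, le_div_iff₀ hp]
  exact mul_le_mul_of_nonneg_left (hy x) (h.maxGap_pos n).le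

/-- Bounded geometry. -/
lemma exists_gap_le_mul_uniform :
    ∃ A, 0 ≤ A ∧ ∀ n w x, gap B ρ n w ≤ A * gap B ρ n x := by
  choose A hA hAb using h.exists_gap_le_mul
  obtain ⟨C, hC, n₀, hR⟩ := h.exists_gap_ratio_le_mul
  obtain ⟨r, hr, hr1, hdec⟩ := h.maxGap_decay
  set u : ℕ → ℝ := fun n => √(maxGap B ρ n) with hu
  have hu0 : ∀ n, 0 ≤ u n := fun n => Real.sqrt_nonneg _
  set S := (u 0 + u 1) / (1 - √r) with hS
  have hsum : ∀ N, ∑ i ∈ Finset.range N, u i ≤ S := by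
    refine sum_range_le_of_two_step hu0 ?_ fun n => ?_
    · rw [Real.sqrt_lt' one_pos]; linarith
    · simp only [hu]
      rw [← Real.sqrt_mul hr.le]
      exact Real.sqrt_le_sqrt (hdec n)
  have hlarge : ∀ n ≥ n₀, ∀ w x, gap B ρ (n + 1) w ≤
      A (n₀ + 1) * Real.exp (C * ∑ i ∈ Finset.range n, u i) * gap B ρ (n + 1) x := by
    intro n hn
    induction n, hn using Nat.le_induction with
    | base =>
      intro w x
      refine (hAb _ w x).trans (mul_le_mul_of_nonneg_right ?_ (h.gap_pos _ _).le)
      exact le_mul_of_one_le_right (hA _) (Real.one_le_exp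
        (mul_nonneg hC (Finset.sum_nonneg fun i _ => hu0 i)))
    | succ n hn ih =>
      intro w x
      have h1 := hR n hn w x
      have h2 := ih w x
      have hw := h.gap_pos (n + 1) w
      have hx := h.gap_pos (n + 1) x
      have hx' := h.gap_pos (n + 2) x
      have h3 : 1 + C * u n ≤ Real.exp (C * u n) := by
        rw [add_comm]; exact Real.add_one_le_exp _
      rw [div_le_iff₀ hw] at h1
      rw [Finset.sum_range_succ, mul_add, Real.exp_add]
      set P := Real.exp (C * ∑ i ∈ Finset.range n, u i) with hP
      have hA' := hA (n₀ + 1)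
      have hPp : 0 < P := Real.exp_pos _
      have hun := hu0 n
      calc _ ≤ _ := h1
        _ ≤ Real.exp (C * u n) * (gap B ρ (n + 2) x / gap B ρ (n + 1) x) *
            (A (n₀ + 1) * P * gap B ρ (n + 1) x) := by
            refine mul_le_mul (mul_le_mul_of_nonneg_right h3 (by positivity)) h2 hw.le ?_
            positivity
        _ = _ := by field_simp
  refine ⟨∑ n ∈ Finset.range (n₀ + 1), A n + A (n₀ + 1) * Real.exp (C * S), ?_, fun n w x => ?_⟩
  · have := hA (n₀ + 1)
    have := Finset.sum_nonneg fun n (_ : n ∈ Finset.range (n₀ + 1)) => hA n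
    positivity
  have hx := h.gap_pos n x
  rw [add_mul]
  rcases lt_or_ge n (n₀ + 1) with hn | hn
  · have h1 := hAb n w x
    have h2 : A n ≤ ∑ n ∈ Finset.range (n₀ + 1), A n :=
      Finset.single_le_sum (fun i _ => hA i) (Finset.mem_range.2 hn)
    have h3 := mul_le_mul_of_nonneg_right h2 hx.le
    have h4 := hA (n₀ + 1)
    have h5 : 0 ≤ A (n₀ + 1) * Real.exp (C * S) * gap B ρ n x := by positivity
    linarith
  · obtain ⟨m, rfl⟩ : ∃ m, n = m + 1 := ⟨n - 1, by omega⟩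
    have h1 := hlarge m (by omega) w x
    have h2 : Real.exp (C * ∑ i ∈ Finset.range m, u i) ≤ Real.exp (C * S) :=
      Real.exp_le_exp.2 (mul_le_mul_of_nonneg_left (hsum m) hC)
    have h3 : A (n₀ + 1) * Real.exp (C * ∑ i ∈ Finset.range m, u i) * gap B ρ (m + 1) x ≤
        A (n₀ + 1) * Real.exp (C * S) * gap B ρ (m + 1) x :=
      mul_le_mul_of_nonneg_right (mul_le_mul_of_nonneg_left h2 (hA _)) hx.le
    have h4 := mul_nonneg (Finset.sum_nonneg fun n (_ : n ∈ Finset.range (n₀ + 1)) => hA n) hx.le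
    linarith

lemma exists_gap_compare_cfDist : ∃ A, 1 ≤ A ∧ ∀ n x, gap B ρ n x ≤ A * cfDist ρ n ∧
    cfDist ρ n ≤ A * gap B ρ n x := by
  obtain ⟨A, hA, hb⟩ := h.exists_gap_le_mul_uniform
  refine ⟨A + 1, by linarith, fun n x => ?_⟩
  obtain ⟨y, hy⟩ := h.exists_cfDist_le_gap n
  obtain ⟨z, hz⟩ := h.exists_gap_le_cfDist n
  have hα := cfDist_pos h.irr n
  have hx := h.gap_pos n x
  have h1 := mul_le_mul_of_nonneg_left hz hA
  constructor
  · linarith [hb n x z]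
  · linarith [hb n y x]

end DioLift

/-! ### Polynomial weights in the distances -/

/-- The weight `α_n ^ (-max 0 (3j/4 - c))`. -/
noncomputable def distWeight (ρ c : ℝ) (n j : ℕ) : ℝ :=
  cfDist ρ n ^ (-max 0 (3 / 4 * (j : ℝ) - c))

section Weight

variable {ρ c : ℝ} (hρ : Irrational ρ)
include hρ

lemma cfDist_rpow_le {n : ℕ} {y z : ℝ} (h : z ≤ y) : cfDist ρ n ^ y ≤ cfDist ρ n ^ z :=
  Real.rpow_le_rpow_of_exponent_ge (cfDist_pos hρ n) (cfDist_le_one hρ n) h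

lemma one_le_cfDist_rpow {n : ℕ} {y : ℝ} (h : y ≤ 0) : 1 ≤ cfDist ρ n ^ y := by
  simpa using cfDist_rpow_le hρ (n := n) h

lemma one_le_distWeight (n j : ℕ) : 1 ≤ distWeight ρ c n j :=
  one_le_cfDist_rpow hρ (by simp)

lemma distWeight_nonneg (n j : ℕ) : 0 ≤ distWeight ρ c n j :=
  zero_le_one.trans (one_le_distWeight hρ n j)

omit hρ in
lemma distWeight_zero (hc : 0 ≤ c) (n : ℕ) : distWeight ρ c n 0 = 1 := by
  simp [distWeight, hc]

lemma distWeight_mul_le (hc : 0 ≤ c) (n a b : ℕ) :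
    distWeight ρ c n a * distWeight ρ c n b ≤ distWeight ρ c n (a + b) := by
  rw [distWeight, distWeight, ← Real.rpow_add (cfDist_pos hρ n)]
  refine cfDist_rpow_le hρ ?_
  push_cast
  have ha : (0 : ℝ) ≤ a := Nat.cast_nonneg _
  have hb : (0 : ℝ) ≤ b := Nat.cast_nonneg _
  have h1 := le_max_left 0 (3 / 4 * ((a : ℝ) + b) - c)
  have h2 := le_max_right 0 (3 / 4 * ((a : ℝ) + b) - c)
  rcases max_cases 0 (3 / 4 * (a : ℝ) - c) with h | h <;>
    rcases max_cases 0 (3 / 4 * (b : ℝ) - c) with h' | h' <;> rw [h.1, h'.1] <;> linarith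

lemma distWeight_mono {m n : ℕ} (h : m ≤ n) (j : ℕ) :
    distWeight ρ c m j ≤ distWeight ρ c n j :=
  Real.rpow_le_rpow_of_nonpos (cfDist_pos hρ n) (cfDist_antitone hρ h) (by simp)

lemma cfDist_mul_distWeight_succ_le (n j : ℕ) :
    cfDist ρ n * distWeight ρ c n (j + 1) ≤ distWeight ρ c n j := by
  nth_rw 1 [← Real.rpow_one (cfDist ρ n)]
  rw [distWeight, ← Real.rpow_add (cfDist_pos hρ n)]
  refine cfDist_rpow_le hρ ?_
  push_cast
  rcases max_cases 0 (3 / 4 * ((j : ℝ) + 1) - c) with h | h <;>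
    rcases max_cases 0 (3 / 4 * (j : ℝ) - c) with h' | h' <;> rw [h.1, h'.1] <;> linarith

lemma sum_cfDist_rpow_le {s : ℝ} (hs : 0 < s) :
    ∃ S, 0 ≤ S ∧ ∀ n, ∑ i ∈ Finset.range n, cfDist ρ i ^ s ≤ S := by
  have h0 : ∀ n, 0 ≤ cfDist ρ n ^ s := fun n => Real.rpow_nonneg (cfDist_pos hρ n).le _
  have hq : (1 / 2 : ℝ) ^ s < 1 := Real.rpow_lt_one (by norm_num) (by norm_num) hs
  refine ⟨(cfDist ρ 0 ^ s + cfDist ρ 1 ^ s) / (1 - (1 / 2 : ℝ) ^ s),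
    div_nonneg (add_nonneg (h0 _) (h0 _)) (by linarith),
    DioLift.sum_range_le_of_two_step h0 hq fun n => ?_⟩
  rw [← Real.mul_rpow (by norm_num) (cfDist_pos hρ n).le]
  refine Real.rpow_le_rpow (cfDist_pos hρ _).le ?_ hs.le
  linarith [cfDist_add_two_le_half hρ n]

end Weight

/-! ### Taylor's formula and the commutation relation -/

/-- Average of the second derivative along a segment in Taylor's formula. -/
noncomputable def taylorAvg (f : ℝ → ℝ) (s : ℝ) (g : ℝ → ℝ) (y : ℝ) : ℝ :=
  ∫ t in (0:ℝ)..1, (1 - t) * deriv (deriv f) (y + t * (s * g y))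

lemma taylor_integral {f : ℝ → ℝ} (hf : ContDiff ℝ ∞ f) (x d : ℝ) :
    f (x + d) - f x =
      d * deriv f x + d ^ 2 * ∫ t in (0:ℝ)..1, (1 - t) * deriv (deriv f) (x + t * d) := by
  have h1 := smooth_deriv hf
  have h2 := smooth_deriv h1
  have hd : ∀ t ∈ Set.uIcc (0:ℝ) 1, HasDerivAt
      (fun t => (1 - t) * (d * deriv f (x + t * d)) + f (x + t * d))
      (d ^ 2 * ((1 - t) * deriv (deriv f) (x + t * d))) t := fun t _ => by
    have hu : HasDerivAt (fun t : ℝ => x + t * d) d t := by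
      simpa using ((hasDerivAt_id t).mul_const d).const_add x
    have e1 := (h1.diff_infty (x + t * d)).hasDerivAt.comp t hu
    have e2 := (hf.diff_infty (x + t * d)).hasDerivAt.comp t hu
    have e3 := (((hasDerivAt_id t).const_sub 1).mul (e1.const_mul d)).add e2
    refine e3.congr_deriv ?_
    simp only [id, Function.comp]
    ring
  have hi := intervalIntegral.integral_eq_sub_of_hasDerivAt hd (by
    refine Continuous.intervalIntegrable ?_ _ _
    have := h2.continuous
    fun_prop)
  rw [intervalIntegral.integral_const_mul] at hi
  rw [hi]
  simp
  ring

lemma smooth_taylorAvg_kernel {f g : ℝ → ℝ} (hf : ContDiff ℝ ∞ f) (hg : ContDiff ℝ ∞ g) (s : ℝ) :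
    ContDiff ℝ ∞ (fun p : ℝ × ℝ =>
      (1 - p.1) * deriv (deriv f) (p.2 + p.1 * (s * g p.2))) :=
  (contDiff_const.sub contDiff_fst).mul ((smooth_deriv (smooth_deriv hf)).comp
    (contDiff_snd.add (contDiff_fst.mul (contDiff_const.mul (hg.comp contDiff_snd)))))

lemma smooth_taylorAvg {f g : ℝ → ℝ} (hf : ContDiff ℝ ∞ f) (hg : ContDiff ℝ ∞ g) (s : ℝ) :
    ContDiff ℝ ∞ (taylorAvg f s g) :=
  contDiff_param_integral (k := fun t y => (1 - t) * deriv (deriv f) (y + t * (s * g y)))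
    (smooth_taylorAvg_kernel hf hg s)

lemma derivBound_taylorAvg {ρ c : ℝ} (hρ : Irrational ρ) (hc : 0 ≤ c) {f g : ℕ → ℝ → ℝ}
    {s : ℕ → ℝ} (hs : ∀ n, |s n| ≤ cfDist ρ n)
    (hf : ∀ n, ContDiff ℝ ∞ (f n)) (hg : ∀ n, ContDiff ℝ ∞ (g n))
    (hfb : ∀ N, DerivBound N (fun i : ℕ × ℝ => f i.1) Prod.snd fun i => distWeight ρ c i.1)
    (hgb : ∀ N, DerivBound N (fun i : ℕ × ℝ => g i.1) Prod.snd fun i => distWeight ρ c i.1)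
    (N : ℕ) :
    DerivBound N (fun i : ℕ × ℝ => taylorAvg (f i.1) (s i.1) (g i.1)) Prod.snd
      fun i j => distWeight ρ c i.1 (j + 2) := by
  have hW : ∀ n j, 0 ≤ distWeight ρ c n j := distWeight_nonneg hρ
  set u : (ℕ × ℝ) × Set.Icc (0:ℝ) 1 → ℝ → ℝ :=
    fun i y => y + (i.2 : ℝ) * (s i.1.1 * g i.1.1 y) with hu_def
  have hu : ∀ i, ContDiff ℝ ∞ (u i) := fun i =>
    contDiff_id.add (contDiff_const.mul (contDiff_const.mul (hg i.1.1)))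
  have ht : ∀ t : Set.Icc (0:ℝ) 1, |(t : ℝ)| ≤ 1 := fun t => by
    rw [abs_of_nonneg t.2.1]; exact t.2.2
  have hdu : ∀ i, deriv (u i) = fun y => 1 + (i.2 * s i.1.1) * deriv (g i.1.1) y := fun i => by
    funext y
    have e := (hasDerivAt_id y).add
      ((((hg i.1.1).diff_infty y).hasDerivAt.const_mul (s i.1.1)).const_mul (i.2 : ℝ))
    rw [mul_assoc]
    exact e.deriv
  have h1 := ((hfb (N + 2)).deriv.deriv).reindex
    (fun i : (ℕ × ℝ) × Set.Icc (0:ℝ) 1 => (i.1.1, u i i.1.2))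
  have hone : DerivBound N (fun (_ : (ℕ × ℝ) × Set.Icc (0:ℝ) 1) (_ : ℝ) => (1 : ℝ))
      (fun i => i.1.2) (fun i => distWeight ρ c i.1.1) := by
    refine ⟨1, zero_le_one, fun i j _ => ?_⟩
    have := one_le_distWeight (c := c) hρ i.1.1 j
    rcases j with _ | j
    · simpa using this
    · simp [iteratedDeriv_const]; linarith
  have h2 : DerivBound N (fun i => deriv (u i)) (fun i => i.1.2)
      (fun i => distWeight ρ c i.1.1) := by
    have h3 := (((hgb (N + 1)).deriv).reindex
      (fun i : (ℕ × ℝ) × Set.Icc (0:ℝ) 1 => i.1)).const_mul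
      (V := fun i => distWeight ρ c i.1.1)
      (fun i => (i.2 : ℝ) * s i.1.1) 1 zero_le_one (fun i j _ => by
        rw [abs_mul, one_mul]
        refine le_trans (mul_le_mul_of_nonneg_right ?_ (hW _ _))
          (cfDist_mul_distWeight_succ_le hρ i.1.1 j)
        calc _ ≤ 1 * cfDist ρ i.1.1 :=
              mul_le_mul (ht _) (hs _) (abs_nonneg _) zero_le_one
          _ = _ := one_mul _)
    have h4 := DerivBound.add (fun _ => contDiff_const)
      (fun i => contDiff_const.mul (smooth_deriv (hg i.1.1))) hone h3
    simpa only [hdu] using h4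
  have h5 := DerivBound.comp (φ := fun i => deriv (deriv (f i.1.1))) (u := u)
    (x := fun i => i.1.2) (X := fun i a b => distWeight ρ c i.1.1 (a + b + 2))
    (fun i => smooth_deriv (smooth_deriv (hf i.1.1))) hu h1 h2 (fun _ _ _ => hW _ _)
    (fun i a b d => (distWeight_mul_le hρ hc _ _ _).trans_eq (by congr 1; omega))
  beta_reduce at h5
  have h6 := DerivBound.const_mul (V := fun i j => distWeight ρ c i.1.1 (j + 2))
    (fun i => 1 - (i.2 : ℝ)) h5 1 zero_le_one (fun i j _ => by
      rw [zero_add]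
      refine mul_le_mul_of_nonneg_right ?_ (hW _ _)
      rw [abs_le]
      constructor <;> linarith [i.2.2.1, i.2.2.2])
  beta_reduce at h6
  have h7 := DerivBound.param_integral (x := Prod.snd)
    (W := fun (i : ℕ × ℝ) j => distWeight ρ c i.1 (j + 2))
    (k := fun i t y => (1 - t) * deriv (deriv (f i.1)) (y + t * (s i.1 * g i.1 y)))
    (fun i => smooth_taylorAvg_kernel (hf i.1) (hg i.1) (s i.1)) h6
  exact h7

/-! ### Rescaled gaps -/

/-- The displacement of the return map, rescaled by `α_n`. -/
noncomputable def scaledGap (B : ℝ → ℝ) (ρ : ℝ) (n : ℕ) (x : ℝ) : ℝ := gap B ρ n x / cfDist ρ n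

/-- The logarithmic derivative of the rescaled gaps. -/
noncomputable def gapLogD (B : ℝ → ℝ) (ρ : ℝ) (n : ℕ) (x : ℝ) : ℝ :=
  deriv (scaledGap B ρ n) x * (scaledGap B ρ n x)⁻¹

namespace DioLift

variable {B : ℝ → ℝ} {ρ : ℝ} (h : DioLift B ρ)
include h

lemma smooth_scaledGap (n : ℕ) : ContDiff ℝ ∞ (scaledGap B ρ n) := (h.smooth_gap n).div_const _

lemma scaledGap_pos (n : ℕ) (x : ℝ) : 0 < scaledGap B ρ n x :=
  div_pos (h.gap_pos n x) (cfDist_pos h.irr n)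

lemma smooth_inv_scaledGap (n : ℕ) : ContDiff ℝ ∞ (fun x => (scaledGap B ρ n x)⁻¹) :=
  (h.smooth_scaledGap n).inv fun x => (h.scaledGap_pos n x).ne'

lemma smooth_gapLogD (n : ℕ) : ContDiff ℝ ∞ (gapLogD B ρ n) :=
  (smooth_deriv (h.smooth_scaledGap n)).mul (h.smooth_inv_scaledGap n)

omit h in
lemma scaledGap_zero (x : ℝ) : scaledGap B ρ 0 x = 1 := by
  rw [scaledGap, gap_zero, cfDist_zero, div_one]

omit h in
lemma gapLogD_zero (x : ℝ) : gapLogD B ρ 0 x = 0 := by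
  have : scaledGap B ρ 0 = fun _ => 1 := funext scaledGap_zero
  simp [gapLogD, this]

lemma gap_eq_scaledGap (n : ℕ) (x : ℝ) : gap B ρ n x = cfDist ρ n * scaledGap B ρ n x := by
  rw [scaledGap, mul_div_cancel₀ _ (cfDist_pos h.irr n).ne']

lemma gapLogD_succ_sub (n : ℕ) (x : ℝ) : gapLogD B ρ (n + 1) x - gapLogD B ρ n x =
    (cfSign (n + 1) * cfDist ρ (n + 1)) *
      (scaledGap B ρ (n + 1) x * (scaledGap B ρ n x)⁻¹ *
        taylorAvg (scaledGap B ρ n) (cfSign (n + 1) * cfDist ρ (n + 1))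
          (scaledGap B ρ (n + 1)) x) +
    (-(cfSign n * cfDist ρ n)) *
      (scaledGap B ρ n x * (scaledGap B ρ (n + 1) x)⁻¹ *
        taylorAvg (scaledGap B ρ (n + 1)) (cfSign n * cfDist ρ n) (scaledGap B ρ n) x) := by
  have hc := h.ret_comm n (n + 1) x
  simp only [ret_eq, h.gap_eq_scaledGap, ← mul_assoc] at hc
  have t1 := taylor_integral (h.smooth_scaledGap n) x
    (cfSign (n + 1) * cfDist ρ (n + 1) * scaledGap B ρ (n + 1) x)
  have t2 := taylor_integral (h.smooth_scaledGap (n + 1)) x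
    (cfSign n * cfDist ρ n * scaledGap B ρ n x)
  have p1 := (h.scaledGap_pos n x).ne'
  have p2 := (h.scaledGap_pos (n + 1) x).ne'
  have a1 := (cfDist_pos h.irr n).ne'
  have a2 := (cfDist_pos h.irr (n + 1)).ne'
  have s1 : cfSign n ≠ 0 := fun e => by simpa [e] using abs_cfSign n
  have s2 : cfSign (n + 1) ≠ 0 := fun e => by simpa [e] using abs_cfSign (n + 1)
  simp only [gapLogD, taylorAvg]
  set I := ∫ t in (0:ℝ)..1, (1 - t) * deriv (deriv (scaledGap B ρ n))
    (x + t * (cfSign (n + 1) * cfDist ρ (n + 1) * scaledGap B ρ (n + 1) x))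
  set J := ∫ t in (0:ℝ)..1, (1 - t) * deriv (deriv (scaledGap B ρ (n + 1)))
    (x + t * (cfSign n * cfDist ρ n * scaledGap B ρ n x))
  set z := scaledGap B ρ n x
  set w := scaledGap B ρ (n + 1) x
  set s := cfSign n * cfDist ρ n with hs
  set r := cfSign (n + 1) * cfDist ρ (n + 1) with hr
  have hs0 : s ≠ 0 := mul_ne_zero s1 a1
  have hr0 : r ≠ 0 := mul_ne_zero s2 a2
  have key : s * (r * w * deriv (scaledGap B ρ n) x + (r * w) ^ 2 * I) =
      r * (s * z * deriv (scaledGap B ρ (n + 1)) x + (s * z) ^ 2 * J) := by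
    rw [← t1, ← t2]; linear_combination hc
  have key2 : w * deriv (scaledGap B ρ n) x + r * w ^ 2 * I =
      z * deriv (scaledGap B ρ (n + 1)) x + s * z ^ 2 * J := by
    have := mul_ne_zero hs0 hr0
    apply mul_left_cancel₀ this
    linear_combination key
  field_simp
  linear_combination -key2

end DioLift

/-! ### Uniform bounds on the derivatives of the rescaled gaps -/

lemma DerivBound.of_forall {ι : Type*} {N : ℕ} {φ : ι → ℝ → ℝ} {x : ι → ℝ} {W : ι → ℕ → ℝ}
    (hW : ∀ i j, 0 ≤ W i j)
    (h : ∀ j, ∃ C : ℝ, 0 ≤ C ∧ ∀ i, |iteratedDeriv j (φ i) (x i)| ≤ C * W i j) :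
    DerivBound N φ x W := by
  choose C hC h using h
  refine ⟨∑ j ∈ Finset.range (N + 1), C j, Finset.sum_nonneg fun j _ => hC j, fun i j hj => ?_⟩
  exact (h j i).trans (mul_le_mul_of_nonneg_right (Finset.single_le_sum (f := C)
    (fun j _ => hC j) (by simp; omega)) (hW i j))

lemma cfDist_mul_distWeight_le {ρ c : ℝ} (hρ : Irrational ρ) (n j : ℕ) :
    cfDist ρ n * distWeight ρ c n (j + 2) ≤
      cfDist ρ n ^ (1 / 8 : ℝ) * distWeight ρ (c + 1 / 8) n (j + 1) := by
  nth_rw 1 [← Real.rpow_one (cfDist ρ n)]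
  rw [distWeight, distWeight, ← Real.rpow_add (cfDist_pos hρ n), ← Real.rpow_add (cfDist_pos hρ n)]
  refine cfDist_rpow_le hρ ?_
  push_cast
  rcases max_cases 0 (3 / 4 * ((j : ℝ) + 2) - c) with h | h <;>
    rcases max_cases 0 (3 / 4 * ((j : ℝ) + 1) - (c + 1 / 8)) with h' | h' <;>
      rw [h.1, h'.1] <;> linarith

namespace DioLift

variable {B : ℝ → ℝ} {ρ : ℝ} (h : DioLift B ρ)
include h

lemma exists_scaledGap_bound :
    ∃ A, 1 ≤ A ∧ ∀ n x, scaledGap B ρ n x ≤ A ∧ A⁻¹ ≤ scaledGap B ρ n x := by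
  obtain ⟨A, hA, hb⟩ := h.exists_gap_compare_cfDist
  refine ⟨A, hA, fun n x => ?_⟩
  have hα := cfDist_pos h.irr n
  have hA0 : 0 < A := by linarith
  obtain ⟨h1, h2⟩ := hb n x
  rw [scaledGap, div_le_iff₀ hα, le_div_iff₀ hα, inv_mul_le_iff₀ hA0]
  exact ⟨h1, h2⟩

lemma exists_invScale_le :
    ∃ C, 0 ≤ C ∧ ∀ n x, invScale B ρ n x ≤ C * cfDist ρ n ^ (-(1 / 2) : ℝ) := by
  obtain ⟨A, hA, hb⟩ := h.exists_gap_compare_cfDist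
  refine ⟨A * A, by positivity, fun n x => ?_⟩
  have hα := cfDist_pos h.irr n
  obtain ⟨y, hy⟩ := h.exists_gap_eq_maxGap n
  have h1 : √(maxGap B ρ n) ≤ A * √(cfDist ρ n) := by
    rw [← hy]
    refine Real.sqrt_le_iff.2 ⟨by positivity, (hb n y).1.trans ?_⟩
    rw [mul_pow, Real.sq_sqrt hα.le]
    exact mul_le_mul_of_nonneg_right (by nlinarith) hα.le
  have h2 : cfDist ρ n ^ (-(1 / 2) : ℝ) * cfDist ρ n = √(cfDist ρ n) := by
    rw [Real.sqrt_eq_rpow]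
    nth_rw 2 [← Real.rpow_one (cfDist ρ n)]
    rw [← Real.rpow_add hα]
    norm_num
  rw [invScale, div_le_iff₀ (h.gap_pos n x)]
  calc _ ≤ _ := h1
    _ = A * cfDist ρ n ^ (-(1 / 2) : ℝ) * cfDist ρ n := by rw [← h2]; ring
    _ ≤ A * cfDist ρ n ^ (-(1 / 2) : ℝ) * (A * gap B ρ n x) :=
      mul_le_mul_of_nonneg_left (hb n x).2 (by positivity)
    _ = _ := by ring

lemma exists_iteratedDeriv_scaledGap_le : ∃ β : ℝ, 0 < β ∧ ∀ k : ℕ, ∃ C, 0 ≤ C ∧ ∀ n x,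
    |iteratedDeriv (k + 2) (scaledGap B ρ (n + 1)) x| ≤
      C * cfDist ρ n ^ (-((k + 1 : ℝ) / 2) - (1 + β)) := by
  obtain ⟨c, hc, β, hβ, hd⟩ := h.dio
  obtain ⟨D, hD, hDb⟩ := h.exists_invScale_le
  refine ⟨β, hβ, fun k => ?_⟩
  obtain ⟨C, hC, hb⟩ := h.exists_iteratedDeriv_ret_le (k + 1)
  refine ⟨C * D ^ (k + 1) / c, by positivity, fun n x => ?_⟩
  have hα := cfDist_pos h.irr n
  have hα' := cfDist_pos h.irr (n + 1)
  have h1 : iteratedDeriv (k + 2) (scaledGap B ρ (n + 1)) x =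
      (cfDist ρ (n + 1))⁻¹ * iteratedDeriv (k + 2) (gap B ρ (n + 1)) x := by
    rw [← iteratedDeriv_const_mul_field]
    congr 1
    funext y
    rw [scaledGap, div_eq_inv_mul]
  have h2 : invScale B ρ n x ^ (k + 1) ≤ D ^ (k + 1) * cfDist ρ n ^ (-((k + 1 : ℝ) / 2)) := by
    refine (pow_le_pow_left₀ (h.invScale_pos n x).le (hDb n x) _).trans_eq ?_
    rw [mul_pow, ← Real.rpow_natCast (cfDist ρ n ^ _), ← Real.rpow_mul hα.le]
    congr 2
    push_cast
    ring
  have h3 := le_cfDist_succ h.irr hc hβ hd n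
  rw [h1, abs_mul, h.abs_iteratedDeriv_gap, abs_of_pos (inv_pos.2 hα'), inv_mul_le_iff₀ hα']
  have h4 : 0 < cfDist ρ n ^ (-((k + 1 : ℝ) / 2)) := Real.rpow_pos_of_pos hα _
  calc _ ≤ C * invScale B ρ n x ^ (k + 1) := hb n x
    _ ≤ C * (D ^ (k + 1) * cfDist ρ n ^ (-((k + 1 : ℝ) / 2))) := mul_le_mul_of_nonneg_left h2 hC
    _ = c * cfDist ρ n ^ (1 + β) * (C * D ^ (k + 1) / c *
          cfDist ρ n ^ (-((k + 1 : ℝ) / 2) - (1 + β))) := by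
        rw [Real.rpow_sub hα]
        have := (Real.rpow_pos_of_pos hα (1 + β)).ne'
        field_simp
    _ ≤ _ := mul_le_mul_of_nonneg_right h3 (by positivity)

lemma derivBound_scaledGap_base (N : ℕ) :
    DerivBound N (fun i : ℕ × ℝ => scaledGap B ρ (i.1 + 1)) Prod.snd
      fun i => distWeight ρ 0 i.1 := by
  refine .of_forall (fun i => distWeight_nonneg h.irr i.1) fun j => ?_
  obtain ⟨β, hβ, hk⟩ := h.exists_iteratedDeriv_scaledGap_le
  obtain ⟨A, hA, hAb⟩ := h.exists_scaledGap_bound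
  set m := j + ⌈4 * β⌉₊ with hm
  have hmβ : 4 * β ≤ m := by
    rw [hm]; push_cast
    linarith [Nat.le_ceil (4 * β), (Nat.cast_nonneg j : (0 : ℝ) ≤ j)]
  obtain ⟨C, hC, hCb⟩ := hk m
  obtain ⟨L, hL, hLb⟩ := exists_landau_bound (m + 2)
  refine ⟨L * (A + C), by positivity, fun i => ?_⟩
  obtain ⟨n, x⟩ := i
  have hα := cfDist_pos h.irr n
  have h1 := hLb (scaledGap B ρ (n + 1)) (cfDist ρ n ^ (3 / 4 : ℝ)) A _
    (h.smooth_scaledGap _) (Real.rpow_pos_of_pos hα _) (fun x => by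
      rw [abs_of_pos (h.scaledGap_pos _ _)]; exact (hAb _ x).1) (fun x => hCb n x) j (by omega) x
  have h2 : cfDist ρ n ^ (-((m + 1 : ℝ) / 2) - (1 + β)) *
      (cfDist ρ n ^ (3 / 4 : ℝ)) ^ (m + 2) ≤ 1 := by
    rw [← Real.rpow_natCast (cfDist ρ n ^ _), ← Real.rpow_mul hα.le, ← Real.rpow_add hα]
    refine Real.rpow_le_one hα.le (cfDist_le_one h.irr n) ?_
    push_cast
    linarith
  have h3 : (cfDist ρ n ^ (3 / 4 : ℝ)) ^ j * distWeight ρ 0 n j = 1 := by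
    rw [distWeight, ← Real.rpow_natCast (cfDist ρ n ^ _), ← Real.rpow_mul hα.le,
      ← Real.rpow_add hα, max_eq_right (by rw [sub_zero]; positivity)]
    simp
  have hW := one_le_distWeight (c := 0) h.irr n j
  have h4 : |iteratedDeriv j (scaledGap B ρ (n + 1)) x| * (cfDist ρ n ^ (3 / 4 : ℝ)) ^ j ≤
      L * (A + C) := by
    refine h1.trans (mul_le_mul_of_nonneg_left ?_ hL)
    rw [mul_assoc]
    have := mul_le_mul_of_nonneg_left h2 hC
    linarith
  calc |iteratedDeriv j (scaledGap B ρ (n + 1)) x|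
      = |iteratedDeriv j (scaledGap B ρ (n + 1)) x| * (cfDist ρ n ^ (3 / 4 : ℝ)) ^ j *
        distWeight ρ 0 n j := by rw [mul_assoc, h3, mul_one]
    _ ≤ _ := mul_le_mul_of_nonneg_right h4 (by linarith)

lemma derivBound_scaledGap_pred {c : ℝ}
    (hP : ∀ N, DerivBound N (fun i : ℕ × ℝ => scaledGap B ρ (i.1 + 1)) Prod.snd
      fun i => distWeight ρ c i.1) (N : ℕ) :
    DerivBound N (fun i : ℕ × ℝ => scaledGap B ρ i.1) Prod.snd fun i => distWeight ρ c i.1 := by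
  obtain ⟨C, hC, hb⟩ := hP N
  refine ⟨C + 1, by positivity, fun i j hj => ?_⟩
  obtain ⟨n, x⟩ := i
  have hW := one_le_distWeight (c := c) h.irr n j
  rw [add_mul, one_mul]
  dsimp only
  rcases n with _ | n
  · have h0 : scaledGap B ρ 0 = fun _ => 1 := funext scaledGap_zero
    have : |iteratedDeriv j (scaledGap B ρ 0) x| ≤ 1 := by
      rw [h0]
      rcases j with _ | j <;> simp [iteratedDeriv_const]
    have := mul_nonneg hC (zero_le_one.trans hW)
    linarith
  · have h1 := hb (n, x) j hj
    have h2 := mul_le_mul_of_nonneg_left (distWeight_mono (c := c) h.irr (Nat.le_succ n) j) hC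
    dsimp only [Nat.succ_eq_add_one] at h1 h2
    linarith

lemma derivBound_gapLogD_sub {c : ℝ} (hc : 0 ≤ c)
    (hP : ∀ N, DerivBound N (fun i : ℕ × ℝ => scaledGap B ρ (i.1 + 1)) Prod.snd
      fun i => distWeight ρ c i.1) (N : ℕ) :
    DerivBound N (fun (i : ℕ × ℝ) y => gapLogD B ρ (i.1 + 1) y - gapLogD B ρ i.1 y) Prod.snd
      fun i j => cfDist ρ i.1 * distWeight ρ c i.1 (j + 2) := by
  have hP' := h.derivBound_scaledGap_pred hP
  obtain ⟨A, hA, hAb⟩ := h.exists_scaledGap_bound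
  have hW : ∀ (i : ℕ × ℝ) j, 0 ≤ distWeight ρ c i.1 j := fun i => distWeight_nonneg h.irr i.1
  have hWW : ∀ (i : ℕ × ℝ) a b, distWeight ρ c i.1 a * distWeight ρ c i.1 b ≤
      distWeight ρ c i.1 (a + b) := fun i => distWeight_mul_le h.irr hc i.1
  have hW0 : ∀ i : ℕ × ℝ, distWeight ρ c i.1 0 = 1 := fun i => distWeight_zero hc i.1
  have hA' : 0 < A⁻¹ := by positivity
  have hsm : ∀ i : ℕ × ℝ, ContDiff ℝ ∞ (scaledGap B ρ i.1) := fun i => h.smooth_scaledGap i.1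
  have hsm' : ∀ i : ℕ × ℝ, ContDiff ℝ ∞ (scaledGap B ρ (i.1 + 1)) :=
    fun i => h.smooth_scaledGap _
  have hs : ∀ n, |cfSign n * cfDist ρ n| = cfDist ρ n := fun n => by
    rw [abs_mul, abs_cfSign, one_mul, abs_of_pos (cfDist_pos h.irr n)]
  have hs1 : ∀ n, |cfSign n * cfDist ρ n| ≤ cfDist ρ n := fun n => (hs n).le
  have hs2 : ∀ n, |cfSign (n + 1) * cfDist ρ (n + 1)| ≤ cfDist ρ n := fun n => by
    rw [hs]; exact (cfDist_succ_lt h.irr n).le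
  have ta := derivBound_taylorAvg h.irr hc hs2 h.smooth_scaledGap
    (fun n => h.smooth_scaledGap (n + 1)) hP' hP N
  have tb := derivBound_taylorAvg h.irr hc hs1 (fun n => h.smooth_scaledGap (n + 1))
    h.smooth_scaledGap hP hP' N
  have i1 := DerivBound.inv hsm (hP' N) A⁻¹ hA' (fun i y => (hAb i.1 y).2) hW0 hW hWW
  have i2 := DerivBound.inv hsm' (hP N) A⁻¹ hA' (fun i y => (hAb _ y).2) hW0 hW hWW
  have q1 := DerivBound.mul hsm' (fun i => h.smooth_inv_scaledGap i.1) (hP N) i1 hW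
    (fun i a b _ => hWW i a b)
  have q2 := DerivBound.mul hsm (fun i => h.smooth_inv_scaledGap (i.1 + 1)) (hP' N) i2 hW
    (fun i a b _ => hWW i a b)
  have hWW2 : ∀ (i : ℕ × ℝ) a b, a + b ≤ N → distWeight ρ c i.1 a * distWeight ρ c i.1 (b + 2) ≤
      distWeight ρ c i.1 (a + b + 2) := fun i a b _ => hWW i a (b + 2)
  have r1 := DerivBound.mul (U := fun (i : ℕ × ℝ) j => distWeight ρ c i.1 (j + 2))
    (fun i => (hsm' i).mul (h.smooth_inv_scaledGap i.1))
    (fun i : ℕ × ℝ => smooth_taylorAvg (hsm i) (hsm' i) _) q1 ta hW hWW2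
  have r2 := DerivBound.mul (U := fun (i : ℕ × ℝ) j => distWeight ρ c i.1 (j + 2))
    (fun i => (hsm i).mul (h.smooth_inv_scaledGap (i.1 + 1)))
    (fun i : ℕ × ℝ => smooth_taylorAvg (hsm' i) (hsm i) _) q2 tb hW hWW2
  have m1 := DerivBound.const_mul
    (V := fun (i : ℕ × ℝ) j => cfDist ρ i.1 * distWeight ρ c i.1 (j + 2))
    (fun i : ℕ × ℝ => cfSign (i.1 + 1) * cfDist ρ (i.1 + 1)) r1 1 zero_le_one (fun i j _ => by
      rw [one_mul]; exact mul_le_mul_of_nonneg_right (hs2 i.1) (hW _ _))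
  have m2 := DerivBound.const_mul
    (V := fun (i : ℕ × ℝ) j => cfDist ρ i.1 * distWeight ρ c i.1 (j + 2))
    (fun i : ℕ × ℝ => -(cfSign i.1 * cfDist ρ i.1)) r2 1 zero_le_one (fun i j _ => by
      rw [one_mul, abs_neg]; exact mul_le_mul_of_nonneg_right (hs1 i.1) (hW _ _))
  have fin := DerivBound.add
    (fun i => contDiff_const.mul (((hsm' i).mul (h.smooth_inv_scaledGap i.1)).mul
      (smooth_taylorAvg (hsm i) (hsm' i) _)))
    (fun i => contDiff_const.mul (((hsm i).mul (h.smooth_inv_scaledGap (i.1 + 1))).mul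
      (smooth_taylorAvg (hsm' i) (hsm i) _))) m1 m2
  simpa only [← h.gapLogD_succ_sub] using fin

lemma iteratedDeriv_gapLogD (n j : ℕ) (x : ℝ) : iteratedDeriv j (gapLogD B ρ n) x =
    ∑ m ∈ Finset.range n,
      iteratedDeriv j (fun y => gapLogD B ρ (m + 1) y - gapLogD B ρ m y) x := by
  have h0 : gapLogD B ρ 0 = fun _ => 0 := funext gapLogD_zero
  have h1 : iteratedDeriv j (gapLogD B ρ 0) x = 0 := by
    rw [h0]; simp
  rw [← sub_zero (iteratedDeriv j (gapLogD B ρ n) x), ← h1,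
    ← Finset.sum_range_sub (fun m => iteratedDeriv j (gapLogD B ρ m) x)]
  refine Finset.sum_congr rfl fun m _ => ?_
  exact (iteratedDeriv_fun_sub ((h.smooth_gapLogD (m + 1)).at_nat _ _)
    ((h.smooth_gapLogD m).at_nat _ _)).symm

lemma derivBound_gapLogD {c : ℝ} (hc : 0 ≤ c)
    (hP : ∀ N, DerivBound N (fun i : ℕ × ℝ => scaledGap B ρ (i.1 + 1)) Prod.snd
      fun i => distWeight ρ c i.1) (N : ℕ) :
    DerivBound N (fun i : ℕ × ℝ => gapLogD B ρ (i.1 + 1)) Prod.snd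
      fun i j => distWeight ρ (c + 1 / 8) i.1 (j + 1) := by
  obtain ⟨C, hC, hb⟩ := h.derivBound_gapLogD_sub hc hP N
  obtain ⟨S, hS, hSb⟩ := sum_cfDist_rpow_le h.irr (s := 1 / 8) (by norm_num)
  refine ⟨C * S, by positivity, fun i j hj => ?_⟩
  obtain ⟨n, x⟩ := i
  dsimp only
  rw [h.iteratedDeriv_gapLogD]
  have hW := distWeight_nonneg (c := c + 1 / 8) h.irr n (j + 1)
  refine (Finset.abs_sum_le_sum_abs _ _).trans ?_
  calc _ ≤ ∑ m ∈ Finset.range (n + 1), C * distWeight ρ (c + 1 / 8) n (j + 1) *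
        cfDist ρ m ^ (1 / 8 : ℝ) := by
        refine Finset.sum_le_sum fun m hm => (hb (m, x) j hj).trans ?_
        dsimp only
        rw [mul_assoc]
        refine mul_le_mul_of_nonneg_left ((cfDist_mul_distWeight_le h.irr m j).trans ?_) hC
        rw [mul_comm]
        refine mul_le_mul_of_nonneg_right (distWeight_mono h.irr ?_ _)
          (Real.rpow_nonneg (cfDist_pos h.irr m).le _)
        have := Finset.mem_range.1 hm
        omega
    _ = C * distWeight ρ (c + 1 / 8) n (j + 1) *
        ∑ m ∈ Finset.range (n + 1), cfDist ρ m ^ (1 / 8 : ℝ) := by rw [Finset.mul_sum]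
    _ ≤ C * distWeight ρ (c + 1 / 8) n (j + 1) * S :=
        mul_le_mul_of_nonneg_left (hSb _) (by positivity)
    _ = _ := by ring

lemma derivBound_scaledGap_step {c : ℝ} (hc : 0 ≤ c)
    (hP : ∀ N, DerivBound N (fun i : ℕ × ℝ => scaledGap B ρ (i.1 + 1)) Prod.snd
      fun i => distWeight ρ c i.1) (N : ℕ) :
    DerivBound N (fun i : ℕ × ℝ => scaledGap B ρ (i.1 + 1)) Prod.snd
      fun i => distWeight ρ (c + 1 / 8) i.1 := by
  obtain ⟨A, hA, hAb⟩ := h.exists_scaledGap_bound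
  have hc' : 0 ≤ c + 1 / 8 := by linarith
  have hW : ∀ (i : ℕ × ℝ) j, 0 ≤ distWeight ρ (c + 1 / 8) i.1 j :=
    fun i => distWeight_nonneg h.irr i.1
  have h0 : DerivBound 0 (fun i : ℕ × ℝ => scaledGap B ρ (i.1 + 1)) Prod.snd
      fun i => distWeight ρ (c + 1 / 8) i.1 := by
    refine .of_zero A (by linarith) fun i => ?_
    rw [distWeight_zero hc', mul_one, abs_of_pos (h.scaledGap_pos _ _)]
    exact (hAb _ _).1
  induction N with
  | zero => exact h0
  | succ N ih =>
    refine .of_deriv h0 ?_ hW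
    have hd : ∀ n, deriv (scaledGap B ρ n) = fun x => gapLogD B ρ n x * scaledGap B ρ n x :=
      fun n => funext fun x => by
        rw [gapLogD, mul_assoc, inv_mul_cancel₀ (h.scaledGap_pos n x).ne', mul_one]
    have h1 := DerivBound.mul (U := fun (i : ℕ × ℝ) j => distWeight ρ (c + 1 / 8) i.1 (j + 1))
      (fun i : ℕ × ℝ => h.smooth_gapLogD (i.1 + 1)) (fun i : ℕ × ℝ => h.smooth_scaledGap (i.1 + 1))
      (h.derivBound_gapLogD hc hP N) ih (fun i j => hW i (j + 1)) (fun i a b _ =>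
        (distWeight_mul_le h.irr hc' i.1 (a + 1) b).trans_eq (by congr 1; omega))
    simp only [hd]
    exact h1

lemma derivBound_scaledGap (s N : ℕ) :
    DerivBound N (fun i : ℕ × ℝ => scaledGap B ρ (i.1 + 1)) Prod.snd
      fun i => distWeight ρ (s / 8) i.1 := by
  induction s generalizing N with
  | zero => simpa using h.derivBound_scaledGap_base N
  | succ s ih =>
    have := h.derivBound_scaledGap_step (by positivity) ih N
    convert this using 3
    push_cast
    ring

lemma exists_iteratedDeriv_gapLogD_sub_le (j : ℕ) : ∃ C, 0 ≤ C ∧ ∀ n x,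
    |iteratedDeriv j (fun y => gapLogD B ρ (n + 1) y - gapLogD B ρ n y) x| ≤
      C * cfDist ρ n := by
  obtain ⟨C, hC, hb⟩ := h.derivBound_gapLogD_sub (by positivity)
    (h.derivBound_scaledGap (6 * (j + 2))) j
  refine ⟨C, hC, fun n x => (hb (n, x) j le_rfl).trans_eq ?_⟩
  have : distWeight ρ ((6 * (j + 2) : ℕ) / 8) n (j + 2) = 1 := by
    rw [distWeight, max_eq_left, neg_zero, Real.rpow_zero]
    push_cast
    linarith
  simp only [this, mul_one]

end DioLift

/-! ### The conjugacy -/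

lemma eq_of_deriv_eq {f g : ℝ → ℝ} (hf : Differentiable ℝ f) (hg : Differentiable ℝ g)
    (h : ∀ x, deriv f x = deriv g x) (x y : ℝ) : f x - g x = f y - g y :=
  is_const_of_deriv_eq_zero (f := fun x => f x - g x) (hf.sub hg) (fun x => by
    rw [deriv_fun_sub (hf x) (hg x), h, sub_self]) x y

/-- The primitive of a smooth function. -/
lemma exists_smooth_primitive {f : ℝ → ℝ} (hf : ContDiff ℝ ∞ f) :
    ContDiff ℝ ∞ (fun x => ∫ t in (0:ℝ)..x, f t) ∧
      ∀ x, HasDerivAt (fun x => ∫ t in (0:ℝ)..x, f t) (f x) x := by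
  have hd : ∀ x, HasDerivAt (fun x => ∫ t in (0:ℝ)..x, f t) (f x) x := fun x =>
    intervalIntegral.integral_hasDerivAt_right (hf.continuous.intervalIntegrable _ _)
      hf.continuous.stronglyMeasurable.stronglyMeasurableAtFilter hf.continuous.continuousAt
  refine ⟨contDiff_infty_iff_deriv.2 ⟨fun x => (hd x).differentiableAt, ?_⟩, hd⟩
  rwa [show deriv (fun x => ∫ t in (0:ℝ)..x, f t) = f from funext fun x => (hd x).deriv]

lemma summable_cfDist {ρ : ℝ} (hρ : Irrational ρ) : Summable (cfDist ρ) := by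
  obtain ⟨S, -, hS⟩ := sum_cfDist_rpow_le hρ one_pos
  refine summable_of_sum_range_le (c := S) (fun n => (cfDist_pos hρ n).le) fun n => ?_
  simpa using hS n

namespace DioLift

variable {B : ℝ → ℝ} {ρ : ℝ} (h : DioLift B ρ)
include h

lemma exists_limit_gapLogD : ∃ Y : ℝ → ℝ, ContDiff ℝ ∞ Y ∧
    ∀ x, Tendsto (fun n => gapLogD B ρ n x) atTop (nhds (Y x)) := by
  have hs : ∀ n, ContDiff ℝ ∞ (fun y => gapLogD B ρ (n + 1) y - gapLogD B ρ n y) := fun n =>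
    (h.smooth_gapLogD (n + 1)).sub (h.smooth_gapLogD n)
  choose C hC hb using h.exists_iteratedDeriv_gapLogD_sub_le
  have hsum : ∀ k, Summable fun n => C k * cfDist ρ n := fun k => (summable_cfDist h.irr).mul_left _
  refine ⟨fun x => ∑' n, (gapLogD B ρ (n + 1) x - gapLogD B ρ n x), ?_, fun x => ?_⟩
  · refine contDiff_tsum (v := fun k n => C k * cfDist ρ n) hs (fun k _ => hsum k) fun k n x _ => ?_
    rw [norm_iteratedFDeriv_eq_norm_iteratedDeriv]
    exact hb k n x
  · have h1 : Summable fun n => gapLogD B ρ (n + 1) x - gapLogD B ρ n x :=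
      Summable.of_norm_bounded (hsum 0) fun n => by simpa using hb 0 n x
    have h2 := h1.hasSum.tendsto_sum_nat
    simpa only [Finset.sum_range_sub (fun n => gapLogD B ρ n x), gapLogD_zero, sub_zero] using h2

lemma exists_gapLogD_bound : ∃ C, ∀ n x, |gapLogD B ρ n x| ≤ C := by
  obtain ⟨C, hC, hb⟩ := h.exists_iteratedDeriv_gapLogD_sub_le 0
  refine ⟨∑' n, C * cfDist ρ n, fun n x => ?_⟩
  have h1 := h.iteratedDeriv_gapLogD n 0 x
  rw [iteratedDeriv_zero] at h1
  rw [h1]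
  refine (Finset.abs_sum_le_sum_abs _ _).trans ((Finset.sum_le_sum fun m _ => hb m x).trans ?_)
  exact ((summable_cfDist h.irr).mul_left C).sum_le_tsum _
    fun m _ => mul_nonneg hC (cfDist_pos h.irr m).le

lemma log_scaledGap_sub (n : ℕ) (x : ℝ) :
    Real.log (scaledGap B ρ n x) - Real.log (scaledGap B ρ n 0) =
      ∫ t in (0:ℝ)..x, gapLogD B ρ n t := by
  refine (intervalIntegral.integral_eq_sub_of_hasDerivAt
    (f := fun t => Real.log (scaledGap B ρ n t)) (fun t _ => ?_)
    ((h.smooth_gapLogD n).continuous.intervalIntegrable _ _)).symm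
  exact (((h.smooth_scaledGap n).diff_infty t).hasDerivAt.log (h.scaledGap_pos n t).ne')

lemma tendsto_gap (x : ℝ) : Tendsto (fun n => gap B ρ n x) atTop (nhds 0) := by
  obtain ⟨A, hA, hb⟩ := h.exists_gap_compare_cfDist
  have h1 := (summable_cfDist h.irr).tendsto_atTop_zero.const_mul A
  rw [mul_zero] at h1
  exact squeeze_zero (fun n => (h.gap_pos n x).le) (fun n => (hb n x).1) h1

lemma tendsto_log_scaledGap_sub (x : ℝ) :
    Tendsto (fun n => Real.log (scaledGap B ρ n (B x)) - Real.log (scaledGap B ρ n x)) atTop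
      (nhds (Real.log (deriv B x))) := by
  have h1 : ∀ n, ∃ ξ ∈ Set.uIcc x (ret B ρ n x), gap B ρ n (B x) = deriv B ξ * gap B ρ n x :=
    fun n => by simpa [tr] using h.gap_tr_eq_deriv n 1 0 x
  choose ξ hξ he using h1
  have h2 : ∀ n, Real.log (scaledGap B ρ n (B x)) - Real.log (scaledGap B ρ n x) =
      Real.log (deriv B (ξ n)) := fun n => by
    have e : scaledGap B ρ n (B x) = deriv B (ξ n) * scaledGap B ρ n x := by
      rw [scaledGap, scaledGap, he, mul_div_assoc]
    rw [e, Real.log_mul (h.deriv_pos _).ne' (h.scaledGap_pos n x).ne', add_sub_cancel_right]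
  have h3 : Tendsto ξ atTop (nhds x) := by
    rw [tendsto_iff_dist_tendsto_zero]
    refine squeeze_zero (fun _ => dist_nonneg) (fun n => ?_) (h.tendsto_gap x)
    rw [Real.dist_eq, h.gap_eq_abs]
    exact Set.abs_sub_left_of_mem_uIcc (hξ n)
  simp only [h2]
  exact (((smooth_deriv h.smooth).continuous.continuousAt.tendsto.comp h3).log (h.deriv_pos x).ne')

lemma exists_periodic_potential : ∃ Φ : ℝ → ℝ, ContDiff ℝ ∞ Φ ∧ (∀ x, Φ (x + 1) = Φ x) ∧
    ∀ x, Φ (B x) - Φ x = Real.log (deriv B x) := by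
  obtain ⟨Y, hY, hlim⟩ := h.exists_limit_gapLogD
  obtain ⟨C, hC⟩ := h.exists_gapLogD_bound
  have hΦ : ∀ x, Tendsto (fun n => Real.log (scaledGap B ρ n x) - Real.log (scaledGap B ρ n 0))
      atTop (nhds (∫ t in (0:ℝ)..x, Y t)) := fun x => by
    simp only [h.log_scaledGap_sub]
    exact intervalIntegral.tendsto_integral_filter_of_dominated_convergence (fun _ => C)
      (Eventually.of_forall fun n => (h.smooth_gapLogD n).continuous.aestronglyMeasurable)
      (Eventually.of_forall fun n => Eventually.of_forall fun t _ => hC n t)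
      intervalIntegrable_const (Eventually.of_forall fun t _ => hlim t)
  refine ⟨fun x => ∫ t in (0:ℝ)..x, Y t, (exists_smooth_primitive hY).1, fun x => ?_, fun x => ?_⟩
  · refine tendsto_nhds_unique (hΦ (x + 1)) ?_
    have : ∀ n, scaledGap B ρ n (x + 1) = scaledGap B ρ n x := fun n => by
      rw [scaledGap, h.gap_add_one, scaledGap]
    simpa only [this] using hΦ x
  · refine tendsto_nhds_unique ((hΦ (B x)).sub (hΦ x)) ?_
    simpa only [sub_sub_sub_cancel_right] using h.tendsto_log_scaledGap_sub x

lemma exists_conjugacy_const : ∃ Ψ : ℝ → ℝ, ContDiff ℝ ∞ Ψ ∧ (∀ x, Ψ (x + 1) = Ψ x + 1) ∧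
    (∀ x, 0 < deriv Ψ x) ∧ ∃ κ, ∀ x, Ψ (B x) = Ψ x + κ := by
  obtain ⟨Φ, hΦ, hper, hcoh⟩ := h.exists_periodic_potential
  obtain ⟨hs, hd⟩ := exists_smooth_primitive (Real.contDiff_exp.comp hΦ.neg)
  set P : ℝ → ℝ := fun x => ∫ t in (0:ℝ)..x, (Real.exp ∘ fun x => -Φ x) t
  have hd' : ∀ x, deriv P x = Real.exp (-Φ x) := fun x => (hd x).deriv
  have hP : Differentiable ℝ P := hs.diff_infty
  have hmono : StrictMono P := strictMono_of_deriv_pos fun x => by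
    rw [hd']; exact Real.exp_pos _
  have hc : 0 < P 1 - P 0 := sub_pos.2 (hmono one_pos)
  have h1 : ∀ x, P (x + 1) - P x = P 1 - P 0 := fun x => by
    have := eq_of_deriv_eq (f := fun x => P (x + 1)) (hP.comp (differentiable_id.add_const 1)) hP
      (fun x => by rw [deriv_comp_add_const, hd', hd', hper]) x 0
    simpa using this
  have hB : ∀ x, P (B x) - P x = P (B 0) - P 0 := fun x => by
    have hBd := h.smooth.diff_infty
    refine eq_of_deriv_eq (f := fun x => P (B x)) (hP.comp hBd) hP (fun x => ?_) x 0
    have e := ((hd (B x)).comp x (hBd x).hasDerivAt).deriv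
    refine e.trans ?_
    rw [hd', Function.comp_apply]
    have : Φ (B x) = Φ x + Real.log (deriv B x) := by linarith [hcoh x]
    rw [this, neg_add, Real.exp_add, Real.exp_neg (Real.log _), Real.exp_log (h.deriv_pos x),
      mul_assoc, inv_mul_cancel₀ (h.deriv_pos x).ne', mul_one]
  refine ⟨fun x => P x / (P 1 - P 0), hs.div_const _, fun x => ?_, fun x => ?_,
    (P (B 0) - P 0) / (P 1 - P 0), fun x => ?_⟩
  · have := h1 x
    field_simp
    linarith
  · rw [deriv_div_const, hd']
    positivity
  · rw [← add_div]
    refine congrArg (· / (P 1 - P 0)) ?_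
    linarith [hB x]

end DioLift

lemma eq_of_conjugacy {B Ψ : ℝ → ℝ} {ρ κ : ℝ}
    (hρ : Tendsto (fun n : ℕ => B^[n] 0 / (n : ℝ)) atTop (nhds ρ)) (hΨ : Continuous Ψ)
    (hone : ∀ x, Ψ (x + 1) = Ψ x + 1) (hκ : ∀ x, Ψ (B x) = Ψ x + κ) : κ = ρ := by
  obtain ⟨C, -, hb⟩ := exists_abs_le_of_periodic (f := fun x => Ψ x - x) (by fun_prop)
    (fun x => by rw [hone]; ring)
  have hit : ∀ n : ℕ, Ψ (B^[n] 0) = Ψ 0 + n * κ := fun n => by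
    induction n with
    | zero => simp
    | succ n ih => rw [Function.iterate_succ_apply', hκ, ih]; push_cast; ring
  refine tendsto_nhds_unique ?_ hρ
  have hz : Tendsto (fun n : ℕ => (2 * C) / (n : ℝ)) atTop (nhds 0) :=
    tendsto_const_div_atTop_nhds_zero_nat _
  refine tendsto_iff_norm_sub_tendsto_zero.2 (squeeze_zero' (Eventually.of_forall
    fun _ => norm_nonneg _) ((eventually_gt_atTop 0).mono fun n hn => ?_) hz)
  have hn' : (0 : ℝ) < n := by exact_mod_cast hn
  have h1 := abs_le.1 (hb (B^[n] 0))
  have h2 := abs_le.1 (hb 0)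
  rw [hit] at h1
  have e : B^[n] 0 / (n : ℝ) - κ = (B^[n] 0 - n * κ) / n := by field_simp
  rw [e, Real.norm_eq_abs, abs_div, abs_of_pos hn']
  refine div_le_div_of_nonneg_right (abs_le.2 ⟨?_, ?_⟩) hn'.le <;> linarith [h1.1, h1.2, h2.1, h2.2]

lemma DioLift.of_tendsto {B : ℝ → ℝ} {ρ : ℝ} (hB : ContDiff ℝ ∞ B)
    (hlift : ∀ x, B (x + 1) = B x + 1) (hpos : ∀ x, 0 < deriv B x)
    (hρ : Tendsto (fun n : ℕ => B^[n] 0 / (n : ℝ)) atTop (nhds ρ)) (hdio : Diophantine ρ) :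
    DioLift B ρ := by
  set f : CircleDeg1Lift := ⟨⟨B, (strictMono_of_deriv_pos hpos).monotone⟩, hlift⟩ with hf
  have hfB : ∀ n, ⇑(f ^ n) = B^[n] := fun n => CircleDeg1Lift.coe_pow f n
  have hτ : CircleDeg1Lift.translationNumber f = ρ := f.translationNumber_eq_of_tendsto₀ hρ
  have hτn : ∀ n : ℕ, CircleDeg1Lift.translationNumber (f ^ n) = n * ρ := fun n => by
    rw [CircleDeg1Lift.translationNumber_pow, hτ]
  refine ⟨hB, hlift, hpos, hdio, fun i j k l x hlt => ?_⟩
  rcases le_total i j with hij | hij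
  · obtain ⟨d, rfl⟩ := Nat.exists_eq_add_of_le' hij
    push_cast at hlt
    have h1 := (f ^ d).lt_map_of_int_lt_translationNumber (n := k - l)
      (by rw [hτn]; push_cast; linarith) (B^[i] x)
    rw [hfB, ← Function.iterate_add_apply] at h1
    push_cast at h1
    linarith
  · obtain ⟨d, rfl⟩ := Nat.exists_eq_add_of_le' hij
    push_cast at hlt
    have h1 := (f ^ d).map_lt_of_translationNumber_lt_int (n := l - k)
      (by rw [hτn]; push_cast; linarith) (B^[j] x)
    rw [hfB, ← Function.iterate_add_apply] at h1
    push_cast at h1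
    linarith

/-- Herman–Yoccoz: a smooth circle diffeomorphism with Diophantine rotation number
is smoothly conjugate to the rotation by its rotation number. -/
theorem stmt_3 (B : ℝ → ℝ) (hB : ContDiff ℝ (⊤ : ℕ∞) B)
    (hlift : ∀ x, B (x + 1) = B x + 1) (hpos : ∀ x, 0 < deriv B x)
    (ρ : ℝ) (hρ : Tendsto (fun n : ℕ => B^[n] 0 / (n : ℝ)) atTop (nhds ρ))
    (hdio : Diophantine ρ) :
    ∃ Ψ : ℝ → ℝ, ContDiff ℝ (⊤ : ℕ∞) Ψ ∧ (∀ x, Ψ (x + 1) = Ψ x + 1) ∧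
      (∀ x, 0 < deriv Ψ x) ∧ ∀ x, Ψ (B x) = Ψ x + ρ := by
  obtain ⟨Ψ, hΨ, hone, hd, κ, hκ⟩ :=
    (DioLift.of_tendsto hB hlift hpos hρ hdio).exists_conjugacy_const
  exact ⟨Ψ, hΨ, hone, hd, eq_of_conjugacy hρ hΨ.continuous hone hκ ▸ hκ⟩
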